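/- arXiv:1402.6496 — 6 statements merged into one kernel-verified Lean document; each statement's English description precedes it below -/
import Mathlib

section
/- Let d ≥ 2, let V ⊂ S^{d-1} be finite, and suppose P = conv V is a d-dimensional polytope whose vertex set is V and which satisfies Property Z. Let p₁, p₂ ∈ V be distinct points such that every facet of P contains exactly one of p₁ and p₂, and such that for every S ⊂ V \ {p₁,p₂}, conv(S ∪ {p₁}) is a facet of P if and only if conv(S ∪ {p₂}) is a facet of P. Then p₂ = −p₁, and ⟨v, p₁⟩ = 0 for every v ∈ V \ {p₁, p₂}; that is, P is a d-bipyramid whose apexes p₁, p₂ are antipodal and whose base conv(V \ {p₁,p₂}) lies in the linear hyperplane orthogonal to [p₁,p₂]. -/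
open MeasureTheory Real RealInnerProductSpace

/-- Property Z for a polytope inscribed in the unit sphere with vertex set `V`. -/
def PropertyZ {d : ℕ} (V : Set (EuclideanSpace ℝ (Fin d))) : Prop :=
  ∀ p ∈ V, ∃ ε > (0 : ℝ), ∀ q ∈ Metric.sphere (0 : EuclideanSpace ℝ (Fin d)) 1,
    dist q p < ε →
      volume (convexHull ℝ ((V \ {p}) ∪ {q})) ≤ volume (convexHull ℝ V)

/-- A facet of a `d`-dimensional polytope `P ⊆ ℝ^d` is a `(d-1)`-dimensional exposed face. -/
def IsFacet {d : ℕ} (P F : Set (EuclideanSpace ℝ (Fin d))) : Prop :=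
  IsExposed ℝ P F ∧ Module.finrank ℝ (affineSpan ℝ F).direction = d - 1

section lines
variable {d : ℕ}

lemma volume_eq_line (u : EuclideanSpace ℝ (Fin d)) (hu : u ≠ 0)
    (A : Set (EuclideanSpace ℝ (Fin d))) (hA : MeasurableSet A) :
    volume A = ∫⁻ x, ({x | 0 ≤ ⟪x, u⟫ ∧ ⟪x, u⟫ < ‖u‖ ^ 2} :
      Set (EuclideanSpace ℝ (Fin d))).indicator 1 x * volume {τ : ℝ | x + τ • u ∈ A} := by
  set W : Set (EuclideanSpace ℝ (Fin d)) := {x | 0 ≤ ⟪x, u⟫ ∧ ⟪x, u⟫ < ‖u‖ ^ 2} with hWdef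
  have hun : 0 < ‖u‖ ^ 2 := by positivity
  have hW : MeasurableSet W := by
    have hm : Measurable (fun x : EuclideanSpace ℝ (Fin d) => ⟪x, u⟫) := by fun_prop
    exact (measurableSet_le measurable_const hm).inter (measurableSet_lt hm measurable_const)
  have h1 : ∀ x : EuclideanSpace ℝ (Fin d), volume {τ : ℝ | x + τ • u ∈ A} =
      ∫⁻ τ : ℝ, A.indicator 1 (x + τ • u) := by
    intro x
    have hm : MeasurableSet {τ : ℝ | x + τ • u ∈ A} := by
      have : Measurable (fun τ : ℝ => x + τ • u) := by fun_prop
      exact this hA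
    rw [← lintegral_indicator_one hm]
    rfl
  have h2 : ∀ x : EuclideanSpace ℝ (Fin d), ∫⁻ τ : ℝ, W.indicator (1 : EuclideanSpace ℝ (Fin d) → ENNReal) (x - τ • u) = 1 := by
    intro x
    have hs : {τ : ℝ | x - τ • u ∈ W} = Set.Ioc (⟪x, u⟫ / ‖u‖ ^ 2 - 1) (⟪x, u⟫ / ‖u‖ ^ 2) := by
      ext τ
      simp only [hWdef, Set.mem_ofPred_eq, Set.mem_Ioc, inner_sub_left, inner_smul_left,
        real_inner_self_eq_norm_sq, conj_trivial]
      rw [sub_lt_iff_lt_add (a := ⟪x, u⟫ / ‖u‖ ^ 2), div_lt_iff₀ hun, le_div_iff₀ hun]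
      constructor <;> rintro ⟨a, b⟩ <;> constructor <;> nlinarith
    have hm : MeasurableSet {τ : ℝ | x - τ • u ∈ W} := by
      rw [hs]; exact measurableSet_Ioc
    have : (fun τ : ℝ => W.indicator (1 : EuclideanSpace ℝ (Fin d) → ENNReal) (x - τ • u)) =
        {τ : ℝ | x - τ • u ∈ W}.indicator 1 := rfl
    rw [this, lintegral_indicator_one hm, hs]
    simp
  have hf1 : Measurable (W.indicator (1 : EuclideanSpace ℝ (Fin d) → ENNReal)) := measurable_one.indicator hW
  have hf2 : Measurable (A.indicator (1 : EuclideanSpace ℝ (Fin d) → ENNReal)) := measurable_one.indicator hA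
  symm
  calc ∫⁻ x, W.indicator 1 x * volume {τ : ℝ | x + τ • u ∈ A}
      = ∫⁻ x, ∫⁻ τ : ℝ, W.indicator 1 x * A.indicator 1 (x + τ • u) := by
        refine lintegral_congr fun x => ?_
        rw [h1, lintegral_const_mul]
        exact hf2.comp (by fun_prop)
    _ = ∫⁻ τ : ℝ, ∫⁻ x, W.indicator 1 x * A.indicator 1 (x + τ • u) := by
        apply lintegral_lintegral_swap
        apply Measurable.aemeasurable
        apply Measurable.mul
        · exact hf1.comp measurable_fst
        · exact hf2.comp (g := A.indicator (1 : EuclideanSpace ℝ (Fin d) → ENNReal))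
            (f := fun z : EuclideanSpace ℝ (Fin d) × ℝ => z.1 + z.2 • u) (by fun_prop)
    _ = ∫⁻ τ : ℝ, ∫⁻ x, W.indicator 1 (x - τ • u) * A.indicator 1 x := by
        refine lintegral_congr fun τ => ?_
        rw [← lintegral_sub_right_eq_self (fun x => W.indicator 1 x * A.indicator 1 (x + τ • u))
          (τ • u)]
        simp
    _ = ∫⁻ x, ∫⁻ τ : ℝ, W.indicator 1 (x - τ • u) * A.indicator 1 x := by
        apply lintegral_lintegral_swap
        apply Measurable.aemeasurable
        apply Measurable.mul
        · exact hf1.comp (g := W.indicator (1 : EuclideanSpace ℝ (Fin d) → ENNReal))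
            (f := fun z : ℝ × EuclideanSpace ℝ (Fin d) => z.2 - z.1 • u) (by fun_prop)
        · exact hf2.comp measurable_snd
    _ = ∫⁻ x, A.indicator 1 x := by
        refine lintegral_congr fun x => ?_
        rw [lintegral_mul_const, h2, one_mul]
        exact hf1.comp (by fun_prop)
    _ = volume A := lintegral_indicator_one hA

lemma volume_le_of_lines (u : EuclideanSpace ℝ (Fin d)) (hu : u ≠ 0)
    (A B : Set (EuclideanSpace ℝ (Fin d))) (hA : MeasurableSet A) (hB : MeasurableSet B)
    (h : ∀ x, volume {τ : ℝ | x + τ • u ∈ A} ≤ volume {τ : ℝ | x + τ • u ∈ B}) :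
    volume A ≤ volume B := by
  rw [volume_eq_line u hu A hA, volume_eq_line u hu B hB]
  exact lintegral_mono fun x => mul_le_mul_right (h x) _

/-- Moving a point on the sphere along a chord. -/
lemma sphere_move (s w e : EuclideanSpace ℝ (Fin d)) (hs : ‖s‖ = 1) (hw : w ≠ 0)
    (hsw : ⟪s, w⟫ = 0) (hse : ⟪s, e⟫ = 1) (η δ₁ : ℝ) (hη : 0 < η) (hδ₁ : 0 < δ₁) :
    ∃ δ ε : ℝ, 0 < δ ∧ δ < δ₁ ∧ 0 < ε ∧ ‖s + ε • (w - δ • e)‖ = 1 ∧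
      dist (s + ε • (w - δ • e)) s < η := by
  have hc : ContinuousAt (fun δ : ℝ => s + (2 * δ / ‖w - δ • e‖ ^ 2) • (w - δ • e)) 0 := by
    have : ‖w - (0:ℝ) • e‖ ^ 2 ≠ 0 := by simpa using hw
    have h2 : ContinuousAt (fun δ : ℝ => 2 * δ / ‖w - δ • e‖ ^ 2) 0 := by
      refine ContinuousAt.div (f := fun δ : ℝ => 2 * δ) (g := fun δ : ℝ => ‖w - δ • e‖ ^ 2)
        ?_ ?_ this <;> fun_prop
    exact continuousAt_const.add (h2.smul (by fun_prop))
  have hc2 : ContinuousAt (fun δ : ℝ => w - δ • e) 0 := by fun_prop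
  have h1 := Metric.tendsto_nhds.1 hc η hη
  have h2 : ∀ᶠ δ : ℝ in nhds 0, w - δ • e ≠ 0 := hc2.eventually_ne (by simpa using hw)
  have h3 : ∀ᶠ δ : ℝ in nhds 0, δ < δ₁ := eventually_lt_nhds hδ₁
  have h4 := ((h1.and (h2.and h3)).filter_mono (nhdsWithin_le_nhds (s := Set.Ioi 0))).and
    self_mem_nhdsWithin
  obtain ⟨δ, ⟨ha, hb, hc⟩, h0⟩ := h4.exists
  have h0 : 0 < δ := h0
  have hp : 0 < ‖w - δ • e‖ := norm_pos_iff.2 hb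
  refine ⟨δ, 2 * δ / ‖w - δ • e‖ ^ 2, h0, hc, by positivity, ?_, by simpa using ha⟩
  have : ‖s + (2 * δ / ‖w - δ • e‖ ^ 2) • (w - δ • e)‖ ^ 2 = 1 := by
    rw [norm_add_sq_real, norm_smul, inner_smul_right, inner_sub_right, inner_smul_right, hsw, hse,
      hs, Real.norm_of_nonneg (by positivity)]
    field_simp
    ring
  have h5 := norm_nonneg (s + (2 * δ / ‖w - δ • e‖ ^ 2) • (w - δ • e))
  nlinarith
end lines

section polar
variable {d : ℕ}

/-- The polar body of `conv V` with respect to the centre `z`. -/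
def polarBody (V : Set (EuclideanSpace ℝ (Fin d))) (z : EuclideanSpace ℝ (Fin d)) :
    Set (EuclideanSpace ℝ (Fin d)) := {n | ∀ v ∈ V, ⟪n, v - z⟫ ≤ 1}

/-- The vertices at which a functional in the polar body is tight. -/
def activeSet (V : Set (EuclideanSpace ℝ (Fin d))) (z n : EuclideanSpace ℝ (Fin d)) :
    Set (EuclideanSpace ℝ (Fin d)) := {v | v ∈ V ∧ ⟪n, v - z⟫ = 1}

variable {V : Set (EuclideanSpace ℝ (Fin d))} {z : EuclideanSpace ℝ (Fin d)}

lemma polarBody_hull {n : EuclideanSpace ℝ (Fin d)} (hn : n ∈ polarBody V z)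
    {x : EuclideanSpace ℝ (Fin d)} (hx : x ∈ convexHull ℝ V) : ⟪n, x - z⟫ ≤ 1 := by
  have hc : Convex ℝ {x : EuclideanSpace ℝ (Fin d) | ⟪n, x⟫ ≤ 1 + ⟪n, z⟫} :=
    convex_halfSpace_le (innerₗ _ n).isLinear _
  have : V ⊆ {x : EuclideanSpace ℝ (Fin d) | ⟪n, x⟫ ≤ 1 + ⟪n, z⟫} := by
    intro v hv
    have := hn v hv
    rw [inner_sub_right] at this
    show ⟪n, v⟫ ≤ 1 + ⟪n, z⟫
    linarith
  have h : ⟪n, x⟫ ≤ 1 + ⟪n, z⟫ := convexHull_min this hc hx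
  rw [inner_sub_right]; linarith

lemma polarBody_convex : Convex ℝ (polarBody V z) := by
  have : polarBody V z = ⋂ v ∈ V, {n | ⟪v - z, n⟫ ≤ 1} := by
    ext n; simp [polarBody, real_inner_comm]
  rw [this]
  exact convex_iInter₂ fun v _ => convex_halfSpace_le (innerₗ _ (v - z)).isLinear _

lemma polarBody_compact (hz : z ∈ interior (convexHull ℝ V)) : IsCompact (polarBody V z) := by
  apply Metric.isCompact_of_isClosed_isBounded
  · have : polarBody V z = ⋂ v ∈ V, {n | ⟪n, v - z⟫ ≤ 1} := by
      ext n; simp [polarBody]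
    rw [this]
    exact isClosed_biInter fun v _ => isClosed_le (by fun_prop) continuous_const
  · obtain ⟨r, hr, hb⟩ := Metric.mem_nhds_iff.1 (mem_interior_iff_mem_nhds.1 hz)
    refine (Metric.isBounded_iff_subset_closedBall 0).2 ⟨2 / r, fun n hn => ?_⟩
    rw [mem_closedBall_zero_iff]
    by_cases h0 : n = 0
    · subst h0; simp; positivity
    have hnn : 0 < ‖n‖ := norm_pos_iff.2 h0
    have h := polarBody_hull hn (x := z + (r / 2 / ‖n‖) • n) (hb (by
      rw [Metric.mem_ball, dist_eq_norm, add_sub_cancel_left, norm_smul,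
        Real.norm_of_nonneg (by positivity)]
      field_simp
      norm_num))
    rw [add_sub_cancel_left, inner_smul_right, real_inner_self_eq_norm_sq] at h
    rw [le_div_iff₀ hr]
    have : r / 2 / ‖n‖ * ‖n‖ ^ 2 = r / 2 * ‖n‖ := by field_simp
    linarith

lemma exists_extreme_separating (hfin : V.Finite) (hz : z ∈ interior (convexHull ℝ V))
    {y : EuclideanSpace ℝ (Fin d)} (hy : y ∉ convexHull ℝ V) :
    ∃ n ∈ (polarBody V z).extremePoints ℝ, 1 < ⟪n, y - z⟫ := by
  by_contra! hcon
  obtain ⟨f, a, h1, h2⟩ := geometric_hahn_banach_closed_point (convex_convexHull ℝ V)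
    (hfin.isCompact_convexHull ℝ).isClosed hy
  have hza := h1 z (interior_subset hz)
  set n := (a - f z)⁻¹ • (InnerProductSpace.toDual ℝ _).symm f with hndef
  have hn : ∀ x, ⟪n, x - z⟫ = (f x - f z) / (a - f z) := by
    intro x
    rw [hndef, inner_smul_left, InnerProductSpace.toDual_symm_apply, map_sub]
    simp; ring
  have hpos : 0 < a - f z := by linarith
  have hnD : n ∈ polarBody V z := by
    intro v hv
    rw [hn, div_le_one hpos]
    have := h1 v (subset_convexHull ℝ V hv)
    linarith
  have hny : 1 < ⟪n, y - z⟫ := by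
    rw [hn, one_lt_div hpos]; linarith
  rw [← closure_convexHull_extremePoints (polarBody_compact hz) polarBody_convex] at hnD
  have : closure (convexHull ℝ ((polarBody V z).extremePoints ℝ)) ⊆ {m | ⟪y - z, m⟫ ≤ 1} := by
    apply closure_minimal
    · apply convexHull_min
      · intro m hm
        have := hcon m hm
        rw [real_inner_comm] at this
        exact this
      · exact convex_halfSpace_le (innerₗ _ (y - z)).isLinear _
    · exact isClosed_le (by fun_prop) continuous_const
  have h3 : ⟪y - z, n⟫ ≤ 1 := this hnD
  rw [real_inner_comm] at h3
  linarith

lemma active_span (hfin : V.Finite) {n : EuclideanSpace ℝ (Fin d)}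
    (hn : n ∈ (polarBody V z).extremePoints ℝ) :
    Submodule.span ℝ ((fun v => v - z) '' activeSet V z n) = ⊤ := by
  by_contra hne
  rw [← Submodule.orthogonal_eq_bot_iff, Submodule.eq_bot_iff] at hne
  push Not at hne
  obtain ⟨w, hw, hw0⟩ := hne
  have hwa : ∀ v ∈ activeSet V z n, ⟪w, v - z⟫ = 0 := by
    intro v hv
    rw [real_inner_comm]
    exact (Submodule.mem_orthogonal _ _).1 hw _ (Submodule.subset_span ⟨v, hv, rfl⟩)
  have key : ∀ᶠ ε : ℝ in nhds 0, n + ε • w ∈ polarBody V z := by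
    have : ∀ᶠ ε : ℝ in nhds 0, ∀ v ∈ V, ⟪n + ε • w, v - z⟫ ≤ 1 := by
      rw [Filter.eventually_all_finite hfin]
      intro v hv
      by_cases hva : ⟪n, v - z⟫ = 1
      · refine Filter.Eventually.of_forall fun ε => ?_
        rw [inner_add_left, inner_smul_left, hwa v ⟨hv, hva⟩, hva]; simp
      · have hlt : ⟪n, v - z⟫ < 1 := lt_of_le_of_ne (hn.1 v hv) hva
        have hc : ContinuousAt (fun ε : ℝ => ⟪n + ε • w, v - z⟫) 0 := by fun_prop
        exact (hc.eventually_lt continuousAt_const (by simpa using hlt)).mono fun _ h => h.le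
    exact this
  have key2 : ∀ᶠ ε : ℝ in nhds 0, n + (-ε) • w ∈ polarBody V z := by
    have : Filter.Tendsto (fun ε : ℝ => -ε) (nhds 0) (nhds 0) := by
      simpa using (continuous_neg (G := ℝ)).tendsto 0
    exact this.eventually key
  obtain ⟨ε, ⟨ha, hb⟩, hε⟩ := (((key.and key2).filter_mono
    (nhdsWithin_le_nhds (s := Set.Ioi 0))).and self_mem_nhdsWithin).exists
  have hε : 0 < ε := hε
  have := (mem_extremePoints.1 hn).2 _ ha _ hb ⟨1/2, 1/2, by norm_num, by norm_num, by norm_num, by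
    module⟩
  have h := this.1
  simp [hε.ne', hw0] at h

lemma extreme_finite (hfin : V.Finite) : ((polarBody V z).extremePoints ℝ).Finite := by
  apply Set.Finite.of_finite_image (f := activeSet V z)
  · apply hfin.finite_subsets.subset
    rintro _ ⟨n, hn, rfl⟩
    exact fun v hv => hv.1
  · intro n hn m hm hnm
    have hs := active_span hfin hn
    have : n - m ∈ (Submodule.span ℝ ((fun v => v - z) '' activeSet V z n))ᗮ := by
      rw [Submodule.mem_orthogonal']
      intro x hx
      induction hx using Submodule.span_induction with
      | mem x hx =>
        obtain ⟨v, hv, rfl⟩ := hx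
        have h2 := hv
        rw [hnm] at h2
        simp only
        rw [inner_sub_left, hv.2, h2.2, sub_self]
      | zero => simp
      | add x y _ _ h1 h2 => rw [inner_add_right, h1, h2, add_zero]
      | smul a x _ h => rw [inner_smul_right, h, mul_zero]
    rw [hs, Submodule.top_orthogonal_eq_bot, Submodule.mem_bot] at this
    exact sub_eq_zero.1 this

lemma exists_extreme_at (hfin : V.Finite) (hz : z ∈ interior (convexHull ℝ V))
    {x e : EuclideanSpace ℝ (Fin d)} (hx : x ∈ convexHull ℝ V)
    (he : ∀ τ : ℝ, 0 < τ → x + τ • e ∉ convexHull ℝ V) :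
    ∃ n ∈ (polarBody V z).extremePoints ℝ, ⟪n, x - z⟫ = 1 ∧ 0 < ⟪n, e⟫ := by
  have key : ∀ᶠ τ : ℝ in nhds 0, ∀ n ∈ (polarBody V z).extremePoints ℝ,
      ⟪n, x - z⟫ < 1 → ⟪n, x + τ • e - z⟫ < 1 := by
    rw [Filter.eventually_all_finite (extreme_finite hfin)]
    intro n hn
    by_cases h : ⟪n, x - z⟫ < 1
    · have hc : ContinuousAt (fun τ : ℝ => ⟪n, x + τ • e - z⟫) 0 := by fun_prop
      exact (hc.eventually_lt continuousAt_const (by simpa using h)).mono fun _ h _ => h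
    · exact Filter.Eventually.of_forall fun _ h' => absurd h' h
  obtain ⟨τ, ha, hτ⟩ := ((key.filter_mono
    (nhdsWithin_le_nhds (s := Set.Ioi 0))).and self_mem_nhdsWithin).exists
  have hτ : 0 < τ := hτ
  obtain ⟨n, hn, h1⟩ := exists_extreme_separating hfin hz (he τ hτ)
  have h2 : ⟪n, x - z⟫ = 1 := by
    by_contra h
    have := ha n hn (lt_of_le_of_ne (polarBody_hull hn.1 hx) h)
    linarith
  refine ⟨n, hn, h2, ?_⟩
  have h3 : x + τ • e - z = (x - z) + τ • e := by abel
  rw [h3, inner_add_right, h2, inner_smul_right] at h1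
  by_contra h4
  nlinarith

lemma facet_of_extreme (hfin : V.Finite) (hvert : (convexHull ℝ V).extremePoints ℝ = V)
    {n x : EuclideanSpace ℝ (Fin d)}
    (hn : n ∈ (polarBody V z).extremePoints ℝ) (hx : x ∈ convexHull ℝ V) (hnx : ⟪n, x - z⟫ = 1) :
    {y | y ∈ convexHull ℝ V ∧ ⟪n, y - z⟫ = 1} = convexHull ℝ (activeSet V z n) ∧
    IsFacet (convexHull ℝ V) (convexHull ℝ (activeSet V z n)) := by
  set F : Set (EuclideanSpace ℝ (Fin d)) := {y | y ∈ convexHull ℝ V ∧ ⟪n, y - z⟫ = 1} with hF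
  have hexp : IsExposed ℝ (convexHull ℝ V) F := by
    intro _
    refine ⟨innerSL ℝ n, ?_⟩
    ext y
    simp only [hF, Set.mem_ofPred_eq, innerSL_apply_apply]
    constructor
    · rintro ⟨hy, h1⟩
      refine ⟨hy, fun w hw => ?_⟩
      have := polarBody_hull hn.1 hw
      rw [inner_sub_right] at this h1
      linarith
    · rintro ⟨hy, h1⟩
      refine ⟨hy, ?_⟩
      have h2 := polarBody_hull hn.1 hy
      have h3 := h1 x hx
      rw [inner_sub_right] at h2 hnx ⊢
      linarith
  have hPc : IsCompact (convexHull ℝ V) := hfin.isCompact_convexHull ℝ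
  have hFA : F = convexHull ℝ (activeSet V z n) := by
    apply Set.Subset.antisymm
    · have hFc : IsCompact F := hexp.isCompact hPc
      rw [← closure_convexHull_extremePoints hFc (hexp.convex (convex_convexHull ℝ V))]
      have hAf : (activeSet V z n).Finite := hfin.subset fun v hv => hv.1
      apply closure_minimal _ (hAf.isCompact_convexHull ℝ).isClosed
      apply convexHull_mono
      intro v hv
      have h1 := hexp.isExtreme.extremePoints_subset_extremePoints hv
      rw [hvert] at h1
      exact ⟨h1, hv.1.2⟩
    · apply convexHull_min _ (hexp.convex (convex_convexHull ℝ V))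
      intro v hv
      exact ⟨subset_convexHull ℝ V hv.1, hv.2⟩
  refine ⟨hFA, hFA ▸ hexp, ?_⟩
  rw [affineSpan_convexHull, direction_affineSpan]
  have hne : (activeSet V z n).Nonempty := by
    rw [← convexHull_nonempty_iff (𝕜 := ℝ), ← hFA]
    exact ⟨x, hx, hnx⟩
  obtain ⟨a, ha⟩ := hne
  have hs := active_span hfin hn
  have hle : (⊤ : Submodule ℝ (EuclideanSpace ℝ (Fin d))) ≤
      vectorSpan ℝ (activeSet V z n) ⊔ Submodule.span ℝ {a - z} := by
    rw [← hs, Submodule.span_le]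
    rintro _ ⟨v, hv, rfl⟩
    have : v - z = (v -ᵥ a) + (a - z) := by simp
    simp only [this]
    exact Submodule.add_mem_sup (vsub_mem_vectorSpan ℝ hv ha) (Submodule.mem_span_singleton_self _)
  have h1 : d ≤ Module.finrank ℝ (vectorSpan ℝ (activeSet V z n)) + 1 := by
    have h2 := Submodule.finrank_mono hle
    rw [finrank_top, finrank_euclideanSpace_fin] at h2
    have h3 := Submodule.finrank_add_le_finrank_add_finrank (vectorSpan ℝ (activeSet V z n))
      (Submodule.span ℝ {a - z})
    have h4 : Module.finrank ℝ (Submodule.span ℝ {a - z}) ≤ 1 := by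
      simpa using finrank_span_le_card (R := ℝ) ({a - z} : Set (EuclideanSpace ℝ (Fin d)))
    omega
  have h2 : vectorSpan ℝ (activeSet V z n) < ⊤ := by
    rw [lt_top_iff_ne_top]
    intro htop
    have hk : vectorSpan ℝ (activeSet V z n) ≤ LinearMap.ker (innerₗ _ n) := by
      rw [vectorSpan_eq_span_vsub_set_right ℝ ha, Submodule.span_le]
      rintro _ ⟨v, hv, rfl⟩
      have e1 := hv.2
      have e2 := ha.2
      rw [inner_sub_right] at e1 e2
      simp [inner_sub_right]
      linarith
    rw [htop] at hk
    have h5 : ⟪n, a - z⟫ = 0 := hk (Submodule.mem_top : a - z ∈ ⊤)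
    rw [ha.2] at h5
    norm_num at h5
  have h3 := Submodule.finrank_lt h2.ne
  rw [finrank_euclideanSpace_fin] at h3
  omega
end polar

section main
variable {d : ℕ}

/-- Every top boundary point in direction `p₁ - p₂` lies in a facet through `p₁`, which is a
pyramid over a set that also spans a facet with `p₂`. -/
lemma exists_pair (hd : 2 ≤ d)
    (V : Set (EuclideanSpace ℝ (Fin d))) (hfin : V.Finite)
    (hdim : affineSpan ℝ V = ⊤)
    (hvert : (convexHull ℝ V).extremePoints ℝ = V)
    (p₁ p₂ : EuclideanSpace ℝ (Fin d)) (hp₁ : p₁ ∈ V) (hp₂ : p₂ ∈ V)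
    (hfacet : ∀ F : Set (EuclideanSpace ℝ (Fin d)), IsFacet (convexHull ℝ V) F →
      (p₁ ∈ F ∧ p₂ ∉ F) ∨ (p₁ ∉ F ∧ p₂ ∈ F))
    (hswap : ∀ S : Set (EuclideanSpace ℝ (Fin d)), S ⊆ V \ {p₁, p₂} →
      (IsFacet (convexHull ℝ V) (convexHull ℝ (S ∪ {p₁})) ↔
        IsFacet (convexHull ℝ V) (convexHull ℝ (S ∪ {p₂}))))
    (x : EuclideanSpace ℝ (Fin d)) (hx : x ∈ convexHull ℝ V)
    (hxu : ∀ τ : ℝ, 0 < τ → x + τ • (p₁ - p₂) ∉ convexHull ℝ V) :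
    ∃ (γ : ℝ) (σ : EuclideanSpace ℝ (Fin d)) (l₁ l₂ : EuclideanSpace ℝ (Fin d) →L[ℝ] ℝ),
      0 ≤ γ ∧ γ ≤ 1 ∧ σ ∈ convexHull ℝ V ∧ x = (1 - γ) • p₁ + γ • σ ∧
      (∀ y ∈ convexHull ℝ V, l₁ y ≤ l₁ p₁) ∧ l₁ p₂ < l₁ p₁ ∧
      (∀ y ∈ convexHull ℝ V, l₂ y ≤ l₂ p₂) ∧ l₂ p₁ < l₂ p₂ ∧ l₁ σ = l₁ p₁ ∧ l₂ σ = l₂ p₂ := by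
  obtain ⟨z, hz⟩ := interior_convexHull_nonempty_iff_affineSpan_eq_top.2 hdim
  obtain ⟨n, hn, hnx, hnu⟩ := exists_extreme_at hfin hz hx hxu
  obtain ⟨hF, hFac⟩ := facet_of_extreme hfin hvert hn hx hnx
  have hP₁ := subset_convexHull ℝ V hp₁
  have hP₂ := subset_convexHull ℝ V hp₂
  have hmem : ∀ y, y ∈ convexHull ℝ (activeSet V z n) ↔ y ∈ convexHull ℝ V ∧ ⟪n, y - z⟫ = 1 := by
    intro y; rw [← hF]; rfl
  have hcase : ⟪n, p₁ - z⟫ = 1 ∧ p₂ ∉ convexHull ℝ (activeSet V z n) := by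
    rcases hfacet _ hFac with ⟨h1, h2⟩ | ⟨h1, h2⟩
    · exact ⟨((hmem _).1 h1).2, h2⟩
    · exfalso
      have e1 := ((hmem _).1 h2).2
      have e2 := polarBody_hull hn.1 hP₁
      rw [inner_sub_right] at e1 e2 hnu
      linarith
  obtain ⟨hn₁, hn₂⟩ := hcase
  have hn₂' : ⟪n, p₂⟫ < ⟪n, p₁⟫ := by
    have e1 := polarBody_hull hn.1 hP₂
    have e2 : ⟪n, p₂ - z⟫ ≠ 1 := fun h => hn₂ ((hmem _).2 ⟨hP₂, h⟩)
    have e3 := lt_of_le_of_ne e1 e2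
    rw [inner_sub_right] at e3 hn₁
    linarith
  set S := activeSet V z n \ {p₁} with hS
  have hSV : S ⊆ V \ {p₁, p₂} := by
    rintro v ⟨hv, hv1⟩
    refine ⟨hv.1, ?_⟩
    rintro (h | h)
    · exact hv1 h
    · have h : v = p₂ := h
      subst h
      exact hn₂ (subset_convexHull ℝ _ hv)
  have hSA : S ∪ {p₁} = activeSet V z n := by
    rw [hS, Set.sdiff_union_self, Set.union_eq_left, Set.singleton_subset_iff]
    exact ⟨hp₁, hn₁⟩
  have hSne : S.Nonempty := by
    by_contra h
    rw [Set.not_nonempty_iff_eq_empty] at h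
    have h2 := hFac.2
    rw [← hSA, h] at h2
    rw [affineSpan_convexHull, direction_affineSpan, Set.empty_union, vectorSpan_singleton,
      finrank_bot] at h2
    omega
  have hFac₂ := (hswap S hSV).1 (hSA ▸ hFac)
  have hp₂F : p₂ ∈ convexHull ℝ (S ∪ {p₂}) := subset_convexHull ℝ _ (by simp)
  have hp₁F : p₁ ∉ convexHull ℝ (S ∪ {p₂}) := by
    rcases hfacet _ hFac₂ with ⟨h1, h2⟩ | ⟨h1, h2⟩
    · exact absurd hp₂F h2
    · exact h1
  obtain ⟨l₂, hl₂⟩ := hFac₂.1 ⟨p₂, hp₂F⟩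
  have hmem₂ : ∀ y, y ∈ convexHull ℝ (S ∪ {p₂}) ↔
      y ∈ convexHull ℝ V ∧ ∀ w ∈ convexHull ℝ V, l₂ w ≤ l₂ y := by
    intro y; rw [hl₂]; rfl
  have hl₂max := ((hmem₂ _).1 hp₂F).2
  rw [← hSA, Set.union_singleton] at hmem
  have hxm := (hmem x).2 ⟨hx, hnx⟩
  rw [convexHull_insert hSne, mem_convexJoin] at hxm
  obtain ⟨a, rfl, σ, hσ, α, γ, hα, hγ, hαγ, hxe⟩ := hxm
  have hσ₁ := (hmem σ).1 (convexHull_mono (Set.subset_insert _ _) hσ)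
  have hσ₂ := (hmem₂ σ).1 (convexHull_mono Set.subset_union_left hσ)
  refine ⟨γ, σ, innerSL ℝ n, l₂, hγ, by linarith, hσ₁.1, ?_, ?_, ?_, hl₂max, ?_, ?_, ?_⟩
  · rw [← hxe, ← hαγ]; simp
  · intro y hy
    have := polarBody_hull hn.1 hy
    rw [inner_sub_right] at this hn₁
    simp only [innerSL_apply_apply]
    linarith
  · simpa using hn₂'
  · by_contra hlt
    push Not at hlt
    exact hp₁F ((hmem₂ _).2 ⟨hP₁, fun w hw => (hl₂max w hw).trans hlt⟩)
  · have := hσ₁.2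
    rw [inner_sub_right] at this hn₁
    simp only [innerSL_apply_apply]
    linarith
  · exact le_antisymm (hl₂max _ hσ₁.1) (hσ₂.2 _ hP₂)

/-- Description of the fibre of `conv V` in direction `p₁ - p₂`. -/
lemma exists_fibre (hd : 2 ≤ d)
    (V : Set (EuclideanSpace ℝ (Fin d))) (hfin : V.Finite)
    (hdim : affineSpan ℝ V = ⊤)
    (hvert : (convexHull ℝ V).extremePoints ℝ = V)
    (p₁ p₂ : EuclideanSpace ℝ (Fin d)) (hp₁ : p₁ ∈ V) (hp₂ : p₂ ∈ V) (hne : p₁ ≠ p₂)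
    (hfacet : ∀ F : Set (EuclideanSpace ℝ (Fin d)), IsFacet (convexHull ℝ V) F →
      (p₁ ∈ F ∧ p₂ ∉ F) ∨ (p₁ ∉ F ∧ p₂ ∈ F))
    (hswap : ∀ S : Set (EuclideanSpace ℝ (Fin d)), S ⊆ V \ {p₁, p₂} →
      (IsFacet (convexHull ℝ V) (convexHull ℝ (S ∪ {p₁})) ↔
        IsFacet (convexHull ℝ V) (convexHull ℝ (S ∪ {p₂}))))
    (x : EuclideanSpace ℝ (Fin d)) (hx : x ∈ convexHull ℝ V) :
    ∃ (τ γ : ℝ) (σ : EuclideanSpace ℝ (Fin d)) (l₁ l₂ : EuclideanSpace ℝ (Fin d) →L[ℝ] ℝ),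
      0 ≤ γ ∧ γ ≤ 1 ∧ σ ∈ convexHull ℝ V ∧ x + τ • (p₁ - p₂) = (1 - γ) • p₁ + γ • σ ∧
      (∀ y ∈ convexHull ℝ V, l₁ y ≤ l₁ p₁) ∧ l₁ p₂ < l₁ p₁ ∧
      (∀ y ∈ convexHull ℝ V, l₂ y ≤ l₂ p₂) ∧ l₂ p₁ < l₂ p₂ ∧ l₁ σ = l₁ p₁ ∧ l₂ σ = l₂ p₂ ∧
      (∀ κ : ℝ, x + κ • (p₁ - p₂) ∈ convexHull ℝ V → τ - (1 - γ) ≤ κ ∧ κ ≤ τ) := by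
  have hPc : IsCompact (convexHull ℝ V) := hfin.isCompact_convexHull ℝ
  have hu : p₁ - p₂ ≠ 0 := sub_ne_zero.2 hne
  have hTc : IsCompact {τ : ℝ | x + τ • (p₁ - p₂) ∈ convexHull ℝ V} := by
    have hemb : Topology.IsClosedEmbedding (fun τ : ℝ => x + τ • (p₁ - p₂)) :=
      (Homeomorph.addLeft x).isClosedEmbedding.comp (isClosedEmbedding_smul_left hu)
    exact hemb.isCompact_preimage hPc
  obtain ⟨τ, hτ, hmax⟩ := hTc.exists_isMaxOn ⟨0, by simpa using hx⟩ continuousOn_id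
  have hmax' : ∀ κ : ℝ, x + κ • (p₁ - p₂) ∈ convexHull ℝ V → κ ≤ τ := fun κ hκ => hmax hκ
  obtain ⟨γ, σ, l₁, l₂, h0, h1, hσ, hxe, ha, hb, hc, he, hf, hg⟩ :=
    exists_pair hd V hfin hdim hvert p₁ p₂ hp₁ hp₂ hfacet hswap (x + τ • (p₁ - p₂)) hτ (by
      intro ρ hρ hmem
      rw [add_assoc, ← add_smul] at hmem
      have := hmax' _ hmem
      linarith)
  refine ⟨τ, γ, σ, l₁, l₂, h0, h1, hσ, hxe, ha, hb, hc, he, hf, hg, fun κ hκ => ⟨?_, hmax' κ hκ⟩⟩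
  have e1 := hc _ hκ
  have e2 := congrArg l₂ hxe
  simp only [map_add, map_smul, map_sub, smul_eq_mul, hg] at e1 e2
  by_contra hlt
  push Not at hlt
  nlinarith

/-- Non-apex vertices are orthogonal to the axis. -/
lemma orth_axis (hd : 2 ≤ d)
    (V : Set (EuclideanSpace ℝ (Fin d))) (hfin : V.Finite)
    (hVsph : V ⊆ Metric.sphere 0 1)
    (hdim : affineSpan ℝ V = ⊤)
    (hvert : (convexHull ℝ V).extremePoints ℝ = V)
    (hZ : PropertyZ V)
    (p₁ p₂ : EuclideanSpace ℝ (Fin d)) (hp₁ : p₁ ∈ V) (hp₂ : p₂ ∈ V) (hne : p₁ ≠ p₂)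
    (hfacet : ∀ F : Set (EuclideanSpace ℝ (Fin d)), IsFacet (convexHull ℝ V) F →
      (p₁ ∈ F ∧ p₂ ∉ F) ∨ (p₁ ∉ F ∧ p₂ ∈ F))
    (hswap : ∀ S : Set (EuclideanSpace ℝ (Fin d)), S ⊆ V \ {p₁, p₂} →
      (IsFacet (convexHull ℝ V) (convexHull ℝ (S ∪ {p₁})) ↔
        IsFacet (convexHull ℝ V) (convexHull ℝ (S ∪ {p₂}))))
    (s : EuclideanSpace ℝ (Fin d)) (hs : s ∈ V \ {p₁, p₂}) :
    ⟪s, p₁ - p₂⟫ = 0 := by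
  by_contra hsu
  have hfib := exists_fibre hd V hfin hdim hvert p₁ p₂ hp₁ hp₂ hne hfacet hswap
  obtain ⟨hsV, hs12⟩ := hs
  simp only [Set.mem_insert_iff, Set.mem_singleton_iff, not_or] at hs12
  obtain ⟨hs1, hs2⟩ := hs12
  have hP₁ := subset_convexHull ℝ V hp₁
  have hP₂ := subset_convexHull ℝ V hp₂
  have hPs := subset_convexHull ℝ V hsV
  have hu : p₁ - p₂ ≠ 0 := sub_ne_zero.2 hne
  have hext : ∀ a ∈ convexHull ℝ V, ∀ b ∈ convexHull ℝ V, s ∈ segment ℝ a b → a = s ∨ b = s := by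
    rw [← hvert] at hsV
    exact (mem_extremePoints_iff_forall_segment.1 hsV).2
  obtain ⟨τ, γ, σ, l₁, l₂, h0, h1, hσ, hxe, ha, hb, hc, he, hf, hg, hκ⟩ := hfib s hPs
  have h00 := hκ 0 (by simpa using hPs)
  have hseg : s ∉ segment ℝ p₁ p₂ := fun h => by
    rcases hext _ hP₁ _ hP₂ h with h | h
    · exact hs1 h.symm
    · exact hs2 h.symm
  have hγ : γ = 1 := by
    by_contra hγ1
    have hγp : 0 < 1 - γ := by
      have := lt_of_le_of_ne h1 hγ1
      linarith
    set p' := (1 - τ / (1 - γ)) • p₁ + (τ / (1 - γ)) • p₂ with hp'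
    have hp's : p' ∈ segment ℝ p₁ p₂ := by
      refine ⟨1 - τ / (1 - γ), τ / (1 - γ), ?_, div_nonneg h00.2 hγp.le, by ring, rfl⟩
      rw [sub_nonneg, div_le_one hγp]; linarith
    have hseq : s = (1 - γ) • p' + γ • σ := by
      have e1 : s = (1 - γ) • p₁ + γ • σ - τ • (p₁ - p₂) := by rw [← hxe]; abel
      have e2 : (1 - γ) • p' = (1 - γ) • p₁ - τ • (p₁ - p₂) := by
        rw [hp', smul_add, smul_smul, smul_smul, mul_sub, mul_div_cancel₀ _ hγp.ne']
        module
      rw [e2, e1]; module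
    rcases h0.eq_or_lt with h | h
    · rw [← h] at hseq
      simp at hseq
      exact hseg (hseq ▸ hp's)
    · have hopen : s ∈ openSegment ℝ p' σ := ⟨1 - γ, γ, hγp, h, by ring, hseq.symm⟩
      have hp'P : p' ∈ convexHull ℝ V := (convex_convexHull ℝ V).segment_subset hP₁ hP₂ hp's
      rw [← hvert] at hsV
      have := ((mem_extremePoints.1 hsV).2 _ hp'P _ hσ hopen).1
      exact hseg (this ▸ hp's)
  subst hγ
  have hτ0 : τ = 0 := by linarith [h00.1, h00.2]
  subst hτ0
  have hsσ : s = σ := by simpa using hxe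
  subst hsσ
  -- the supporting functional parallel to the axis
  set n : EuclideanSpace ℝ (Fin d) →L[ℝ] ℝ := (l₂ p₂ - l₂ p₁) • l₁ + (l₁ p₁ - l₁ p₂) • l₂ with hn
  have hnapp : ∀ y, n y = (l₂ p₂ - l₂ p₁) * l₁ y + (l₁ p₁ - l₁ p₂) * l₂ y := fun y => by simp [hn]
  have hnu : n (p₁ - p₂) = 0 := by rw [hnapp, map_sub, map_sub]; ring
  have hnP : ∀ y ∈ convexHull ℝ V, n y ≤ n s := by
    intro y hy
    rw [hnapp, hnapp, hf, hg]
    have e1 := ha y hy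
    have e2 := hc y hy
    nlinarith
  have hnp₂ : n p₂ < n s := by
    rw [hnapp, hnapp, hf, hg]
    nlinarith
  clear_value n
  -- move `s`
  set w := (s - p₂) + (-(⟪s, s - p₂⟫ / ⟪s, p₁ - p₂⟫)) • (p₁ - p₂) with hw
  have hw0 : w ≠ 0 := by
    intro h
    have := congrArg n h
    rw [hw, map_add, map_smul, hnu, map_sub] at this
    simp at this
    linarith
  have hsw : ⟪s, w⟫ = 0 := by
    rw [hw, inner_add_right, inner_smul_right]
    field_simp
    ring
  have hse : ⟪s, (⟪s, p₁ - p₂⟫)⁻¹ • (p₁ - p₂)⟫ = 1 := by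
    rw [inner_smul_right, inv_mul_cancel₀ hsu]
  have hsn : ‖s‖ = 1 := by simpa using hVsph hsV
  obtain ⟨η, hη, hZs⟩ := hZ s hsV
  obtain ⟨δ, ε, -, -, hε, hqn, hqd⟩ := sphere_move s w _ hsn hw0 hsw hse η 1 hη one_pos
  obtain ⟨q, hq⟩ : ∃ q, q = s + ε • (w - δ • (⟪s, p₁ - p₂⟫)⁻¹ • (p₁ - p₂)) := ⟨_, rfl⟩
  rw [← hq] at hqn hqd
  have hvol := hZs q (by simpa using hqn) hqd
  obtain ⟨t, ht⟩ : ∃ t : ℝ, q = s + ε • (s - p₂) + t • (p₁ - p₂) := by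
    refine ⟨ε * (-(⟪s, s - p₂⟫ / ⟪s, p₁ - p₂⟫)) - ε * δ * (⟪s, p₁ - p₂⟫)⁻¹, ?_⟩
    rw [hq, hw]; module
  clear_value w
  set P' := convexHull ℝ (V \ {s} ∪ {q}) with hP'
  have hnq : n s < n q := by
    rw [ht, map_add, map_add, map_smul, map_smul, hnu, map_sub]
    simp
    nlinarith
  have hV'fin : (V \ {s} ∪ {q}).Finite := (hfin.subset Set.sdiff_subset).union (Set.finite_singleton q)
  have hP'c : IsCompact P' := hV'fin.isCompact_convexHull ℝ
  have hP'conv : Convex ℝ P' := convex_convexHull ℝ _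
  have hVP' : ∀ v ∈ V, v ≠ s → v ∈ P' := fun v hv hvs =>
    subset_convexHull ℝ _ (Or.inl ⟨hv, hvs⟩)
  have hp₁P' : p₁ ∈ P' := hVP' _ hp₁ (Ne.symm hs1)
  have hp₂P' : p₂ ∈ P' := hVP' _ hp₂ (Ne.symm hs2)
  have hqP' : q ∈ P' := subset_convexHull ℝ _ (Or.inr rfl)
  have hshadow : ∀ y ∈ convexHull ℝ V, ∃ r : ℝ, y + r • (p₁ - p₂) ∈ P' := by
    have hcv : Convex ℝ {y | ∃ r : ℝ, y + r • (p₁ - p₂) ∈ P'} := by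
      rintro y ⟨r, hr⟩ y' ⟨r', hr'⟩ a b ha hb hab
      refine ⟨a * r + b * r', ?_⟩
      have := hP'conv hr hr' ha hb hab
      convert this using 1
      module
    have hsub : V ⊆ {y | ∃ r : ℝ, y + r • (p₁ - p₂) ∈ P'} := by
      intro v hv
      by_cases hvs : v = s
      · subst hvs
        refine ⟨t / (1 + ε), ?_⟩
        have := hP'conv hp₂P' hqP' (a := ε / (1 + ε)) (b := 1 / (1 + ε)) (by positivity)
          (by positivity) (by field_simp; ring)
        convert this using 1
        rw [ht]
        obtain ⟨k, hk⟩ : ∃ k : ℝ, k = 1 / (1 + ε) := ⟨_, rfl⟩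
        have h3 : k * (1 + ε) = 1 := by rw [hk]; field_simp
        have h4 : ε / (1 + ε) = k * ε := by rw [hk]; ring
        have h5 : t / (1 + ε) = k * t := by rw [hk]; ring
        rw [h4, h5, ← hk]
        calc v + (k * t) • (p₁ - p₂) = (k * (1 + ε)) • v + (k * t) • (p₁ - p₂) := by
              rw [h3, one_smul]
          _ = _ := by module
      · exact ⟨0, by simpa using hVP' v hv hvs⟩
    exact fun y hy => convexHull_min hsub hcv hy
  have hPm : MeasurableSet (convexHull ℝ V) := (hfin.isCompact_convexHull ℝ).isClosed.measurableSet
  have hP'm : MeasurableSet P' := hP'c.isClosed.measurableSet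
  have hHo : IsOpen {y : EuclideanSpace ℝ (Fin d) | n s < n y} :=
    isOpen_lt continuous_const n.continuous
  have hle : volume (convexHull ℝ V) ≤ volume (P' \ {y | n s < n y}) := by
    apply volume_le_of_lines (p₁ - p₂) hu _ _ hPm (hP'm.diff hHo.measurableSet)
    intro x
    by_cases hx : ∃ τ₀ : ℝ, x + τ₀ • (p₁ - p₂) ∈ convexHull ℝ V
    · obtain ⟨τ₀, hx⟩ := hx
      obtain ⟨τ, γ, σ, -, -, h0, h1, hσ, hxe, -, -, -, -, -, -, hκ⟩ := hfib _ hx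
      obtain ⟨r, hr⟩ := hshadow σ hσ
      have hnx := hnP _ hx
      rw [map_add, map_smul, hnu, smul_zero, add_zero] at hnx
      have hA : {ρ : ℝ | x + ρ • (p₁ - p₂) ∈ convexHull ℝ V} ⊆
          Set.Icc (τ₀ + τ - (1 - γ)) (τ₀ + τ) := by
        intro ρ hρ
        have h3 := hκ (ρ - τ₀) (by
          have h4 : x + τ₀ • (p₁ - p₂) + (ρ - τ₀) • (p₁ - p₂) = x + ρ • (p₁ - p₂) := by module
          rw [h4]; exact hρ)
        constructor <;> linarith [h3.1, h3.2]
      have hB : Set.Icc (τ₀ + τ - (1 - γ) + γ * r) (τ₀ + τ + γ * r) ⊆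
          {ρ : ℝ | x + ρ • (p₁ - p₂) ∈ P' \ {y | n s < n y}} := by
        rintro ρ ⟨hρ1, hρ2⟩
        refine ⟨?_, ?_⟩
        · have h3 : x + ρ • (p₁ - p₂) =
              (1 - γ - (τ₀ + τ + γ * r - ρ)) • p₁ + (τ₀ + τ + γ * r - ρ) • p₂
                + γ • (σ + r • (p₁ - p₂)) := by
            have h4 : x = (1 - γ) • p₁ + γ • σ - τ • (p₁ - p₂) - τ₀ • (p₁ - p₂) := by
              rw [← hxe]; abel
            rw [h4]; module
          rw [h3]
          have := hP'conv.sum_mem (t := Finset.univ)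
            (w := ![1 - γ - (τ₀ + τ + γ * r - ρ), τ₀ + τ + γ * r - ρ, γ])
            (z := ![p₁, p₂, σ + r • (p₁ - p₂)])
            (by intro i _; fin_cases i <;> simp <;> linarith)
            (by simp [Fin.sum_univ_three])
            (by intro i _; fin_cases i <;> simp [hp₁P', hp₂P', hr])
          simpa [Fin.sum_univ_three] using this
        · show ¬ n s < n _
          rw [map_add, map_smul, hnu, smul_zero, add_zero]
          exact not_lt.2 hnx
      refine (measure_mono hA).trans (le_trans ?_ (measure_mono hB))
      rw [Real.volume_Icc, Real.volume_Icc]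
      apply ENNReal.ofReal_le_ofReal
      linarith
    · push Not at hx
      have : {τ : ℝ | x + τ • (p₁ - p₂) ∈ convexHull ℝ V} = ∅ := by
        ext τ; simpa using hx τ
      rw [this]; simp
  have hPpos : 0 < volume (convexHull ℝ V) :=
    (isOpen_interior.measure_pos volume
      (interior_convexHull_nonempty_iff_affineSpan_eq_top.2 hdim)).trans_le
      (measure_mono interior_subset)
  have hIntr : (interior P').Nonempty := by
    by_contra h
    rw [Set.not_nonempty_iff_eq_empty] at h
    have h2 := hP'conv.addHaar_frontier volume
    rw [hP'c.isClosed.frontier_eq, h, Set.sdiff_empty] at h2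
    have h3 := hPpos.trans_le (hle.trans (measure_mono Set.sdiff_subset))
    rw [h2] at h3
    exact lt_irrefl _ h3
  have hCpos : 0 < volume (P' ∩ {y | n s < n y}) := by
    have hcl : q ∈ closure (interior P') := by
      rw [hP'conv.closure_interior_eq_closure_of_nonempty_interior hIntr]
      exact subset_closure hqP'
    have hne' := mem_closure_iff.1 hcl _ hHo hnq
    rw [Set.inter_comm] at hne'
    exact ((isOpen_interior.inter hHo).measure_pos volume hne').trans_le
      (measure_mono (Set.inter_subset_inter_left _ interior_subset))
  have hsplit := measure_inter_add_sdiff (μ := volume) P' hHo.measurableSet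
  have hfinP : volume (convexHull ℝ V) ≠ ⊤ := (hfin.isCompact_convexHull ℝ).measure_lt_top.ne
  have : volume (convexHull ℝ V) < volume P' := by
    calc volume (convexHull ℝ V) < volume (P' ∩ {y | n s < n y}) + volume (convexHull ℝ V) := by
          rw [add_comm]; exact ENNReal.lt_add_right hfinP hCpos.ne'
      _ ≤ volume (P' ∩ {y | n s < n y}) + volume (P' \ {y | n s < n y}) := by gcongr
      _ = volume P' := hsplit
  exact absurd hvol (not_le.2 this)

/-- The midpoint of the axis is interior. -/
lemma midpoint_interior
    (V : Set (EuclideanSpace ℝ (Fin d))) (hfin : V.Finite)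
    (hdim : affineSpan ℝ V = ⊤)
    (hvert : (convexHull ℝ V).extremePoints ℝ = V)
    (p₁ p₂ : EuclideanSpace ℝ (Fin d)) (hp₁ : p₁ ∈ V) (hp₂ : p₂ ∈ V)
    (hfacet : ∀ F : Set (EuclideanSpace ℝ (Fin d)), IsFacet (convexHull ℝ V) F →
      (p₁ ∈ F ∧ p₂ ∉ F) ∨ (p₁ ∉ F ∧ p₂ ∈ F)) :
    (1 / 2 : ℝ) • p₁ + (1 / 2 : ℝ) • p₂ ∈ interior (convexHull ℝ V) := by
  have hP₁ := subset_convexHull ℝ V hp₁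
  have hP₂ := subset_convexHull ℝ V hp₂
  obtain ⟨z, hz⟩ := interior_convexHull_nonempty_iff_affineSpan_eq_top.2 hdim
  set m := (1 / 2 : ℝ) • p₁ + (1 / 2 : ℝ) • p₂ with hm
  have hmP : m ∈ convexHull ℝ V :=
    convex_convexHull ℝ V hP₁ hP₂ (by norm_num) (by norm_num) (by norm_num)
  by_contra hmi
  obtain ⟨n, hn, hnm, -⟩ := exists_extreme_at hfin hz hmP (e := m - z) (by
    intro τ hτ hmem
    apply hmi
    apply (convex_convexHull ℝ V).openSegment_interior_self_subset_interior hz hmem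
    refine ⟨τ / (1 + τ), 1 / (1 + τ), by positivity, by positivity, by field_simp; ring, ?_⟩
    obtain ⟨k, hk⟩ : ∃ k : ℝ, k = 1 / (1 + τ) := ⟨_, rfl⟩
    have h3 : k * (1 + τ) = 1 := by rw [hk]; field_simp
    have h4 : τ / (1 + τ) = k * τ := by rw [hk]; ring
    rw [h4, ← hk]
    calc (k * τ) • z + k • (m + τ • (m - z)) = (k * (1 + τ)) • m := by module
      _ = m := by rw [h3, one_smul])
  obtain ⟨hF, hFac⟩ := facet_of_extreme hfin hvert hn hmP hnm
  have e1 := polarBody_hull hn.1 hP₁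
  have e2 := polarBody_hull hn.1 hP₂
  have e3 : ⟪n, m - z⟫ = (1 / 2) * ⟪n, p₁ - z⟫ + (1 / 2) * ⟪n, p₂ - z⟫ := by
    have : m - z = (1 / 2 : ℝ) • (p₁ - z) + (1 / 2 : ℝ) • (p₂ - z) := by rw [hm]; module
    rw [this, inner_add_right, inner_smul_right, inner_smul_right]
  have h1 : p₁ ∈ convexHull ℝ (activeSet V z n) := by
    rw [← hF]; exact ⟨hP₁, by linarith⟩
  have h2 : p₂ ∈ convexHull ℝ (activeSet V z n) := by
    rw [← hF]; exact ⟨hP₂, by linarith⟩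
  rcases hfacet _ hFac with ⟨_, h⟩ | ⟨h, _⟩
  · exact h h2
  · exact h h1

lemma rest_nonempty (hd : 2 ≤ d) (V : Set (EuclideanSpace ℝ (Fin d)))
    (hdim : affineSpan ℝ V = ⊤) (p₁ p₂ : EuclideanSpace ℝ (Fin d)) :
    (V \ {p₁, p₂}).Nonempty := by
  by_contra h
  rw [Set.not_nonempty_iff_eq_empty, Set.sdiff_eq_empty] at h
  have h1 : affineSpan ℝ ({p₁, p₂} : Set (EuclideanSpace ℝ (Fin d))) = ⊤ :=
    top_le_iff.1 (hdim ▸ affineSpan_mono ℝ h)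
  have h2 := (collinear_pair ℝ p₁ p₂).finrank_le_one
  rw [← direction_affineSpan, h1, AffineSubspace.direction_top, finrank_top,
    finrank_euclideanSpace_fin] at h2
  omega

lemma midpoint_mem_base (V : Set (EuclideanSpace ℝ (Fin d))) (hfin : V.Finite)
    (p₁ p₂ : EuclideanSpace ℝ (Fin d)) (hne : p₁ ≠ p₂) (h₁ : ‖p₁‖ = 1) (h₂ : ‖p₂‖ = 1)
    (hV' : (V \ {p₁, p₂}).Nonempty)
    (horth : ∀ v ∈ V \ {p₁, p₂}, ⟪v, p₁ - p₂⟫ = 0)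
    (hm : (1 / 2 : ℝ) • p₁ + (1 / 2 : ℝ) • p₂ ∈ interior (convexHull ℝ V)) :
    (1 / 2 : ℝ) • p₁ + (1 / 2 : ℝ) • p₂ ∈ convexHull ℝ (V \ {p₁, p₂}) := by
  set m := (1 / 2 : ℝ) • p₁ + (1 / 2 : ℝ) • p₂ with hmdef
  by_contra hmn
  have hfin' : (V \ {p₁, p₂}).Finite := hfin.subset Set.sdiff_subset
  obtain ⟨f, a, hf1, hf2⟩ := geometric_hahn_banach_closed_point (convex_convexHull ℝ (V \ {p₁, p₂}))
    (hfin'.isCompact_convexHull ℝ).isClosed hmn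
  have hu : p₁ - p₂ ≠ 0 := sub_ne_zero.2 hne
  have hun : 0 < ‖p₁ - p₂‖ ^ 2 := by positivity
  set g : EuclideanSpace ℝ (Fin d) →L[ℝ] ℝ :=
    f - (f (p₁ - p₂) / ‖p₁ - p₂‖ ^ 2) • innerSL ℝ (p₁ - p₂) with hg
  have hgapp : ∀ y, g y = f y - f (p₁ - p₂) / ‖p₁ - p₂‖ ^ 2 * ⟪y, p₁ - p₂⟫ := by
    intro y
    rw [hg, real_inner_comm (p₁ - p₂) y]
    rfl
  have hgu : g (p₁ - p₂) = 0 := by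
    rw [hgapp, real_inner_self_eq_norm_sq]; field_simp; ring
  have hmu : ⟪m, p₁ - p₂⟫ = 0 := by
    rw [hmdef, inner_add_left, inner_smul_left, inner_smul_left, inner_sub_right, inner_sub_right,
      real_inner_self_eq_norm_sq, real_inner_self_eq_norm_sq, h₁, h₂, real_inner_comm p₁ p₂]
    simp; ring
  have hgm : g m = f m := by rw [hgapp, hmu]; ring
  have hgv : ∀ v ∈ V \ {p₁, p₂}, g v < g m := by
    intro v hv
    rw [hgm, hgapp, horth v hv]
    have := hf1 v (subset_convexHull ℝ _ hv)
    linarith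
  have hg12 : g p₁ = g p₂ := by
    rw [map_sub] at hgu; linarith
  have hgm1 : g m = g p₁ := by
    rw [hmdef, map_add, map_smul, map_smul, ← hg12]; simp; ring
  have hgP : ∀ y ∈ convexHull ℝ V, g y ≤ g m := by
    have hc : Convex ℝ {y | g y ≤ g m} := convex_halfSpace_le g.toLinearMap.isLinear _
    have hs : V ⊆ {y | g y ≤ g m} := by
      intro v hv
      show g v ≤ g m
      by_cases h1 : v = p₁
      · rw [h1, hgm1]
      by_cases h2 : v = p₂
      · rw [h2, hgm1, hg12]
      exact (hgv v ⟨hv, by simp [h1, h2]⟩).le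
    exact fun y hy => convexHull_min hs hc hy
  obtain ⟨v, hv⟩ := hV'
  have hlt := hgv v hv
  have hc : ContinuousAt (fun τ : ℝ => m + τ • (m - v)) 0 := by fun_prop
  have hev : ∀ᶠ τ : ℝ in nhds 0, m + τ • (m - v) ∈ convexHull ℝ V := by
    apply hc.eventually
    simp only [zero_smul, add_zero]
    exact mem_interior_iff_mem_nhds.1 hm
  obtain ⟨τ, ha, hτ⟩ := ((hev.filter_mono
    (nhdsWithin_le_nhds (s := Set.Ioi 0))).and self_mem_nhdsWithin).exists
  have hτ : 0 < τ := hτ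
  have h3 := hgP _ ha
  rw [map_add, map_smul, map_sub, smul_eq_mul] at h3
  nlinarith

/-- The apex is parallel to the axis. -/
lemma apex_parallel
    (V : Set (EuclideanSpace ℝ (Fin d))) (hfin : V.Finite)
    (hVsph : V ⊆ Metric.sphere 0 1)
    (hdim : affineSpan ℝ V = ⊤)
    (hZ : PropertyZ V)
    (p₁ p₂ : EuclideanSpace ℝ (Fin d)) (hp₁ : p₁ ∈ V) (hp₂ : p₂ ∈ V) (hne : p₁ ≠ p₂)
    (hV' : (V \ {p₁, p₂}).Nonempty)
    (horth : ∀ v ∈ V \ {p₁, p₂}, ⟪v, p₁ - p₂⟫ = 0)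
    (hm : (1 / 2 : ℝ) • p₁ + (1 / 2 : ℝ) • p₂ ∈ convexHull ℝ (V \ {p₁, p₂})) :
    (p₁ - p₂) - ⟪p₁, p₁ - p₂⟫ • p₁ = 0 := by
  by_contra hw0
  have h₁ : ‖p₁‖ = 1 := by simpa using hVsph hp₁
  have h₂ : ‖p₂‖ = 1 := by simpa using hVsph hp₂
  have hu : p₁ - p₂ ≠ 0 := sub_ne_zero.2 hne
  have hun : 0 < ‖p₁ - p₂‖ ^ 2 := by positivity
  obtain ⟨u, hudef⟩ : ∃ u, u = p₁ - p₂ := ⟨_, rfl⟩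
  have hp₁u : 0 < ⟪p₁, u⟫ ∧ ⟪p₂, u⟫ = -⟪p₁, u⟫ := by
    rw [← real_inner_self_eq_norm_sq] at hun
    have e1 : ⟪p₁ - p₂, p₁ - p₂⟫ = ⟪p₁, u⟫ - ⟪p₂, u⟫ := by rw [hudef, inner_sub_left]
    have e2 : ⟪p₂, u⟫ = -⟪p₁, u⟫ := by
      rw [hudef, inner_sub_right, inner_sub_right, real_inner_self_eq_norm_sq,
        real_inner_self_eq_norm_sq, h₁, h₂, real_inner_comm p₁ p₂]
      ring
    exact ⟨by linarith, e2⟩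
  obtain ⟨hpos, hp₂u⟩ := hp₁u
  rw [← hudef] at hw0 horth
  set B := V \ {p₁, p₂} with hB
  set m := (1 / 2 : ℝ) • p₁ + (1 / 2 : ℝ) • p₂ with hmdef
  set w := u - ⟪p₁, u⟫ • p₁ with hw
  have hpw : ⟪p₁, w⟫ = 0 := by
    rw [hw, inner_sub_right, inner_smul_right, real_inner_self_eq_norm_sq, h₁]; ring
  have hwu : ⟪w, u⟫ = ‖w‖ ^ 2 := by
    have : u = w + ⟪p₁, u⟫ • p₁ := by rw [hw]; abel
    nth_rewrite 1 [this]
    rw [inner_add_right, inner_smul_right, real_inner_comm, real_inner_comm p₁ w, hpw,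
      real_inner_self_eq_norm_sq]
    ring
  have hwn : 0 < ‖w‖ ^ 2 := by
    have := norm_pos_iff.2 hw0
    positivity
  obtain ⟨η, hη, hZs⟩ := hZ p₁ hp₁
  obtain ⟨δ, ε, hδ, hδ1, hε, hqn, hqd⟩ := sphere_move p₁ w p₁ h₁ hw0 hpw
    (by rw [real_inner_self_eq_norm_sq, h₁]; norm_num) η (‖w‖ ^ 2 / ⟪p₁, u⟫) hη (by positivity)
  obtain ⟨q, hq⟩ : ∃ q, q = p₁ + ε • (w - δ • p₁) := ⟨_, rfl⟩
  rw [← hq] at hqn hqd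
  have hvol := hZs q (by simpa using hqn) hqd
  have hqu : 0 < ⟪q - p₁, u⟫ := by
    rw [hq, add_sub_cancel_left, inner_smul_left, inner_sub_left, inner_smul_left, hwu]
    rw [lt_div_iff₀ hpos] at hδ1
    simp only [conj_trivial]
    apply mul_pos hε
    linarith
  set P' := convexHull ℝ (V \ {p₁} ∪ {q}) with hP'
  have hBP' : B ⊆ P' := by
    intro v hv
    refine subset_convexHull ℝ _ (Or.inl ⟨hv.1, fun h => hv.2 ?_⟩)
    exact Or.inl h
  have hp₂P' : p₂ ∈ P' := subset_convexHull ℝ _ (Or.inl ⟨hp₂, Ne.symm hne⟩)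
  have hqP' : q ∈ P' := subset_convexHull ℝ _ (Or.inr rfl)
  have hP'conv : Convex ℝ P' := convex_convexHull ℝ _
  set K := convexHull ℝ (insert p₁ B) with hK
  have hKconv : Convex ℝ K := convex_convexHull ℝ _
  have hp₁K : p₁ ∈ K := subset_convexHull ℝ _ (by simp)
  have hBK : convexHull ℝ B ⊆ K := convexHull_mono (Set.subset_insert _ _)
  have hBP'' : convexHull ℝ B ⊆ P' := convexHull_min hBP' hP'conv
  set H : Set (EuclideanSpace ℝ (Fin d)) := {y | 0 ≤ ⟪y, u⟫} with hH
  have hHm : MeasurableSet H :=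
    (isClosed_le continuous_const (by fun_prop : Continuous fun y : EuclideanSpace ℝ (Fin d) => ⟪y, u⟫)).measurableSet
  have hHc : Convex ℝ H := by
    have := convex_halfSpace_ge (innerₗ (EuclideanSpace ℝ (Fin d)) u).isLinear 0
    have h2 : H = {w | 0 ≤ (innerₗ (EuclideanSpace ℝ (Fin d)) u) w} := by
      ext y; simp [hH, real_inner_comm]
    rw [h2]; exact this
  have hBu : ∀ y ∈ convexHull ℝ B, ⟪y, u⟫ = 0 := by
    intro y hy
    have hc : Convex ℝ {y : EuclideanSpace ℝ (Fin d) | ⟪u, y⟫ = 0} :=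
      convex_hyperplane (innerₗ (EuclideanSpace ℝ (Fin d)) u).isLinear 0
    have : ⟪u, y⟫ = 0 := convexHull_min (fun v hv => by
      show ⟪u, v⟫ = 0
      rw [real_inner_comm]; exact horth v hv) hc hy
    rw [real_inner_comm]; exact this
  have hKH : K ⊆ H := by
    apply convexHull_min _ hHc
    rintro v (rfl | hv)
    · exact hpos.le
    · exact (horth v hv).ge
  have hVins : V = insert p₁ (insert p₂ B) := by
    ext v
    simp only [hB, Set.mem_insert_iff, Set.mem_sdiff, Set.mem_singleton_iff]
    by_cases e1 : v = p₁
    · simp [e1, hp₁]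
    · by_cases e2 : v = p₂
      · simp [e2, hp₂]
      · simp [e1, e2]
  have hdecomp : ∀ x ∈ convexHull ℝ V, ∃ α β γ : ℝ, ∃ σ ∈ convexHull ℝ B, 0 ≤ α ∧ 0 ≤ β ∧ 0 ≤ γ ∧
      α + β + γ = 1 ∧ x = α • p₁ + β • p₂ + γ • σ := by
    intro x hx
    rw [hVins, convexHull_insert (Set.insert_nonempty _ _), mem_convexJoin] at hx
    obtain ⟨_, rfl, y, hy, a, b, ha, hb, hab, rfl⟩ := hx
    rw [convexHull_insert hV', mem_convexJoin] at hy
    obtain ⟨_, rfl, σ, hσ, a', b', ha', hb', hab', rfl⟩ := hy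
    refine ⟨a, b * a', b * b', σ, hσ, ha, by positivity, by positivity, ?_, by module⟩
    rw [add_assoc, ← mul_add, hab', mul_one, hab]
  have hcomb : ∀ (C : Set (EuclideanSpace ℝ (Fin d))), Convex ℝ C → ∀ a ∈ C, ∀ b ∈ C, ∀ c ∈ C,
      ∀ α β γ : ℝ, 0 ≤ α → 0 ≤ β → 0 ≤ γ → α + β + γ = 1 → α • a + β • b + γ • c ∈ C := by
    intro C hC a ha b hb c hc α β γ h1 h2 h3 h4
    have := hC.sum_mem (t := Finset.univ) (w := ![α, β, γ]) (z := ![a, b, c])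
      (by intro i _; fin_cases i <;> simpa)
      (by simpa [Fin.sum_univ_three] using h4)
      (by intro i _; fin_cases i <;> simpa)
    simpa [Fin.sum_univ_three] using this
  have hxu : ∀ (α β γ : ℝ) (σ), σ ∈ convexHull ℝ B →
      ⟪α • p₁ + β • p₂ + γ • σ, u⟫ = (α - β) * ⟪p₁, u⟫ := by
    intro α β γ σ hσ
    rw [inner_add_left, inner_add_left, inner_smul_left, inner_smul_left, inner_smul_left,
      hBu σ hσ, hp₂u]
    simp; ring
  have hPK : convexHull ℝ V ∩ H ⊆ K := by
    rintro x ⟨hx, hxH⟩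
    obtain ⟨α, β, γ, σ, hσ, h1, h2, h3, h4, rfl⟩ := hdecomp x hx
    have hxH : 0 ≤ ⟪α • p₁ + β • p₂ + γ • σ, u⟫ := hxH
    rw [hxu _ _ _ _ hσ] at hxH
    have h5 : 0 ≤ α - β := nonneg_of_mul_nonneg_left hxH hpos
    have := hcomb K hKconv p₁ hp₁K m (hBK hm) σ (hBK hσ) (α - β) (2 * β) γ h5 (by linarith) h3
      (by linarith)
    convert this using 1
    rw [hmdef]; module
  have hPL : convexHull ℝ V \ H ⊆ P' \ H := by
    rintro x ⟨hx, hxH⟩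
    refine ⟨?_, hxH⟩
    obtain ⟨α, β, γ, σ, hσ, h1, h2, h3, h4, rfl⟩ := hdecomp x hx
    have hxH : ¬ 0 ≤ ⟪α • p₁ + β • p₂ + γ • σ, u⟫ := hxH
    rw [hxu _ _ _ _ hσ] at hxH
    have h5 : 0 ≤ β - α := by
      by_contra h
      exact hxH (mul_nonneg (by linarith) hpos.le)
    have := hcomb P' hP'conv p₂ hp₂P' m (hBP'' hm) σ (hBP'' hσ) (β - α) (2 * α) γ h5
      (by linarith) h3 (by linarith)
    convert this using 1
    rw [hmdef]; module
  -- the linear map moving `p₁` to `q`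
  set f : Module.Dual ℝ (EuclideanSpace ℝ (Fin d)) :=
    (⟪p₁, u⟫)⁻¹ • (innerₗ (EuclideanSpace ℝ (Fin d)) u) with hf
  have hfapp : ∀ y, f y = ⟪y, u⟫ / ⟪p₁, u⟫ := by
    intro y; simp [hf, real_inner_comm]; ring
  set T := LinearMap.transvection f (q - p₁) with hT
  have hTapp : ∀ y, T y = y + f y • (q - p₁) := fun y => by simp [hT, LinearMap.transvection.apply]
  have hTdet : 1 < LinearMap.det T := by
    rw [hT, LinearMap.transvection.det, hfapp]
    have : 0 < ⟪q - p₁, u⟫ / ⟪p₁, u⟫ := by positivity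
    linarith
  have hTK : T '' K ⊆ P' ∩ H := by
    apply Set.subset_inter
    · rw [hK, LinearMap.image_convexHull]
      apply convexHull_min _ hP'conv
      rintro _ ⟨v, (rfl | hv), rfl⟩
      · rw [hTapp, hfapp, div_self hpos.ne', one_smul, add_sub_cancel]
        exact hqP'
      · rw [hTapp, hfapp, horth v hv]
        simpa using hBP' hv
    · rintro _ ⟨y, hy, rfl⟩
      have hyu : 0 ≤ ⟪y, u⟫ := hKH hy
      show 0 ≤ ⟪T y, u⟫
      rw [hTapp, hfapp, inner_add_left, inner_smul_left]
      simp only [conj_trivial]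
      positivity
  have hBfin : B.Finite := hfin.subset Set.sdiff_subset
  have hKfin : volume K ≠ ⊤ := ((hBfin.insert p₁).isCompact_convexHull ℝ).measure_lt_top.ne
  have hLfin : volume (convexHull ℝ V \ H) ≠ ⊤ :=
    ((measure_mono Set.sdiff_subset).trans_lt (hfin.isCompact_convexHull ℝ).measure_lt_top).ne
  have hKpos : 0 < volume K := by
    have hIntr := interior_convexHull_nonempty_iff_affineSpan_eq_top.2 hdim
    have hcl : p₁ ∈ closure (interior (convexHull ℝ V)) := by
      rw [(convex_convexHull ℝ V).closure_interior_eq_closure_of_nonempty_interior hIntr]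
      exact subset_closure (subset_convexHull ℝ V hp₁)
    have hO : IsOpen {y : EuclideanSpace ℝ (Fin d) | 0 < ⟪y, u⟫} :=
      isOpen_lt continuous_const (by fun_prop)
    have hne' := mem_closure_iff.1 hcl _ hO hpos
    rw [Set.inter_comm] at hne'
    refine ((isOpen_interior.inter hO).measure_pos volume hne').trans_le (measure_mono ?_)
    rintro y ⟨hy1, hy2⟩
    have hy2 : 0 < ⟪y, u⟫ := hy2
    exact hPK ⟨interior_subset hy1, hy2.le⟩
  have hTvol : volume K < volume (T '' K) := by
    rw [Measure.addHaar_image_linearMap]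
    have h1 : 1 < ENNReal.ofReal |LinearMap.det T| := by
      rw [ENNReal.one_lt_ofReal]
      exact hTdet.trans_le (le_abs_self _)
    calc volume K = 1 * volume K := (one_mul _).symm
      _ < _ := ENNReal.mul_lt_mul_left hKpos.ne' hKfin h1
  have : volume (convexHull ℝ V) < volume P' := by
    calc volume (convexHull ℝ V) = volume (convexHull ℝ V ∩ H) + volume (convexHull ℝ V \ H) :=
          (measure_inter_add_sdiff _ hHm).symm
      _ ≤ volume K + volume (convexHull ℝ V \ H) := by gcongr
      _ < volume (T '' K) + volume (convexHull ℝ V \ H) :=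
          ENNReal.add_lt_add_right hLfin hTvol
      _ ≤ volume (P' ∩ H) + volume (P' \ H) := by gcongr
      _ = volume P' := measure_inter_add_sdiff _ hHm
  exact absurd hvol (not_le.2 this)

end main

theorem propertyZ_bipyramid (d : ℕ) (hd : 2 ≤ d)
    (V : Set (EuclideanSpace ℝ (Fin d))) (hfin : V.Finite)
    (hVsph : V ⊆ Metric.sphere 0 1)
    (hdim : affineSpan ℝ V = ⊤)
    (hvert : (convexHull ℝ V).extremePoints ℝ = V)
    (hZ : PropertyZ V)
    (p₁ p₂ : EuclideanSpace ℝ (Fin d)) (hp₁ : p₁ ∈ V) (hp₂ : p₂ ∈ V) (hne : p₁ ≠ p₂)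
    (hfacet : ∀ F : Set (EuclideanSpace ℝ (Fin d)), IsFacet (convexHull ℝ V) F →
      (p₁ ∈ F ∧ p₂ ∉ F) ∨ (p₁ ∉ F ∧ p₂ ∈ F))
    (hswap : ∀ S : Set (EuclideanSpace ℝ (Fin d)), S ⊆ V \ {p₁, p₂} →
      (IsFacet (convexHull ℝ V) (convexHull ℝ (S ∪ {p₁})) ↔
        IsFacet (convexHull ℝ V) (convexHull ℝ (S ∪ {p₂})))) :
    p₂ = -p₁ ∧ ∀ v ∈ V \ {p₁, p₂}, ⟪v, p₁⟫ = 0 := by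
  have h₁ : ‖p₁‖ = 1 := by simpa using hVsph hp₁
  have h₂ : ‖p₂‖ = 1 := by simpa using hVsph hp₂
  have horth := orth_axis hd V hfin hVsph hdim hvert hZ p₁ p₂ hp₁ hp₂ hne hfacet hswap
  have hV' := rest_nonempty hd V hdim p₁ p₂
  have hm := midpoint_mem_base V hfin p₁ p₂ hne h₁ h₂ hV' horth
    (midpoint_interior V hfin hdim hvert p₁ p₂ hp₁ hp₂ hfacet)
  have hpar := apex_parallel V hfin hVsph hdim hZ p₁ p₂ hp₁ hp₂ hne hV' horth hm
  have e1 : p₂ = (1 - ⟪p₁, p₁ - p₂⟫) • p₁ := by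
    have : p₂ = p₁ - (p₁ - p₂) := by abel
    rw [sub_eq_zero.1 hpar] at this
    rw [sub_smul, one_smul]
    exact this
  have e2 : p₂ = -p₁ := by
    have h3 := congrArg norm e1
    rw [norm_smul, h₁, h₂, mul_one, Real.norm_eq_abs] at h3
    rcases (abs_eq (zero_le_one)).1 h3.symm with h | h
    · rw [h, one_smul] at e1
      exact absurd e1.symm hne
    · rw [h] at e1
      simpa using e1
  refine ⟨e2, fun v hv => ?_⟩
  have h4 := horth v hv
  rw [e2, sub_neg_eq_add, inner_add_right] at h4
  linarith
end

section
/- Let d ≥ 2 and let p₁, …, p_d, q₁, …, q_d be 2d distinct points of S^{d-1} such that P = conv{p₁,…,p_d,q₁,…,q_d} is a d-dimensional polytope with all 2d points as vertices, P satisfies Property Z, and every facet of P contains exactly one point of each pair {pᵢ, qᵢ} (i = 1,…,d), i.e. P has the combinatorial structure of a cross-polytope with diagonals [pᵢ,qᵢ]. Then qᵢ = −pᵢ for every i and ⟨pᵢ, pⱼ⟩ = 0 for all i ≠ j; that is, P is a regular cross-polytope inscribed in S^{d-1}. -/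
open MeasureTheory Real RealInnerProductSpace

namespace CrossZ

open Function

local notation "EE" d => EuclideanSpace ℝ (Fin d)

/-- The determinant of a family of vectors, with respect to the standard basis. -/
noncomputable def vdet (d : ℕ) : (EE d) [⋀^Fin d]→ₗ[ℝ] ℝ :=
  (EuclideanSpace.basisFun (Fin d) ℝ).toBasis.det

/-- The linear map sending the standard basis to `v`. -/
noncomputable def lmap {d : ℕ} (v : Fin d → EE d) : (EE d) →ₗ[ℝ] (EE d) :=
  (EuclideanSpace.basisFun (Fin d) ℝ).toBasis.constr ℝ v

lemma lmap_apply {d : ℕ} (v : Fin d → EE d) (y : EE d) : lmap v y = ∑ j, y j • v j := by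
  simp [lmap, Module.Basis.constr_apply_fintype]

lemma det_lmap {d : ℕ} (v : Fin d → EE d) : LinearMap.det (lmap v) = vdet d v := by
  have h := Module.Basis.det_comp (EuclideanSpace.basisFun (Fin d) ℝ).toBasis (lmap v)
    (EuclideanSpace.basisFun (Fin d) ℝ).toBasis
  rw [Module.Basis.det_self, mul_one] at h
  rw [← h, vdet]
  congr 1
  funext j
  simp only [Function.comp, lmap, Module.Basis.constr_basis]

lemma vdet_eq_zero {d : ℕ} (v : Fin d → EE d) (y : EE d) (hy : y ≠ 0)
    (h : ∀ j, ⟪y, v j⟫ = 0) : vdet d v = 0 := by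
  by_contra hne
  have hu : IsUnit (vdet d v) := isUnit_iff_ne_zero.mpr hne
  obtain ⟨-, hs⟩ := (Module.Basis.is_basis_iff_det
    (EuclideanSpace.basisFun (Fin d) ℝ).toBasis).mpr hu
  apply hy
  have : y ∈ Submodule.span ℝ (Set.range v) := by rw [hs]; trivial
  have h2 : ∀ x ∈ Submodule.span ℝ (Set.range v), ⟪y, x⟫ = 0 := by
    intro x hx
    induction hx using Submodule.span_induction with
    | mem x hx => obtain ⟨j, rfl⟩ := hx; exact h j
    | zero => simp
    | add a b _ _ ha hb => rw [inner_add_right, ha, hb, add_zero]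
    | smul t a _ ha => rw [inner_smul_right, ha, mul_zero]
  exact inner_self_eq_zero.mp (h2 y this)

/-- Closed standard simplex. -/
def simp0 (d : ℕ) : Set (EE d) := {y | (∀ j, 0 ≤ y j) ∧ ∑ j, y j ≤ 1}

lemma simp0_convex (d : ℕ) : Convex ℝ (simp0 d) := by
  rintro x ⟨hx, hx'⟩ y ⟨hy, hy'⟩ a b ha hb hab
  refine ⟨fun j => ?_, ?_⟩
  · have := hx j
    have := hy j
    simp only [PiLp.add_apply, PiLp.smul_apply, smul_eq_mul]
    positivity
  · simp only [PiLp.add_apply, PiLp.smul_apply, smul_eq_mul, Finset.sum_add_distrib,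
      ← Finset.mul_sum]
    nlinarith

lemma flip_all {d : ℕ} {P : (Fin d → Bool) → Prop} (σ₀ : Fin d → Bool) (h0 : P σ₀)
    (hf : ∀ σ i, P σ → P (update σ i (!σ i))) (τ : Fin d → Bool) : P τ := by
  classical
  have key : ∀ s : Finset (Fin d), P (fun j => if j ∈ s then τ j else σ₀ j) := by
    intro s
    induction s using Finset.induction_on with
    | empty => simpa using h0
    | insert a s ha ih =>
      by_cases h : τ a = σ₀ a
      · convert ih using 2 with j
        by_cases hj : j = a
        · subst hj; simp [ha, h]
        · simp [hj]
      · convert hf _ a ih using 1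
        funext j
        by_cases hj : j = a
        · subst hj
          simp only [Finset.mem_insert_self, if_true, update_self, ha, if_false]
          cases h1 : τ j <;> cases h2 : σ₀ j <;> simp_all
        · simp [hj]
  simpa using key Finset.univ

/-- the sign attached to a choice. -/
def sg (s : Bool) : ℝ := if s then 1 else -1

/-- all choices are supported by a functional. -/
def Good {d : ℕ} (c : Fin d → Bool → EE d) : Prop :=
  ∀ σ : Fin d → Bool, ∃ h : EE d, (∀ j, ⟪h, c j (σ j)⟫ = 1) ∧ ∀ j, ⟪h, c j (!σ j)⟫ < 1

/-- The diagonals. -/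
def diag {d : ℕ} (c : Fin d → Bool → EE d) (j : Fin d) : EE d := c j true - c j false

lemma vdet_diag {d : ℕ} (c : Fin d → Bool → EE d) :
    vdet d (diag c) = ∑ σ : Fin d → Bool, (∏ j, sg (σ j)) * vdet d (fun j => c j (σ j)) := by
  have h1 : diag c = fun j => ∑ s : Bool, sg s • c j s := by
    funext j
    simp [diag, sg, sub_eq_add_neg]
  have h2 := (vdet d).toMultilinearMap.map_sum (fun j s => sg s • c j s)
  rw [h1]
  refine h2.trans (Finset.sum_congr rfl fun σ _ => ?_)
  exact (vdet d).toMultilinearMap.map_smul_univ (fun j => sg (σ j)) (fun j => c j (σ j))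

lemma abs_prod_sg {d : ℕ} (σ : Fin d → Bool) : |∏ j, sg (σ j)| = 1 := by
  rw [Finset.abs_prod]
  apply Finset.prod_eq_one
  intro j _
  cases σ j <;> simp [sg]

lemma sum_abs_eq {d : ℕ} (c : Fin d → Bool → EE d) (hc : Good c) :
    ∑ σ : Fin d → Bool, |vdet d (fun j => c j (σ j))| = |vdet d (diag c)| := by
  set F : (Fin d → Bool) → ℝ := fun σ => (∏ j, sg (σ j)) * vdet d (fun j => c j (σ j)) with hF
  have hFabs : ∀ σ, |vdet d (fun j => c j (σ j))| = |F σ| := by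
    intro σ
    rw [hF, abs_mul, abs_prod_sg, one_mul]
  have hflip : ∀ σ i, ∃ α β : ℝ, 0 < α ∧ 0 < β ∧ α * F (update σ i (!σ i)) = β * F σ := by
    intro σ i
    obtain ⟨h, h1, h2⟩ := hc σ
    obtain ⟨h', h1', h2'⟩ := hc (update σ i (!σ i))
    set y := h - h'
    have e1 : ⟪h', c i (!σ i)⟫ = 1 := by simpa using h1' i
    have e2 : ⟪h', c i (σ i)⟫ < 1 := by simpa using h2' i
    have y1 : 0 < ⟪y, c i (σ i)⟫ := by
      rw [inner_sub_left, h1]; linarith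
    have y2 : ⟪y, c i (!σ i)⟫ < 0 := by
      rw [inner_sub_left, e1]; linarith [h2 i]
    have y3 : ∀ j, j ≠ i → ⟪y, c j (σ j)⟫ = 0 := by
      intro j hj
      have := h1' j
      rw [update_of_ne hj] at this
      rw [inner_sub_left, h1, this, sub_self]
    refine ⟨⟪y, c i (σ i)⟫, -⟪y, c i (!σ i)⟫, y1, by linarith, ?_⟩
    have y0 : y ≠ 0 := by
      rintro h0; rw [h0, inner_zero_left] at y1; exact lt_irrefl _ y1
    have hz := vdet_eq_zero (update (fun j => c j (σ j)) i
      (⟪y, c i (σ i)⟫ • c i (!σ i) + (-⟪y, c i (!σ i)⟫) • c i (σ i))) y y0 (by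
        intro j
        by_cases hj : j = i
        · subst hj
          simp only [update_self, inner_add_right, inner_smul_right]
          ring
        · rw [update_of_ne hj]; exact y3 j hj)
    rw [AlternatingMap.map_update_add, AlternatingMap.map_update_smul,
      AlternatingMap.map_update_smul] at hz
    have u1 : update (fun j => c j (σ j)) i (c i (!σ i)) =
        fun j => c j (update σ i (!σ i) j) := by
      funext j
      by_cases hj : j = i
      · subst hj; simp
      · simp [hj]
    have u2 : update (fun j => c j (σ j)) i (c i (σ i)) = fun j => c j (σ j) := by
      exact update_eq_self i (fun j => c j (σ j))
    rw [u1, u2] at hz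
    have hs : ∏ j, sg (update σ i (!σ i) j) = - ∏ j, sg (σ j) := by
      rw [← Finset.mul_prod_erase _ _ (Finset.mem_univ i),
        ← Finset.mul_prod_erase Finset.univ (fun j => sg (σ j)) (Finset.mem_univ i)]
      have : ∏ j ∈ Finset.univ.erase i, sg (update σ i (!σ i) j) =
          ∏ j ∈ Finset.univ.erase i, sg (σ j) := by
        refine Finset.prod_congr rfl fun j hj => ?_
        rw [update_of_ne (Finset.ne_of_mem_erase hj)]
      rw [this, update_self]
      cases σ i <;> simp [sg]
    simp only [hF, hs]
    simp only [smul_eq_mul] at hz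
    linear_combination (-(∏ j, sg (σ j))) * hz
  have hsign : ∀ τ, SignType.sign (F τ) = SignType.sign (F (fun _ => true)) := by
    refine flip_all (fun _ => true) rfl ?_
    intro σ i ih
    obtain ⟨α, β, ha, hb, hab⟩ := hflip σ i
    have := congrArg SignType.sign hab
    rw [sign_mul α, sign_mul β, sign_pos ha, sign_pos hb, one_mul, one_mul] at this
    rw [this, ih]
  rw [vdet_diag]
  simp only [hFabs]
  change ∑ σ, |F σ| = |∑ σ, F σ|
  have hab : ∀ σ, |F σ| = (SignType.sign (F (fun _ => true)) : ℝ) * F σ := by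
    intro σ
    rw [← hsign σ, sign_mul_self]
  rcases lt_trichotomy (F (fun _ => true)) 0 with h | h | h
  · simp only [sign_neg h] at hab
    have : ∀ σ, |F σ| = - F σ := by intro σ; simpa using hab σ
    rw [abs_of_nonpos (Finset.sum_nonpos fun σ _ => by
      have := this σ; have := abs_nonneg (F σ); linarith)]
    simp [this]
  · simp only [h, _root_.sign_zero] at hab
    have : ∀ σ, F σ = 0 := by intro σ; simpa using hab σ
    simp [this]
  · simp only [sign_pos h] at hab
    have : ∀ σ, |F σ| = F σ := by intro σ; simpa using hab σ
    rw [abs_of_nonneg (Finset.sum_nonneg fun σ _ => by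
      have := this σ; have := abs_nonneg (F σ); linarith)]
    simp [this]

lemma volume_lmap {d : ℕ} (v : Fin d → EE d) :
    volume (lmap v '' simp0 d) = ENNReal.ofReal |vdet d v| * volume (simp0 d) := by
  rw [Measure.addHaar_image_linearMap, det_lmap]

lemma lower {d : ℕ} (c : Fin d → Bool → EE d) (hc : Good c) (K : Set (EE d))
    (hK : Convex ℝ K) (h0 : (0 : EE d) ∈ K) (hcK : ∀ j s, c j s ∈ K) :
    ENNReal.ofReal |vdet d (diag c)| * volume (simp0 d) ≤ volume K := by
  have hdis : Pairwise (Function.onFun (AEDisjoint (volume : Measure (EE d)))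
      (fun σ : Fin d → Bool => lmap (fun j => c j (σ j)) '' simp0 d)) := by
    intro σ τ hne
    obtain ⟨i, hi⟩ := Function.ne_iff.mp hne
    obtain ⟨h, h1, h2⟩ := hc σ
    obtain ⟨h', h1', h2'⟩ := hc τ
    have hle : ∀ (h : EE d) (σ τ : Fin d → Bool), (∀ j, ⟪h, c j (σ j)⟫ = 1) →
        (∀ j, ⟪h, c j (!σ j)⟫ < 1) → ∀ j, ⟪h, c j (τ j)⟫ ≤ 1 := by
      intro h σ τ h1 h2 j
      by_cases e : τ j = σ j
      · rw [e, h1]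
      · have : τ j = !σ j := by cases h1 : τ j <;> cases h2 : σ j <;> simp_all
        rw [this]; exact (h2 j).le
    have hsub : (lmap (fun j => c j (σ j)) '' simp0 d) ∩ (lmap (fun j => c j (τ j)) '' simp0 d)
        ⊆ lmap (fun j => c j (σ j)) '' {y | y i = 0} := by
      rintro x ⟨⟨a, ⟨ha, ha1⟩, rfl⟩, ⟨b, ⟨hb, hb1⟩, hab⟩⟩
      refine ⟨a, ?_, rfl⟩
      rw [lmap_apply, lmap_apply] at hab
      have A1 := congrArg (fun x => ⟪h, x⟫) hab
      have A2 := congrArg (fun x => ⟪h', x⟫) hab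
      simp only [inner_sum, inner_smul_right, h1, h1', mul_one] at A1 A2
      have B1 : ∑ j, b j * ⟪h, c j (τ j)⟫ ≤ ∑ j, b j := by
        refine Finset.sum_le_sum fun j _ => ?_
        have := hle h σ τ h1 h2 j
        have := hb j
        nlinarith
      by_contra hai
      have hai' : 0 < a i := lt_of_le_of_ne (ha i) (Ne.symm hai)
      have B2 : ∑ j, a j * ⟪h', c j (σ j)⟫ < ∑ j, a j := by
        refine Finset.sum_lt_sum (fun j _ => ?_) ⟨i, Finset.mem_univ i, ?_⟩
        · have := hle h' τ σ h1' h2' j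
          have := ha j
          nlinarith
        · have e : σ i = !τ i := by cases h1 : τ i <;> cases h2 : σ i <;> simp_all
          have := h2' i
          rw [← e] at this
          nlinarith
      linarith
    refine measure_mono_null hsub ?_
    rw [Measure.addHaar_image_linearMap]
    have : volume {y : EE d | y i = 0} = 0 := by
      have := Measure.addHaar_submodule (volume : Measure (EE d))
        (LinearMap.ker (EuclideanSpace.projₗ (𝕜 := ℝ) i : (EE d) →ₗ[ℝ] ℝ)) (by
          intro htop
          have : EuclideanSpace.single i (1 : ℝ) ∈ LinearMap.ker
            (EuclideanSpace.projₗ (𝕜 := ℝ) i : (EE d) →ₗ[ℝ] ℝ) := by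
            rw [htop]; trivial
          simp at this)
      convert this using 2
      ext y
      simp
    rw [this, mul_zero]
  have hsub : (⋃ σ : Fin d → Bool, lmap (fun j => c j (σ j)) '' simp0 d) ⊆ K := by
    refine Set.iUnion_subset fun σ => ?_
    rintro _ ⟨a, ⟨ha, ha1⟩, rfl⟩
    rw [lmap_apply]
    have := hK.sum_mem (t := Finset.univ) (w := fun o : Option (Fin d) =>
        o.elim (1 - ∑ j, a j) (fun j => a j))
      (z := fun o => o.elim 0 (fun j => c j (σ j))) (by
        rintro (_ | j) _
        · simpa using ha1
        · exact ha j) (by simp [Fintype.sum_option]) (by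
        rintro (_ | j) _
        · exact h0
        · exact hcK _ _)
    simpa [Fintype.sum_option] using this
  calc ENNReal.ofReal |vdet d (diag c)| * volume (simp0 d)
      = ∑ σ : Fin d → Bool, ENNReal.ofReal |vdet d (fun j => c j (σ j))| * volume (simp0 d) := by
        rw [← sum_abs_eq c hc, ENNReal.ofReal_sum_of_nonneg (fun _ _ => abs_nonneg _),
          Finset.sum_mul]
    _ = volume (⋃ σ : Fin d → Bool, lmap (fun j => c j (σ j)) '' simp0 d) := by
        rw [measure_iUnion₀ hdis fun σ =>
          ((simp0_convex d).linear_image _).nullMeasurableSet volume, tsum_fintype]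
        simp only [volume_lmap]
    _ ≤ volume K := measure_mono hsub

lemma bool_flip {s t : Bool} (h : s ≠ t) : s = !t := by
  cases s <;> cases t <;> simp_all

/-- A facet functional. -/
def Fac {d : ℕ} (c : Fin d → Bool → EE d) (σ : Fin d → Bool) (h : EE d) : Prop :=
  (∀ j, ⟪h, c j (σ j)⟫ = 1) ∧ (∀ j, ⟪h, c j (!σ j)⟫ < 1) ∧
    ∀ y : EE d, (∀ j, ⟪y, c j (σ j)⟫ = 0) → y = 0

/-- Facet hypothesis, in terms of functionals. -/
def FacetHyp {d : ℕ} (c : Fin d → Bool → EE d) : Prop :=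
  ∀ h : EE d, (∀ j s, ⟪h, c j s⟫ ≤ 1) →
    (∀ y : EE d, (∀ j s, ⟪h, c j s⟫ = 1 → ⟪y, c j s⟫ = 0) → y = 0) →
    ∀ i, (⟪h, c i true⟫ = 1 ∧ ⟪h, c i false⟫ ≠ 1) ∨ (⟪h, c i true⟫ ≠ 1 ∧ ⟪h, c i false⟫ = 1)

lemma Fac.tight {d : ℕ} {c : Fin d → Bool → EE d} {σ : Fin d → Bool} {h : EE d}
    (hF : Fac c σ h) {j : Fin d} {s : Bool} (hs : ⟪h, c j s⟫ = 1) : s = σ j := by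
  by_contra hne
  have : s = !σ j := bool_flip hne
  have h2 := hF.2.1 j
  rw [← this] at h2
  linarith

lemma exists_fac {d : ℕ} {c : Fin d → Bool → EE d} (hH : FacetHyp c) (h : EE d)
    (h1 : ∀ j s, ⟪h, c j s⟫ ≤ 1)
    (h2 : ∀ y : EE d, (∀ j s, ⟪h, c j s⟫ = 1 → ⟪y, c j s⟫ = 0) → y = 0) :
    ∃ σ, Fac c σ h := by
  have h3 : ∀ i, ∃ s, ⟪h, c i s⟫ = 1 ∧ ⟪h, c i (!s)⟫ < 1 := by
    intro i
    rcases hH h h1 h2 i with ⟨a, b⟩ | ⟨a, b⟩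
    · exact ⟨true, a, lt_of_le_of_ne (h1 _ _) b⟩
    · exact ⟨false, b, lt_of_le_of_ne (h1 _ _) a⟩
  choose σ h4 h5 using h3
  refine ⟨σ, h4, h5, fun y hy => h2 y ?_⟩
  intro j s hs
  by_cases hne : s = σ j
  · rw [hne]; exact hy j
  · have : s = !σ j := bool_flip hne
    have h6 := h5 j
    rw [← this] at h6
    linarith

lemma exists_dual {d : ℕ} (v : Fin d → EE d)
    (hv : ∀ y : EE d, (∀ j, ⟪y, v j⟫ = 0) → y = 0) (i : Fin d) :
    ∃ g : EE d, ⟪g, v i⟫ = 1 ∧ ∀ j, j ≠ i → ⟪g, v j⟫ = 0 := by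
  let f : (EE d) →ₗ[ℝ] (Fin d → ℝ) :=
    LinearMap.pi fun j => (innerSL ℝ (v j)).toLinearMap
  have hf : ∀ y j, f y j = ⟪y, v j⟫ := by
    intro y j
    rw [real_inner_comm]
    rfl
  have hinj : Function.Injective f := by
    rw [← LinearMap.ker_eq_bot, LinearMap.ker_eq_bot']
    intro y hy
    exact hv y fun j => by rw [← hf, hy]; rfl
  have hsur := (LinearMap.injective_iff_surjective_of_finrank_eq_finrank (by simp)).mp hinj
  obtain ⟨g, hg⟩ := hsur (Pi.single i 1)
  refine ⟨g, ?_, fun j hj => ?_⟩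
  · have := congrFun hg i
    rwa [hf, Pi.single_eq_same] at this
  · have := congrFun hg j
    rwa [hf, Pi.single_eq_of_ne hj] at this

lemma exists_coords {d : ℕ} (v : Fin d → EE d)
    (hv : ∀ y : EE d, (∀ j, ⟪y, v j⟫ = 0) → y = 0) (x : EE d) :
    ∃ a : EE d, lmap v a = x := by
  have hinj : Function.Injective (lmap v) := by
    rw [← LinearMap.ker_eq_bot, LinearMap.ker_eq_bot']
    intro y hy
    ext i
    obtain ⟨g, hg1, hg2⟩ := exists_dual v hv i
    have := congrArg (fun x => ⟪g, x⟫) hy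
    simp only [lmap_apply, inner_sum, inner_smul_right, inner_zero_right] at this
    rw [Finset.sum_eq_single i (fun j _ hj => by rw [hg2 j hj, mul_zero]) (by simp),
      hg1, mul_one] at this
    simpa using this
  exact (LinearMap.injective_iff_surjective.mp hinj) x

/-- The polar body. -/
def polar0 {d : ℕ} (c : Fin d → Bool → EE d) : Set (EE d) := {h | ∀ j s, ⟪h, c j s⟫ ≤ 1}

lemma polar0_compact {d : ℕ} (c : Fin d → Bool → EE d) (r : ℝ) (hr : 0 < r)
    (hR : ∀ (h : EE d) (m : ℝ), (∀ j s, ⟪h, c j s⟫ ≤ m) → r * ‖h‖ ≤ m) :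
    IsCompact (polar0 c) := by
  apply Metric.isCompact_of_isClosed_isBounded
  · simp only [polar0, Set.ofPred_forall]
    refine isClosed_iInter fun j => isClosed_iInter fun s => ?_
    exact isClosed_le (by fun_prop) continuous_const
  · refine (Metric.isBounded_closedBall (x := (0 : EE d)) (r := 1 / r)).subset ?_
    intro h hh
    rw [mem_closedBall_zero_iff, le_div_iff₀ hr, mul_comm]
    exact hR h 1 hh

lemma eventually_polar {d : ℕ} (c : Fin d → Bool → EE d) (h g : EE d)
    (h1 : ∀ j s, ⟪h, c j s⟫ ≤ 1) (hg : ∀ j s, ⟪h, c j s⟫ = 1 → ⟪g, c j s⟫ ≤ 0) :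
    ∃ t : ℝ, 0 < t ∧ ∀ j s, ⟪h + t • g, c j s⟫ ≤ 1 := by
  have key : ∀ᶠ t : ℝ in nhdsWithin 0 (Set.Ioi 0), ∀ j s, ⟪h + t • g, c j s⟫ ≤ 1 := by
    rw [Filter.eventually_all]; intro j
    rw [Filter.eventually_all]; intro s
    rcases (h1 j s).lt_or_eq with hlt | heq
    · have hc : Continuous fun t : ℝ => ⟪h + t • g, c j s⟫ := by fun_prop
      have : ∀ᶠ t : ℝ in nhds 0, ⟪h + t • g, c j s⟫ < 1 :=
        hc.continuousAt.eventually_lt continuousAt_const (by simpa using hlt)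
      exact (this.filter_mono nhdsWithin_le_nhds).mono fun t ht => ht.le
    · filter_upwards [self_mem_nhdsWithin] with t ht
      have ht' : 0 < t := ht
      have := hg j s heq
      simp only [inner_add_left, inner_smul_left, heq, RCLike.conj_to_real]
      nlinarith
  obtain ⟨t, h2, h3⟩ := (key.and self_mem_nhdsWithin).exists
  exact ⟨t, h3, h2⟩

lemma cover {d : ℕ} {c : Fin d → Bool → EE d} (hH : FacetHyp c) (r : ℝ) (hr : 0 < r)
    (hR : ∀ (h : EE d) (m : ℝ), (∀ j s, ⟪h, c j s⟫ ≤ m) → r * ‖h‖ ≤ m) (x : EE d) :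
    ∃ σ h, Fac c σ h ∧ ∃ a : EE d, (∀ j, 0 ≤ a j) ∧ lmap (fun j => c j (σ j)) a = x := by
  have hcomp := polar0_compact c r hr hR
  have hne : (polar0 c).Nonempty := ⟨0, by intro j s; simp⟩
  let l : StrongDual ℝ (EE d) := innerSL ℝ x
  have hl : ∀ y, l y = ⟪y, x⟫ := fun y => by simp [l, real_inner_comm]
  have hexp : IsExposed ℝ (polar0 c) (l.toExposed (polar0 c)) :=
    ContinuousLinearMap.toExposed.isExposed
  have hcomp2 := hexp.isCompact hcomp
  have hne2 : (l.toExposed (polar0 c)).Nonempty := by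
    obtain ⟨y, hy, hmax⟩ := hcomp.exists_isMaxOn hne l.continuous.continuousOn
    exact ⟨y, hy, fun z hz => hmax hz⟩
  obtain ⟨h, hh⟩ := hcomp2.extremePoints_nonempty hne2
  have hmax : ∀ y ∈ polar0 c, ⟪y, x⟫ ≤ ⟪h, x⟫ := by
    intro y hy
    have := hh.1.2 y hy
    rwa [hl, hl] at this
  have hext := hexp.isExtreme.extremePoints_subset_extremePoints hh
  have h1 : ∀ j s, ⟪h, c j s⟫ ≤ 1 := hext.1
  have h2 : ∀ y : EE d, (∀ j s, ⟪h, c j s⟫ = 1 → ⟪y, c j s⟫ = 0) → y = 0 := by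
    intro y hy
    obtain ⟨t, ht, htp⟩ := eventually_polar c h y h1 fun j s hs => (hy j s hs).le
    obtain ⟨u, hu, hup⟩ := eventually_polar c h (-y) h1 fun j s hs => by
      rw [inner_neg_left, hy j s hs, neg_zero]
    have := (mem_extremePoints.mp hext).2 (h + t • y) htp (h + u • (-y)) hup
      ⟨u / (t + u), t / (t + u), by positivity, by positivity, by field_simp; ring, by
        have : t + u ≠ 0 := by positivity
        match_scalars <;> field_simp <;> ring⟩
    have h3 := this.1
    rw [add_eq_left, smul_eq_zero] at h3
    exact h3.resolve_left ht.ne'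
  obtain ⟨σ, hF⟩ := exists_fac hH h h1 h2
  obtain ⟨a, ha⟩ := exists_coords _ hF.2.2 x
  refine ⟨σ, h, hF, a, ?_, ha⟩
  intro i
  by_contra hneg
  push Not at hneg
  obtain ⟨g, hg1, hg2⟩ := exists_dual _ hF.2.2 i
  obtain ⟨t, ht, htp⟩ := eventually_polar c h (-g) h1 (by
    intro j s hs
    rw [hF.tight hs, inner_neg_left]
    by_cases hj : j = i
    · subst hj; rw [hg1]; norm_num
    · rw [hg2 j hj]; simp)
  have h3 := hmax _ htp
  have h4 : ⟪g, x⟫ = a i := by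
    rw [← ha, lmap_apply]
    simp only [inner_sum, inner_smul_right]
    rw [Finset.sum_eq_single i (fun j _ hj => by rw [hg2 j hj, mul_zero]) (by simp),
      hg1, mul_one]
  simp only [inner_add_left, inner_smul_left, inner_neg_left, h4, RCLike.conj_to_real] at h3
  nlinarith

lemma fac_flip {d : ℕ} {c : Fin d → Bool → EE d} (hH : FacetHyp c) (r : ℝ) (hr : 0 < r)
    (hR : ∀ (h : EE d) (m : ℝ), (∀ j s, ⟪h, c j s⟫ ≤ m) → r * ‖h‖ ≤ m)
    (σ : Fin d → Bool) (i : Fin d) (hσ : ∃ h, Fac c σ h) :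
    ∃ h, Fac c (update σ i (!σ i)) h := by
  obtain ⟨h, hF⟩ := hσ
  have hle : ∀ j s, ⟪h, c j s⟫ ≤ 1 := by
    intro j s
    by_cases e : s = σ j
    · rw [e, hF.1]
    · have : s = !σ j := bool_flip e
      rw [this]; exact (hF.2.1 j).le
  obtain ⟨g, hg1, hg2⟩ := exists_dual _ hF.2.2 i
  let S : Finset (Fin d × Bool) := Finset.univ.filter fun x => ⟪g, c x.1 x.2⟫ < 0
  have hS : S.Nonempty := by
    by_contra hS
    rw [Finset.not_nonempty_iff_eq_empty, Finset.filter_eq_empty_iff] at hS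
    have := hR (-g) 0 (by
      intro j s
      have := hS (Finset.mem_univ (j, s))
      rw [inner_neg_left]
      simp only [not_lt] at this
      linarith)
    rw [norm_neg] at this
    have h0 : ‖g‖ ≤ 0 := by
      by_contra h; push Not at h; nlinarith
    have : g = 0 := norm_le_zero_iff.mp h0
    rw [this, inner_zero_left] at hg1
    norm_num at hg1
  obtain ⟨⟨k, s⟩, hks, hmin⟩ := S.exists_min_image
    (fun x => (1 - ⟪h, c x.1 x.2⟫) / (-⟪g, c x.1 x.2⟫)) hS
  have hks' : ⟪g, c k s⟫ < 0 := (Finset.mem_filter.mp hks).2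
  set t := (1 - ⟪h, c k s⟫) / (-⟪g, c k s⟫) with ht
  have hlt : ⟪h, c k s⟫ < 1 := by
    refine lt_of_le_of_ne (hle k s) fun heq => ?_
    have := hF.tight heq
    rw [this] at hks'
    by_cases hk : k = i
    · subst hk; linarith
    · linarith [hg2 k hk]
  have htpos : 0 < t := div_pos (by linarith) (by linarith)
  have hp : ∀ j s, ⟪h - t • g, c j s⟫ ≤ 1 := by
    intro j u
    simp only [inner_sub_left, inner_smul_left, RCLike.conj_to_real]
    by_cases hn : ⟪g, c j u⟫ < 0
    · have := hmin (j, u) (Finset.mem_filter.mpr ⟨Finset.mem_univ _, hn⟩)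
      rw [le_div_iff₀ (by linarith)] at this
      linarith
    · push Not at hn
      have := hle j u
      nlinarith
  have htk : ⟪h - t • g, c k s⟫ = 1 := by
    simp only [inner_sub_left, inner_smul_left, RCLike.conj_to_real]
    have : t * (-⟪g, c k s⟫) = 1 - ⟪h, c k s⟫ := by
      rw [ht]; exact div_mul_cancel₀ _ (by linarith)
    linarith
  have htj : ∀ j, j ≠ i → ⟪h - t • g, c j (σ j)⟫ = 1 := by
    intro j hj
    simp only [inner_sub_left, inner_smul_left, RCLike.conj_to_real, hg2 j hj, hF.1 j]
    ring
  have hti : ⟪h - t • g, c i (σ i)⟫ ≠ 1 := by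
    simp only [inner_sub_left, inner_smul_left, RCLike.conj_to_real, hg1, hF.1 i]
    linarith
  obtain ⟨τ, hτ⟩ := exists_fac hH _ hp (by
    intro y hy
    have e : y - ⟪y, c i (σ i)⟫ • g = 0 := by
      apply hF.2.2
      intro j
      simp only [inner_sub_left, inner_smul_left, RCLike.conj_to_real]
      by_cases hj : j = i
      · subst hj; rw [hg1]; ring
      · rw [hg2 j hj, hy j _ (htj j hj)]; ring
    rw [sub_eq_zero] at e
    have h3 := hy k s htk
    rw [e, inner_smul_left] at h3
    have h4 : ⟪y, c i (σ i)⟫ = 0 := by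
      rcases mul_eq_zero.mp h3 with h5 | h5
      · simpa using h5
      · linarith
    rw [e, h4, zero_smul])
  have : τ = update σ i (!σ i) := by
    funext j
    by_cases hj : j = i
    · subst hj
      rw [update_self]
      have h1 := hτ.1 j
      have : τ j ≠ σ j := by
        intro h; rw [h] at h1; exact hti h1
      cases h1 : τ j <;> cases h2 : σ j <;> simp_all
    · rw [update_of_ne hj]
      exact (hτ.tight (htj j hj)).symm
  exact ⟨_, this ▸ hτ⟩

lemma fac_all {d : ℕ} {c : Fin d → Bool → EE d} (hH : FacetHyp c) (r : ℝ) (hr : 0 < r)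
    (hR : ∀ (h : EE d) (m : ℝ), (∀ j s, ⟪h, c j s⟫ ≤ m) → r * ‖h‖ ≤ m) (σ : Fin d → Bool) :
    ∃ h, Fac c σ h := by
  obtain ⟨σ₀, h, hF, -⟩ := cover hH r hr hR 0
  exact flip_all (P := fun σ => ∃ h, Fac c σ h) σ₀ ⟨h, hF⟩
    (fun σ i => fac_flip hH r hr hR σ i) σ

lemma upper {d : ℕ} {c : Fin d → Bool → EE d} (hH : FacetHyp c) (r : ℝ) (hr : 0 < r)
    (hR : ∀ (h : EE d) (m : ℝ), (∀ j s, ⟪h, c j s⟫ ≤ m) → r * ‖h‖ ≤ m)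
    (K : Set (EE d))
    (hK : ∀ h : EE d, (∀ j s, ⟪h, c j s⟫ ≤ 1) → ∀ x ∈ K, ⟪h, x⟫ ≤ 1) :
    volume K ≤ ENNReal.ofReal |vdet d (diag c)| * volume (simp0 d) := by
  have hgood : Good c := fun σ => by
    obtain ⟨h, h1, h2, -⟩ := fac_all hH r hr hR σ
    exact ⟨h, h1, h2⟩
  have hsub : K ⊆ ⋃ σ : Fin d → Bool, lmap (fun j => c j (σ j)) '' simp0 d := by
    intro x hx
    obtain ⟨σ, h, hF, a, ha, hax⟩ := cover hH r hr hR x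
    refine Set.mem_iUnion.mpr ⟨σ, a, ⟨ha, ?_⟩, hax⟩
    have h1 := hK h (by
      intro j s
      by_cases e : s = σ j
      · rw [e, hF.1]
      · have : s = !σ j := bool_flip e
        rw [this]; exact (hF.2.1 j).le) x hx
    rw [← hax, lmap_apply] at h1
    simpa only [inner_sum, inner_smul_right, hF.1, mul_one] using h1
  calc volume K ≤ volume (⋃ σ : Fin d → Bool, lmap (fun j => c j (σ j)) '' simp0 d) :=
        measure_mono hsub
    _ ≤ ∑ σ : Fin d → Bool, volume (lmap (fun j => c j (σ j)) '' simp0 d) :=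
        measure_iUnion_fintype_le _ _
    _ = ENNReal.ofReal |vdet d (diag c)| * volume (simp0 d) := by
        rw [← sum_abs_eq c hgood, ENNReal.ofReal_sum_of_nonneg (fun _ _ => abs_nonneg _),
          Finset.sum_mul]
        simp only [volume_lmap]

/-- Moving one vertex. -/
def move {d : ℕ} (c : Fin d → Bool → EE d) (i : Fin d) (s : Bool) (x : EE d) :
    Fin d → Bool → EE d := fun j u => if j = i ∧ u = s then x else c j u

lemma good_move {d : ℕ} {c : Fin d → Bool → EE d} (hF : ∀ σ, ∃ h, Fac c σ h)
    (i : Fin d) (s : Bool) : ∀ᶠ x in nhds (c i s), Good (move c i s x) := by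
  unfold Good
  rw [Filter.eventually_all]
  intro σ
  obtain ⟨h, h1, h2, h3⟩ := hF σ
  by_cases hs : σ i = s
  · obtain ⟨g, hg1, hg2⟩ := exists_dual _ h3 i
    rw [hs] at hg1
    have hi := h1 i
    rw [hs] at hi
    have e1 : ∀ᶠ x in nhds (c i s), ⟪g, x⟫ ≠ 0 := by
      have hc : Continuous fun x : EE d => ⟪g, x⟫ := by fun_prop
      exact hc.continuousAt.eventually_ne (by rw [hg1]; norm_num)
    have e2 : ∀ᶠ x in nhds (c i s), ∀ j,
        ⟪h + ((1 - ⟪h, x⟫) / ⟪g, x⟫) • g, c j (!σ j)⟫ < 1 := by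
      rw [Filter.eventually_all]
      intro j
      have hc : ContinuousAt
          (fun x : EE d => ⟪h + ((1 - ⟪h, x⟫) / ⟪g, x⟫) • g, c j (!σ j)⟫) (c i s) := by
        have : ContinuousAt (fun x : EE d => (1 - ⟪h, x⟫) / ⟪g, x⟫) (c i s) :=
          ContinuousAt.div (by fun_prop) (by fun_prop) (by rw [hg1]; norm_num)
        fun_prop
      refine hc.eventually_lt continuousAt_const ?_
      rw [hi]
      simpa using h2 j
    filter_upwards [e1, e2] with x hx1 hx2
    refine ⟨h + ((1 - ⟪h, x⟫) / ⟪g, x⟫) • g, fun j => ?_, fun j => ?_⟩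
    · by_cases hj : j = i
      · subst hj
        simp only [move, hs, and_self, if_true, inner_add_left, inner_smul_left,
          RCLike.conj_to_real]
        field_simp
        ring
      · simp only [move, hj, false_and, if_false, inner_add_left, inner_smul_left,
          RCLike.conj_to_real, hg2 j hj, h1 j]
        ring
    · have : ¬ (j = i ∧ (!σ j) = s) := by
        rintro ⟨rfl, h⟩
        rw [hs] at h
        simp at h
      simp only [move, this, if_false]
      exact hx2 j
  · have hs' : s = !σ i := bool_flip (Ne.symm hs)
    have e1 : ∀ᶠ x in nhds (c i s), ⟪h, x⟫ < 1 := by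
      have hc : Continuous fun x : EE d => ⟪h, x⟫ := by fun_prop
      refine hc.continuousAt.eventually_lt continuousAt_const ?_
      rw [hs']; exact h2 i
    filter_upwards [e1] with x hx
    refine ⟨h, fun j => ?_, fun j => ?_⟩
    · have : ¬ (j = i ∧ (σ j) = s) := by
        rintro ⟨rfl, h⟩
        exact hs h
      simp only [move, this, if_false]
      exact h1 j
    · by_cases hj : j = i ∧ (!σ j) = s
      · simp only [move]; rw [if_pos hj]; exact hx
      · simp only [move, hj, if_false]; exact h2 j

lemma crit {d : ℕ} (φ : (EE d) →ₗ[ℝ] ℝ) (a b : EE d) (ha : ‖a‖ = 1) (hab : φ (a - b) ≠ 0)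
    (hloc : ∀ᶠ x in nhds a, ‖x‖ = 1 → |φ (x - b)| ≤ |φ (a - b)|) (y : EE d) :
    φ y = ⟪a, y⟫ * φ a := by
  have key : ∀ v : EE d, ‖v‖ = 1 → ⟪a, v⟫ = 0 → φ v = 0 := by
    intro v hv hav
    let G : ℝ → ℝ := fun t => (Real.cos t * φ a + Real.sin t * φ v - φ b) ^ 2
    have hG : HasDerivAt G (2 * (φ a - φ b) * φ v) 0 := by
      have h1 := (((Real.hasDerivAt_cos 0).mul_const (φ a)).add
        ((Real.hasDerivAt_sin 0).mul_const (φ v))).sub_const (φ b)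
      have h2 : HasDerivAt G _ 0 := h1.pow 2
      convert h2 using 1
      simp
    have hc : Filter.Tendsto (fun t : ℝ => Real.cos t • a + Real.sin t • v)
        (nhds 0) (nhds a) := by
      have : Continuous (fun t : ℝ => Real.cos t • a + Real.sin t • v) := by fun_prop
      have h := this.tendsto 0
      simpa using h
    have hmax : IsLocalMax G 0 := by
      have h3 := hc.eventually hloc
      filter_upwards [h3] with t ht
      have hn : ‖Real.cos t • a + Real.sin t • v‖ = 1 := by
        have : ‖Real.cos t • a + Real.sin t • v‖ ^ 2 = 1 := by
          rw [norm_add_sq_real, norm_smul, norm_smul, ha, hv, inner_smul_left, inner_smul_right,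
            hav]
          simp [Real.cos_sq_add_sin_sq]
        have h0 := norm_nonneg (Real.cos t • a + Real.sin t • v)
        nlinarith
      have := sq_le_sq.mpr (ht hn)
      simpa [G, map_sub, map_add, map_smul] using this
    have h0 := hmax.hasDerivAt_eq_zero hG
    rw [map_sub] at hab
    rcases mul_eq_zero.mp h0 with h | h
    · exact absurd (by linarith) hab
    · exact h
  set w := y - ⟪a, y⟫ • a with hw
  have hwa : ⟪a, w⟫ = 0 := by
    rw [hw, inner_sub_right, inner_smul_right, real_inner_self_eq_norm_sq, ha]; ring
  have hφw : φ w = 0 := by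
    by_cases h0 : w = 0
    · rw [h0, map_zero]
    · have hn : ‖w‖ ≠ 0 := norm_ne_zero_iff.mpr h0
      have := key (‖w‖⁻¹ • w) (by rw [norm_smul, norm_inv, norm_norm, inv_mul_cancel₀ hn])
        (by rw [inner_smul_right, hwa, mul_zero])
      rw [map_smul, smul_eq_mul] at this
      exact (mul_eq_zero.mp this).resolve_left (inv_ne_zero hn)
  rw [hw, map_sub, map_smul, smul_eq_mul] at hφw
  linarith

lemma hull_le {d : ℕ} {V : Set (EE d)} (o h : EE d) (m : ℝ) (hv : ∀ z ∈ V, ⟪h, z - o⟫ ≤ m)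
    (z : EE d) (hz : z ∈ convexHull ℝ V) : ⟪h, z - o⟫ ≤ m := by
  have hconv : Convex ℝ {z : EE d | ⟪h, z⟫ ≤ m + ⟪h, o⟫} :=
    convex_halfSpace_le (innerSL ℝ h).toLinearMap.isLinear _
  have := convexHull_min (s := V) (fun z hz => by
    have := hv z hz
    rw [inner_sub_right] at this
    change ⟪h, z⟫ ≤ m + ⟪h, o⟫
    linarith) hconv hz
  rw [inner_sub_right]
  have h2 : ⟪h, z⟫ ≤ m + ⟪h, o⟫ := this
  linarith

lemma radius {d : ℕ} {V : Set (EE d)} (o : EE d) (r : ℝ) (hr : 0 < r)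
    (hb : Metric.closedBall o r ⊆ convexHull ℝ V) (h : EE d) (m : ℝ)
    (hv : ∀ z ∈ V, ⟪h, z - o⟫ ≤ m) : r * ‖h‖ ≤ m := by
  by_cases h0 : h = 0
  · have := hull_le o h m hv o (hb (Metric.mem_closedBall_self hr.le))
    simpa [h0] using this
  · have hn : ‖h‖ ≠ 0 := norm_ne_zero_iff.mpr h0
    have := hull_le o h m hv (o + (r / ‖h‖) • h) (hb (by
      rw [mem_closedBall_iff_norm, add_sub_cancel_left, norm_smul, norm_div, norm_norm,
        div_mul_cancel₀ _ hn, Real.norm_of_nonneg hr.le]))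
    rw [add_sub_cancel_left, inner_smul_right, real_inner_self_eq_norm_sq] at this
    convert this using 1
    field_simp

lemma center_mem {d : ℕ} {V : Set (EE d)} (hfin : V.Finite) (o : EE d) (r : ℝ) (hr : 0 < r)
    (hb : Metric.closedBall o r ⊆ convexHull ℝ V) (p x : EE d) (hx : dist x p < r) :
    o ∈ convexHull ℝ ((V \ {p}) ∪ {x}) := by
  by_contra ho
  have hfin' : ((V \ {p}) ∪ {x}).Finite := hfin.sdiff.union (Set.finite_singleton x)
  obtain ⟨f, u, hf, hu⟩ := geometric_hahn_banach_closed_point (convex_convexHull ℝ _)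
    (hfin'.isCompact_convexHull ℝ).isClosed ho
  set h := (InnerProductSpace.toDual ℝ (EE d)).symm f with hh
  have hin : ∀ y, ⟪h, y⟫ = f y := fun y => by
    rw [hh, InnerProductSpace.toDual_symm_apply]
  have hlt : ∀ z ∈ (V \ {p}) ∪ {x}, ⟪h, z - o⟫ < 0 := by
    intro z hz
    have := hf z (subset_convexHull ℝ _ hz)
    rw [inner_sub_right, hin, hin]
    linarith
  have hxlt := hlt x (Or.inr rfl)
  have hpos : 0 < ‖h‖ := by
    rw [norm_pos_iff]
    rintro h0
    rw [h0, inner_zero_left] at hxlt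
    exact lt_irrefl _ hxlt
  have := radius o r hr hb h (‖h‖ * dist x p) (by
    intro z hz
    by_cases hzp : z = p
    · subst hzp
      have e : z - o = (z - x) + (x - o) := by abel
      rw [e, inner_add_right]
      have h1 := real_inner_le_norm h (z - x)
      rw [← dist_eq_norm, dist_comm] at h1
      linarith
    · have h1 := hlt z (Or.inl ⟨hz, hzp⟩)
      have : 0 ≤ ‖h‖ * dist x p := by positivity
      linarith)
  nlinarith

lemma facetHyp_of {d : ℕ} (hd : 2 ≤ d) (v : Fin d → Bool → EE d) (V : Set (EE d))
    (hV : V = {z | ∃ j s, v j s = z}) (o : EE d)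
    (hfacet : ∀ F : Set (EE d), IsFacet (convexHull ℝ V) F →
      ∀ i : Fin d, (v i true ∈ F ∧ v i false ∉ F) ∨ (v i true ∉ F ∧ v i false ∈ F)) :
    FacetHyp (fun j s => v j s - o) := by
  intro h h1 h2
  have hvV : ∀ j s, v j s ∈ convexHull ℝ V := fun j s =>
    subset_convexHull ℝ _ (by rw [hV]; exact ⟨j, s, rfl⟩)
  have hP : ∀ z ∈ convexHull ℝ V, ⟪h, z - o⟫ ≤ 1 := by
    apply hull_le
    rw [hV]
    rintro _ ⟨j, s, rfl⟩
    exact h1 j s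
  have htight : ∃ j s, ⟪h, v j s - o⟫ = 1 := by
    by_contra hno
    push Not at hno
    have := h2 (EuclideanSpace.single ⟨0, by omega⟩ 1) (fun j s hs => absurd hs (hno j s))
    simp at this
  obtain ⟨j₀, s₀, ht⟩ := htight
  have h0 : h ≠ 0 := by
    rintro h0; rw [h0, inner_zero_left] at ht; norm_num at ht
  let F : Set (EE d) := {z | z ∈ convexHull ℝ V ∧ ⟪h, z - o⟫ = 1}
  have hmem : ∀ j s, v j s ∈ F ↔ ⟪h, v j s - o⟫ = 1 :=
    fun j s => ⟨fun h => h.2, fun h => ⟨hvV j s, h⟩⟩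
  have hfac : IsFacet (convexHull ℝ V) F := by
    constructor
    · intro _
      refine ⟨innerSL ℝ h, ?_⟩
      ext z
      constructor
      · rintro ⟨hz, hz1⟩
        refine ⟨hz, fun y hy => ?_⟩
        have := hP y hy
        rw [← hz1, inner_sub_right, inner_sub_right] at this
        simp only [innerSL_apply_apply]
        linarith
      · rintro ⟨hz, hz1⟩
        refine ⟨hz, le_antisymm (hP z hz) ?_⟩
        have := hz1 _ (hvV j₀ s₀)
        simp only [innerSL_apply_apply] at this
        rw [← ht, inner_sub_right, inner_sub_right]
        linarith
    · rw [direction_affineSpan]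
      have hup : vectorSpan ℝ F ≤ (Submodule.span ℝ {h})ᗮ := by
        rw [vectorSpan_def, Submodule.span_le]
        rintro _ ⟨a, ha, b, hb, rfl⟩
        rw [SetLike.mem_coe, Submodule.mem_orthogonal_singleton_iff_inner_right]
        change ⟪h, a - b⟫ = 0
        have e : a - b = (a - o) - (b - o) := by abel
        rw [e, inner_sub_right, ha.2, hb.2, sub_self]
      have hup' := Submodule.finrank_mono hup
      have hsum := Submodule.finrank_add_finrank_orthogonal (Submodule.span ℝ {h})
      rw [finrank_span_singleton h0, finrank_euclideanSpace_fin] at hsum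
      have htop : vectorSpan ℝ F ⊔ Submodule.span ℝ {v j₀ s₀ - o} = ⊤ := by
        rw [← Submodule.orthogonal_eq_bot_iff, Submodule.eq_bot_iff]
        intro y hy
        rw [Submodule.mem_orthogonal'] at hy
        apply h2
        intro j s hs
        have e : v j s - o = (v j s - v j₀ s₀) + (v j₀ s₀ - o) := by abel
        change ⟪y, v j s - o⟫ = 0
        rw [e]
        apply hy
        refine Submodule.add_mem_sup ?_ (Submodule.mem_span_singleton_self _)
        exact vsub_mem_vectorSpan ℝ ((hmem j s).mpr hs) ((hmem j₀ s₀).mpr ht)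
      have hlow := Submodule.finrank_add_le_finrank_add_finrank (vectorSpan ℝ F)
        (Submodule.span ℝ {v j₀ s₀ - o})
      have h1 : Module.finrank ℝ (Submodule.span ℝ {v j₀ s₀ - o}) ≤ 1 :=
        (finrank_span_le_card _).trans (by simp)
      rw [htop, finrank_top, finrank_euclideanSpace_fin] at hlow
      omega
  intro i
  have := hfacet F hfac i
  rw [hmem, hmem] at this
  exact this

lemma diag_move {d : ℕ} (v : Fin d → Bool → EE d) (i : Fin d) (s : Bool) (x : EE d) :
    |vdet d (diag (move v i s x))| = |vdet d (update (diag v) i (x - v i (!s)))| := by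
  cases s
  · have : diag (move v i false x) = update (diag v) i (-(x - v i true)) := by
      funext j
      by_cases hj : j = i
      · subst hj; simp [diag, move]
      · simp [diag, move, hj]
    have h2 := (vdet d).map_update_smul (diag v) i (-1 : ℝ) (x - v i true)
    rw [neg_one_smul] at h2
    rw [this, h2, neg_one_smul, abs_neg]
    rfl
  · have : diag (move v i true x) = update (diag v) i (x - v i false) := by
      funext j
      by_cases hj : j = i
      · subst hj; simp [diag, move]
      · simp [diag, move, hj]
    rw [this]
    rfl

theorem core {d : ℕ} (hd : 2 ≤ d) (v : Fin d → Bool → EE d)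
    (hsph : ∀ j s, ‖v j s‖ = 1) (hinj : ∀ j s k t, v j s = v k t → j = k ∧ s = t)
    (V : Set (EE d)) (hV : V = {z | ∃ j s, v j s = z})
    (hdim : affineSpan ℝ V = ⊤) (hZ : PropertyZ V)
    (hfacet : ∀ F : Set (EE d), IsFacet (convexHull ℝ V) F →
      ∀ i : Fin d, (v i true ∈ F ∧ v i false ∉ F) ∨ (v i true ∉ F ∧ v i false ∈ F)) :
    (∀ i, v i false = -(v i true)) ∧ (∀ i j, i ≠ j → ⟪v i true, v j true⟫ = 0) := by
  have hfin : V.Finite := by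
    have : V = Set.range (fun x : Fin d × Bool => v x.1 x.2) := by
      rw [hV]; ext z; simp
    rw [this]; exact Set.finite_range _
  have hvV : ∀ j s, v j s ∈ V := fun j s => by rw [hV]; exact ⟨j, s, rfl⟩
  obtain ⟨o, ho⟩ := interior_convexHull_nonempty_iff_affineSpan_eq_top.mpr hdim
  obtain ⟨r, hr, hb⟩ := Metric.nhds_basis_closedBall.mem_iff.mp (mem_interior_iff_mem_nhds.mp ho)
  set c : Fin d → Bool → EE d := fun j s => v j s - o with hc
  have hH : FacetHyp c := facetHyp_of hd v V hV o hfacet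
  have hR : ∀ (h : EE d) (m : ℝ), (∀ j s, ⟪h, c j s⟫ ≤ m) → r * ‖h‖ ≤ m := by
    intro h m hm
    refine radius o r hr hb h m ?_
    rw [hV]
    rintro _ ⟨j, s, rfl⟩
    exact hm j s
  have hdiag : diag c = diag v := by funext j; simp [diag, hc]
  have hdm : ∀ i s x, diag (move c i s (x - o)) = diag (move v i s x) := by
    intro i s x
    funext j
    simp only [diag, move, hc]
    split_ifs <;> abel
  have hup : volume (convexHull ℝ V) ≤ ENNReal.ofReal |vdet d (diag v)| * volume (simp0 d) := by
    rw [← hdiag, ← measure_preimage_add_right volume o]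
    refine upper hH r hr hR _ ?_
    intro h hh x hx
    have := hull_le o h 1 (by
      rw [hV]
      rintro _ ⟨j, s, rfl⟩
      exact hh j s) _ hx
    simpa using this
  have hall := fac_all hH r hr hR
  have hlow : ∀ i s, ∀ᶠ x in nhds (v i s),
      ENNReal.ofReal |vdet d (diag (move v i s x))| * volume (simp0 d)
        ≤ volume (convexHull ℝ ((V \ {v i s}) ∪ {x})) := by
    intro i s
    have hg : ∀ᶠ x in nhds (v i s), Good (move c i s (x - o)) := by
      have : Filter.Tendsto (fun x : EE d => x - o) (nhds (v i s)) (nhds (c i s)) :=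
        (continuous_id.sub continuous_const).tendsto _
      exact this.eventually (good_move hall i s)
    filter_upwards [hg, Metric.ball_mem_nhds (v i s) hr] with x hx1 hx2
    rw [← hdm, ← measure_preimage_add_right volume o (convexHull ℝ _)]
    refine lower _ hx1 _ ?_ ?_ ?_
    · exact (convex_convexHull ℝ _).translate_preimage_left o
    · have := center_mem hfin o r hr hb (v i s) x hx2
      simpa using this
    · intro j u
      apply subset_convexHull ℝ
      simp only [move]
      split_ifs with hju
      · right; simp
      · left
        refine ⟨by simpa [hc] using hvV j u, ?_⟩
        simp only [hc, sub_add_cancel, Set.mem_singleton_iff]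
        intro e
        exact hju (hinj _ _ _ _ e)
  have hpos : 0 < volume (convexHull ℝ V) :=
    (isOpen_interior.measure_pos volume ⟨o, ho⟩).trans_le (measure_mono interior_subset)
  have hlt : volume (convexHull ℝ V) < ⊤ := (hfin.isCompact_convexHull ℝ).measure_lt_top
  have hmself : ∀ i s, move v i s (v i s) = v := by
    intro i s
    funext j u
    simp only [move]
    split_ifs with hju
    · rw [hju.1, hju.2]
    · rfl
  have hne : ENNReal.ofReal |vdet d (diag v)| * volume (simp0 d) ≠ 0 := (hpos.trans_le hup).ne'
  have hS0 : volume (simp0 d) ≠ 0 := right_ne_zero_of_mul hne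
  have hD0 : vdet d (diag v) ≠ 0 := by
    intro h0
    apply hne
    simp [h0]
  have hSt : volume (simp0 d) ≠ ⊤ := by
    intro htop
    have h1 := (hlow ⟨0, by omega⟩ true).self_of_nhds
    rw [hmself, Set.sdiff_union_self,
      Set.union_eq_left.mpr (Set.singleton_subset_iff.mpr (hvV _ _)), htop,
      ENNReal.mul_top (left_ne_zero_of_mul hne)] at h1
    exact absurd (h1.trans_lt hlt) (lt_irrefl _)
  have hloc : ∀ i s, ∀ᶠ x in nhds (v i s), ‖x‖ = 1 →
      |vdet d (update (diag v) i (x - v i (!s)))| ≤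
        |vdet d (update (diag v) i (v i s - v i (!s)))| := by
    intro i s
    obtain ⟨ε, hε, hz⟩ := hZ (v i s) (hvV i s)
    filter_upwards [hlow i s, Metric.ball_mem_nhds (v i s) hε] with x hx1 hx2 hx3
    rw [← diag_move, ← diag_move, hmself]
    have h1 := hx1.trans ((hz x (by simpa using hx3) hx2).trans hup)
    rw [ENNReal.mul_le_mul_iff_left hS0 hSt] at h1
    exact (ENNReal.ofReal_le_ofReal_iff (abs_nonneg _)).mp h1
  let φ : Fin d → ((EE d) →ₗ[ℝ] ℝ) := fun i => (vdet d).toMultilinearMap.toLinearMap (diag v) i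
  have hφ : ∀ i y, φ i y = vdet d (update (diag v) i y) := fun i y => rfl
  have hφ0 : ∀ i s, φ i (v i s - v i (!s)) ≠ 0 := by
    intro i s
    rw [hφ, ← abs_ne_zero, ← diag_move, hmself, abs_ne_zero]
    exact hD0
  have hcrit : ∀ i s y, φ i y = ⟪v i s, y⟫ * φ i (v i s) := by
    intro i s y
    exact crit (φ i) (v i s) (v i (!s)) (hsph i s) (hφ0 i s) (hloc i s) y
  have hφv : ∀ i s, φ i (v i s) ≠ 0 := by
    intro i s h0
    apply hφ0 i s
    rw [hcrit i s, h0, mul_zero]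
  have hneg : ∀ i, v i false = -(v i true) := by
    intro i
    have hvec : φ i (v i true) • v i true = φ i (v i false) • v i false := by
      apply ext_inner_right ℝ
      intro y
      rw [inner_smul_left, inner_smul_left]
      have h1 := hcrit i true y
      have h2 := hcrit i false y
      simp only [RCLike.conj_to_real]
      linarith
    have hnorm := congrArg norm hvec
    rw [norm_smul, norm_smul, hsph, hsph, mul_one, mul_one, Real.norm_eq_abs,
      Real.norm_eq_abs] at hnorm
    rcases abs_eq_abs.mp hnorm with h | h
    · rw [h] at hvec
      have := smul_right_injective _ (hφv i false) hvec
      exact absurd (hinj _ _ _ _ this).2 (by simp)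
    · rw [h, neg_smul, ← smul_neg] at hvec
      exact (smul_right_injective _ (hφv i false) hvec).symm
  refine ⟨hneg, ?_⟩
  intro i j hij
  have h1 : φ i (diag v j) = 0 := by
    rw [hφ]
    exact (vdet d).map_eq_zero_of_eq _ (by
      rw [update_self, update_of_ne hij.symm]) hij
  rw [hcrit i true] at h1
  have h2 := (mul_eq_zero.mp h1).resolve_right (hφv i true)
  rw [diag, hneg j, sub_neg_eq_add, inner_add_right] at h2
  linarith

end CrossZ

theorem propertyZ_crosspolytope (d : ℕ) (hd : 2 ≤ d)
    (p q : Fin d → EuclideanSpace ℝ (Fin d))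
    (hpsph : ∀ i, p i ∈ Metric.sphere (0 : EuclideanSpace ℝ (Fin d)) 1)
    (hqsph : ∀ i, q i ∈ Metric.sphere (0 : EuclideanSpace ℝ (Fin d)) 1)
    (hdistinct : Function.Injective (Sum.elim p q))
    (V : Set (EuclideanSpace ℝ (Fin d))) (hV : V = Set.range p ∪ Set.range q)
    (hdim : affineSpan ℝ V = ⊤)
    (hvert : (convexHull ℝ V).extremePoints ℝ = V)
    (hZ : PropertyZ V)
    (hfacet : ∀ F : Set (EuclideanSpace ℝ (Fin d)), IsFacet (convexHull ℝ V) F →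
      ∀ i : Fin d, (p i ∈ F ∧ q i ∉ F) ∨ (p i ∉ F ∧ q i ∈ F)) :
    (∀ i, q i = -(p i)) ∧ (∀ i j, i ≠ j → ⟪p i, p j⟫ = 0) := by
  have := CrossZ.core hd (fun j s => if s = true then p j else q j) (by
      intro j s
      cases s
      · simpa using hqsph j
      · simpa using hpsph j) (by
      intro j s k t h
      cases s <;> cases t
      · have := @hdistinct (Sum.inr j) (Sum.inr k) (by simpa using h)
        simpa using this
      · have := @hdistinct (Sum.inr j) (Sum.inl k) (by simpa using h)
        simp at this
      · have := @hdistinct (Sum.inl j) (Sum.inr k) (by simpa using h)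
        simp at this
      · have := @hdistinct (Sum.inl j) (Sum.inl k) (by simpa using h)
        simpa using this) V (by
      rw [hV]
      ext z
      constructor
      · rintro (⟨j, rfl⟩ | ⟨j, rfl⟩)
        · exact ⟨j, true, by simp⟩
        · exact ⟨j, false, by simp⟩
      · rintro ⟨j, s, rfl⟩
        cases s
        · right; exact ⟨j, by simp⟩
        · left; exact ⟨j, by simp⟩) hdim hZ (by simpa using hfacet)
  simpa using this
end

section
/- Let d ≥ 2 be an integer, and for an integer k with 1 ≤ k ≤ d−1 define g(k) = (k+1)^{k+1} · (d−k+1)^{d−k+1} / (k^k · (d−k)^{d−k}). Then g(k) ≤ g(⌊d/2⌋) for all 1 ≤ k ≤ d−1, with equality if and only if k ∈ {⌊d/2⌋, ⌈d/2⌉}. -/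
noncomputable def auxF (x : ℝ) : ℝ := (x + 1) * Real.log (x + 1) - x * Real.log x

theorem auxF_deriv (x : ℝ) (hx : 0 < x) :
    HasDerivAt auxF (Real.log (x + 1) - Real.log x) x := by
  have h1 := Real.hasDerivAt_mul_log hx.ne'
  have h2 := (Real.hasDerivAt_mul_log (x := x + 1) (by positivity)).comp_add_const x 1
  have h3 := h2.sub h1
  have e : Real.log (x + 1) + 1 - (Real.log x + 1) = Real.log (x + 1) - Real.log x := by ring
  rw [e] at h3
  exact h3

theorem auxF_concave : StrictConcaveOn ℝ (Set.Ioi 0) auxF := by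
  apply StrictAntiOn.strictConcaveOn_of_deriv (convex_Ioi 0)
  · intro x hx
    exact (auxF_deriv x hx).continuousAt.continuousWithinAt
  · rw [interior_Ioi]
    intro x hx y hy hxy
    have hx' : 0 < x := hx
    have hy' : 0 < y := hy
    rw [(auxF_deriv x hx).deriv, (auxF_deriv y hy).deriv,
      ← Real.log_div (by positivity) (by positivity),
      ← Real.log_div (by positivity) (by positivity)]
    apply Real.log_lt_log (by positivity)
    rw [div_lt_div_iff₀ hy' hx']
    nlinarith

theorem auxF_lt (a b p q : ℝ) (ha : 0 < a) (hap : a < p) (hpb : p < b) (h : p + q = a + b) :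
    auxF a + auxF b < auxF p + auxF q := by
  have hab : 0 < b - a := by linarith
  have hb : 0 < b := by linarith
  have hs : 0 < (b - p) / (b - a) := div_pos (by linarith) hab
  have ht : 0 < (p - a) / (b - a) := div_pos (by linarith) hab
  have hst : (b - p) / (b - a) + (p - a) / (b - a) = 1 := by field_simp; ring
  have h1 := auxF_concave.2 (Set.mem_Ioi.2 ha) (Set.mem_Ioi.2 hb) (by linarith) hs ht hst
  have h2 := auxF_concave.2 (Set.mem_Ioi.2 ha) (Set.mem_Ioi.2 hb) (by linarith) ht hs
    (by rw [add_comm]; exact hst)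
  have e1 : (b - p) / (b - a) * a + (p - a) / (b - a) * b = p := by field_simp; ring
  have e2 : (p - a) / (b - a) * a + (b - p) / (b - a) * b = q := by
    have : q = a + b - p := by linarith
    rw [this]; field_simp; ring
  simp only [smul_eq_mul] at h1 h2
  rw [e1] at h1
  rw [e2] at h2
  have e3 : auxF a + auxF b = ((b - p) / (b - a) + (p - a) / (b - a)) * (auxF a + auxF b) := by
    rw [hst, one_mul]
  rw [e3]
  linarith

theorem auxF_exp (n : ℕ) (hn : 1 ≤ n) :
    Real.exp (auxF n) = ((n : ℝ) + 1) ^ (n + 1) / (n : ℝ) ^ n := by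
  have hn' : (0 : ℝ) < n := by exact_mod_cast hn
  have e : auxF n = ((n + 1 : ℕ) : ℝ) * Real.log ((n : ℝ) + 1) - n * Real.log n := by
    simp [auxF]
  rw [e, Real.exp_sub, Real.exp_nat_mul, Real.exp_nat_mul, Real.exp_log hn',
    Real.exp_log (by positivity)]

theorem two_simplices_optimal_split (d : ℕ) (hd : 2 ≤ d) (g : ℕ → ℝ)
    (hg : ∀ k : ℕ, g k =
      ((k : ℝ) + 1) ^ (k + 1) * ((d : ℝ) - (k : ℝ) + 1) ^ (d - k + 1) /
        ((k : ℝ) ^ k * ((d : ℝ) - (k : ℝ)) ^ (d - k))) :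
    ∀ k : ℕ, 1 ≤ k → k ≤ d - 1 →
      g k ≤ g (d / 2) ∧ (g k = g (d / 2) ↔ k = d / 2 ∨ k = (d + 1) / 2) := by
  have key : ∀ k : ℕ, 1 ≤ k → k ≤ d - 1 →
      g k = Real.exp (auxF k + auxF ((d - k : ℕ) : ℝ)) := by
    intro k h1 h2
    rw [hg, Real.exp_add, auxF_exp k h1, auxF_exp (d - k) (by omega),
      Nat.cast_sub (by omega), div_mul_div_comm]
  intro k h1 h2
  rw [key k h1 h2, key (d / 2) (by omega) (by omega), Real.exp_le_exp, Real.exp_eq_exp]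
  by_cases hk : k = d / 2 ∨ k = (d + 1) / 2
  · have e : auxF k + auxF ((d - k : ℕ) : ℝ)
        = auxF ((d / 2 : ℕ) : ℝ) + auxF ((d - d / 2 : ℕ) : ℝ) := by
      rcases hk with hk | hk
      · rw [hk]
      · have e1 : d - k = d / 2 := by omega
        have e2 : d - d / 2 = k := by omega
        rw [e1, e2, add_comm]
    exact ⟨e.le, fun _ => hk, fun _ => e⟩
  · have e : auxF k + auxF ((d - k : ℕ) : ℝ)
        < auxF ((d / 2 : ℕ) : ℝ) + auxF ((d - d / 2 : ℕ) : ℝ) := by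
      rcases lt_or_ge k (d / 2) with h | h
      · apply auxF_lt
        · exact_mod_cast h1
        · exact_mod_cast h
        · have : d / 2 < d - k := by omega
          exact_mod_cast this
        · have : d / 2 + (d - d / 2) = k + (d - k) := by omega
          exact_mod_cast this
      · rw [add_comm]
        apply auxF_lt
        · have : 0 < d - k := by omega
          exact_mod_cast this
        · have : d - k < d / 2 := by omega
          exact_mod_cast this
        · have : d / 2 < k := by omega
          exact_mod_cast this
        · have : d / 2 + (d - d / 2) = (d - k) + k := by omega
          exact_mod_cast this
    exact ⟨e.le, fun h => absurd h e.ne, fun h => absurd h hk⟩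
end

section
/- Let d ≥ 3 be an integer. For positive integers k₁, k₂, k₃ with k₁+k₂+k₃ = d, the quantity ∏_{i=1}^{3} (kᵢ+1)^{kᵢ+1} / kᵢ^{kᵢ} is maximal if and only if each kᵢ ∈ {⌊d/3⌋, ⌈d/3⌉}. -/
noncomputable def phiAux (x : ℝ) : ℝ := (x + 1) * Real.log (x + 1) - x * Real.log x

theorem phiAux_hasDerivAt (x : ℝ) (hx : 0 < x) :
    HasDerivAt phiAux (Real.log (x + 1) - Real.log x) x := by
  have h1 := Real.hasDerivAt_mul_log hx.ne'
  have h2 := (Real.hasDerivAt_mul_log (x := x + 1) (by positivity)).comp_add_const x 1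
  have h3 := h2.sub h1
  have e : Real.log (x + 1) - Real.log x = Real.log (x + 1) + 1 - (Real.log x + 1) := by ring
  rw [e]
  exact h3

theorem phiAux_concave : StrictConcaveOn ℝ (Set.Ioi (0 : ℝ)) phiAux := by
  apply StrictAntiOn.strictConcaveOn_of_deriv (convex_Ioi 0)
  · intro x hx
    exact (phiAux_hasDerivAt x hx).continuousAt.continuousWithinAt
  · rw [interior_Ioi]
    intro x hx y hy hxy
    have hx' : 0 < x := hx
    have hy' : 0 < y := hy
    rw [(phiAux_hasDerivAt x hx).deriv, (phiAux_hasDerivAt y hy).deriv,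
      ← Real.log_div (by positivity) (by positivity),
      ← Real.log_div (by positivity) (by positivity)]
    apply Real.log_lt_log (by positivity)
    rw [div_lt_div_iff₀ hy' hx']
    nlinarith

theorem phiAux_lt (m l : ℕ) (hm : 0 < m) (hl : 0 < l) (h1 : l ≠ m) (h2 : l ≠ m + 1) :
    phiAux l < phiAux m + ((l : ℝ) - m) * (phiAux ((m : ℝ) + 1) - phiAux m) := by
  have hm' : (0 : ℝ) < m := by exact_mod_cast hm
  have hl' : (0 : ℝ) < l := by exact_mod_cast hl
  rcases lt_or_gt_of_ne h1 with h | h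
  · have hlm : (l : ℝ) < m := by exact_mod_cast h
    have := phiAux_concave.slope_anti_adjacent (x := l) (y := m) (z := (m : ℝ) + 1)
      hl' (Set.mem_Ioi.2 (by positivity)) hlm (by linarith)
    rw [add_sub_cancel_left, div_one, lt_div_iff₀ (by linarith)] at this
    linarith
  · have hlm : (m : ℝ) + 1 < l := by exact_mod_cast (show m + 1 < l by omega)
    have := phiAux_concave.slope_anti_adjacent (x := m) (y := (m : ℝ) + 1) (z := l)
      hm' hl' (by linarith) hlm
    rw [add_sub_cancel_left, div_one, div_lt_iff₀ (by linarith)] at this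
    linarith

theorem phiAux_eq (m l : ℕ) (h : l = m ∨ l = m + 1) :
    phiAux l = phiAux m + ((l : ℝ) - m) * (phiAux ((m : ℝ) + 1) - phiAux m) := by
  rcases h with rfl | rfl
  · ring
  · push_cast; ring

theorem phiAux_le (m l : ℕ) (hm : 0 < m) (hl : 0 < l) :
    phiAux l ≤ phiAux m + ((l : ℝ) - m) * (phiAux ((m : ℝ) + 1) - phiAux m) := by
  by_cases h : l = m ∨ l = m + 1
  · exact (phiAux_eq m l h).le
  · push Not at h
    exact (phiAux_lt m l hm hl h.1 h.2).le

theorem g_eq_exp (a : ℕ) (ha : 0 < a) :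
    ((a : ℝ) + 1) ^ (a + 1) / (a : ℝ) ^ a = Real.exp (phiAux a) := by
  have ha' : (0 : ℝ) < a := by exact_mod_cast ha
  rw [← Real.exp_log (show 0 < ((a : ℝ) + 1) ^ (a + 1) / (a : ℝ) ^ a by positivity),
    Real.log_div (by positivity) (by positivity), Real.log_pow, Real.log_pow]
  simp [phiAux]


theorem three_simplices_optimal_split (d : ℕ) (hd : 3 ≤ d)
    (f : ℕ → ℕ → ℕ → ℝ)
    (hf : ∀ a b c : ℕ, f a b c =
      (((a : ℝ) + 1) ^ (a + 1) / (a : ℝ) ^ a) * (((b : ℝ) + 1) ^ (b + 1) / (b : ℝ) ^ b) *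
        (((c : ℝ) + 1) ^ (c + 1) / (c : ℝ) ^ c))
    (k₁ k₂ k₃ : ℕ) (h₁ : 0 < k₁) (h₂ : 0 < k₂) (h₃ : 0 < k₃) (hsum : k₁ + k₂ + k₃ = d) :
    (∀ l₁ l₂ l₃ : ℕ, 0 < l₁ → 0 < l₂ → 0 < l₃ → l₁ + l₂ + l₃ = d →
        f l₁ l₂ l₃ ≤ f k₁ k₂ k₃) ↔
      ((k₁ = d / 3 ∨ k₁ = (d + 2) / 3) ∧ (k₂ = d / 3 ∨ k₂ = (d + 2) / 3) ∧
        (k₃ = d / 3 ∨ k₃ = (d + 2) / 3)) := by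
  have key : ∀ a b c : ℕ, 0 < a → 0 < b → 0 < c →
      f a b c = Real.exp (phiAux a + phiAux b + phiAux c) := by
    intro a b c ha hb hc
    rw [hf, g_eq_exp a ha, g_eq_exp b hb, g_eq_exp c hc, Real.exp_add, Real.exp_add]
  obtain ⟨m, hm⟩ : ∃ m, m = d / 3 := ⟨_, rfl⟩
  have hm0 : 0 < m := by omega
  have hk : (k₁ : ℝ) + k₂ + k₃ = d := by exact_mod_cast hsum
  constructor
  · intro H
    have H0 := H (d / 3) ((d + 1) / 3) ((d + 2) / 3) (by omega) (by omega) (by omega) (by omega)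
    rw [key _ _ _ (by omega) (by omega) (by omega), key _ _ _ h₁ h₂ h₃, Real.exp_le_exp,
      phiAux_eq m (d / 3) (by omega), phiAux_eq m ((d + 1) / 3) (by omega),
      phiAux_eq m ((d + 2) / 3) (by omega)] at H0
    have hs : ((d / 3 : ℕ) : ℝ) + ((d + 1) / 3 : ℕ) + ((d + 2) / 3 : ℕ) = d := by
      exact_mod_cast (show d / 3 + (d + 1) / 3 + (d + 2) / 3 = d by omega)
    generalize ((d / 3 : ℕ) : ℝ) = x at *
    generalize (((d + 1) / 3 : ℕ) : ℝ) = y at *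
    generalize (((d + 2) / 3 : ℕ) : ℝ) = z at *
    have l1 := phiAux_le m k₁ hm0 h₁
    have l2 := phiAux_le m k₂ hm0 h₂
    have l3 := phiAux_le m k₃ hm0 h₃
    have hz : z = k₁ + k₂ + k₃ - x - y := by linarith
    subst hz
    have e1 : k₁ = m ∨ k₁ = m + 1 := by
      by_contra hc
      push Not at hc
      have := phiAux_lt m k₁ hm0 h₁ hc.1 hc.2
      linarith
    have e2 : k₂ = m ∨ k₂ = m + 1 := by
      by_contra hc
      push Not at hc
      have := phiAux_lt m k₂ hm0 h₂ hc.1 hc.2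
      linarith
    have e3 : k₃ = m ∨ k₃ = m + 1 := by
      by_contra hc
      push Not at hc
      have := phiAux_lt m k₃ hm0 h₃ hc.1 hc.2
      linarith
    omega
  · rintro H l₁ l₂ l₃ p1 p2 p3 hl
    rw [key _ _ _ p1 p2 p3, key _ _ _ h₁ h₂ h₃, Real.exp_le_exp,
      phiAux_eq m k₁ (by omega), phiAux_eq m k₂ (by omega), phiAux_eq m k₃ (by omega)]
    have hl' : (l₁ : ℝ) + l₂ + l₃ = d := by exact_mod_cast hl
    have i1 := phiAux_le m l₁ hm0 p1
    have i2 := phiAux_le m l₂ hm0 p2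
    have i3 := phiAux_le m l₃ hm0 p3
    have hz : (l₃ : ℝ) = k₁ + k₂ + k₃ - l₁ - l₂ := by linarith
    have i3' : phiAux l₃ ≤ phiAux m + (((k₁ : ℝ) + k₂ + k₃ - l₁ - l₂) - m) *
        (phiAux ((m : ℝ) + 1) - phiAux m) := by
      rw [← hz]; exact i3
    linarith
end

section
/- Let d, n ≥ 1, let u₁, …, u_n ∈ S^{d-1}, and let λ₁, …, λ_n > 0. Let G be the n×n Gram matrix with entries G_{ij} = ⟨uᵢ, uⱼ⟩, let Λ_v = (λ₁, …, λ_n)ᵀ ∈ ℝⁿ, and let Λ_m be the n×n diagonal matrix with diagonal entries λ₁, …, λ_n. Then the John-type conditions Σ_{k=1}^{n} λ_k u_k = 0 and Σ_{k=1}^{n} λ_k u_k u_kᵀ = Id (the d×d identity matrix) hold if and only if {u₁, …, u_n} spans ℝ^d, G Λ_v = 0, and G Λ_m G = G. -/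
open MeasureTheory Real RealInnerProductSpace

theorem john_aux_coord {d n : ℕ} (u : Fin n → EuclideanSpace ℝ (Fin d)) (lam : Fin n → ℝ)
    (x : EuclideanSpace ℝ (Fin d)) (i : Fin d) :
    (∑ k, (lam k * ⟪u k, x⟫) • u k) i =
      (∑ k, lam k • (Matrix.of fun i j : Fin d => u k i * u k j)).mulVec x.ofLp i := by
  simp only [Finset.sum_apply, Pi.smul_apply, Matrix.sum_apply, Matrix.smul_apply,
    Matrix.mulVec, dotProduct, Matrix.of_apply, WithLp.ofLp_sum, WithLp.ofLp_smul, smul_eq_mul,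
    PiLp.inner_apply, RCLike.inner_apply, conj_trivial, Finset.sum_mul, Finset.mul_sum]
  rw [Finset.sum_comm]
  exact Finset.sum_congr rfl fun j _ => Finset.sum_congr rfl fun k _ => by ring

theorem john_aux {d n : ℕ} (u : Fin n → EuclideanSpace ℝ (Fin d)) (lam : Fin n → ℝ) :
    (∑ k, lam k • (Matrix.of fun i j : Fin d => u k i * u k j) =
        (1 : Matrix (Fin d) (Fin d) ℝ)) ↔ ∀ x, ∑ k, (lam k * ⟪u k, x⟫) • u k = x := by
  constructor
  · intro h x
    ext i
    rw [john_aux_coord, h, Matrix.one_mulVec]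
  · intro h
    apply Matrix.ext_of_mulVec_single
    intro j
    funext i
    have := john_aux_coord u lam (WithLp.toLp 2 (Pi.single j 1)) i
    rw [h] at this
    rw [Matrix.one_mulVec]
    exact this.symm

theorem john_conditions_gram (d n : ℕ) (hd : 1 ≤ d) (hn : 1 ≤ n)
    (u : Fin n → EuclideanSpace ℝ (Fin d))
    (husph : ∀ i, u i ∈ Metric.sphere (0 : EuclideanSpace ℝ (Fin d)) 1)
    (lam : Fin n → ℝ) (hlam : ∀ i, 0 < lam i)
    (G : Matrix (Fin n) (Fin n) ℝ) (hG : ∀ i j, G i j = ⟪u i, u j⟫) :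
    ((∑ k, lam k • u k = 0) ∧
      (∑ k, lam k • (Matrix.of fun i j : Fin d => u k i * u k j) =
        (1 : Matrix (Fin d) (Fin d) ℝ))) ↔
    (Submodule.span ℝ (Set.range u) = ⊤ ∧ G.mulVec lam = 0 ∧
      G * Matrix.diagonal lam * G = G) := by
  rw [john_aux]
  have h1 : ∀ i, G.mulVec lam i = ⟪u i, ∑ k, lam k • u k⟫ := by
    intro i
    simp only [Matrix.mulVec, dotProduct, hG, inner_sum, inner_smul_right]
    exact Finset.sum_congr rfl fun k _ => by ring
  have h2 : ∀ i j, (G * Matrix.diagonal lam * G) i j =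
      ⟪u i, ∑ k, (lam k * ⟪u k, u j⟫) • u k⟫ := by
    intro i j
    rw [Matrix.mul_apply]
    simp only [Matrix.mul_diagonal, hG, inner_sum, inner_smul_right]
    exact Finset.sum_congr rfl fun k _ => by ring
  constructor
  · rintro ⟨ha, hb⟩
    refine ⟨?_, ?_, ?_⟩
    · rw [eq_top_iff]
      intro x _
      rw [← hb x]
      exact Submodule.sum_mem _ fun k _ => Submodule.smul_mem _ _
        (Submodule.subset_span ⟨k, rfl⟩)
    · funext i
      rw [h1, ha, inner_zero_right]; rfl
    · ext i j
      rw [h2, hb, hG]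
  · rintro ⟨hs, ha, hb⟩
    have key : ∀ y z : EuclideanSpace ℝ (Fin d), (∀ i, ⟪u i, y⟫ = ⟪u i, z⟫) → y = z := by
      intro y z h
      apply ext_inner_left ℝ
      intro v
      have hv : v ∈ Submodule.span ℝ (Set.range u) := hs ▸ Submodule.mem_top
      induction hv using Submodule.span_induction with
      | mem x hx => obtain ⟨i, rfl⟩ := hx; exact h i
      | zero => simp
      | add x y _ _ hx hy => rw [inner_add_left, inner_add_left, hx, hy]
      | smul a x _ hx => rw [real_inner_smul_left, real_inner_smul_left, hx]
    refine ⟨key _ _ fun i => ?_, fun x => ?_⟩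
    · rw [← h1, ha, inner_zero_right]; rfl
    · have hx : x ∈ Submodule.span ℝ (Set.range u) := hs ▸ Submodule.mem_top
      induction hx using Submodule.span_induction with
      | mem x hx =>
        obtain ⟨j, rfl⟩ := hx
        exact key _ _ fun i => by rw [← h2, hb, hG]
      | zero => simp
      | add x y _ _ hx hy =>
        simp only [inner_add_right, mul_add, add_smul, Finset.sum_add_distrib, hx, hy]
      | smul a x _ hx =>
        conv_rhs => rw [← hx]
        rw [Finset.smul_sum]
        refine Finset.sum_congr rfl fun k _ => ?_
        rw [real_inner_smul_right, smul_smul]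
        congr 1
        ring
end

section
/- In ℝ⁴, let P₄ = conv({(cos(2πj/3), sin(2πj/3), 0, 0) : j = 0,1,2} ∪ {(0,0,±1,0), (0,0,0,±1)}) (the convex hull of a regular triangle and two diameters of S³ lying in mutually orthogonal linear subspaces), and let C₄(7) = conv{ (1/√2)·(cos(2πi/7), sin(2πi/7), cos(4πi/7), sin(4πi/7)) : i = 0,1,…,6 }. Then vol(P₄) = √3/4, vol(C₄(7)) = (49/192)·(cos(π/7) + cos(2π/7)), and in particular vol(P₄) > vol(C₄(7)). -/
open MeasureTheory Real

lemma simplex_integral (n : ℕ) (t : ℝ) (ht : 0 ≤ t) :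
    ∫⁻ x in Set.Ioc 0 t, ENNReal.ofReal ((t - x) ^ n / n.factorial) =
      ENNReal.ofReal (t ^ (n + 1) / (n + 1).factorial) := by
  rw [← ofReal_integral_eq_lintegral_ofReal]
  · congr 1
    rw [← intervalIntegral.integral_of_le ht]
    rw [intervalIntegral.integral_div,
      intervalIntegral.integral_comp_sub_left (fun x => x ^ n) t]
    simp [integral_pow]
    rw [Nat.factorial_succ]
    push_cast
    rw [div_div]
  · exact (Continuous.integrableOn_Icc (by fun_prop)).mono_set Set.Ioc_subset_Icc_self
  · refine (ae_restrict_iff' measurableSet_Ioc).2 (Filter.Eventually.of_forall fun x hx => ?_)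
    have : 0 ≤ t - x := by linarith [hx.2]
    simp only [Pi.zero_apply]
    positivity

lemma volume_open_simplex (n : ℕ) : ∀ t : ℝ, 0 < t →
    volume {x : Fin n → ℝ | (∀ i, 0 < x i) ∧ ∑ i, x i < t} =
      ENNReal.ofReal (t ^ n / n.factorial) := by
  induction n with
  | zero =>
    intro t ht
    have : {x : Fin 0 → ℝ | (∀ i, 0 < x i) ∧ ∑ i, x i < t} = Set.univ := by
      ext x; simp [ht]
    rw [this, Measure.volume_pi_eq_dirac 0]; simp
  | succ n ih =>
    intro t ht
    set S := {x : Fin (n+1) → ℝ | (∀ i, 0 < x i) ∧ ∑ i, x i < t} with hS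
    have hm : MeasurableSet S := by
      simp only [hS]
      measurability
    rw [← ((volume_preserving_piFinSuccAbove (fun _ : Fin (n+1) => ℝ) 0).symm).measure_preimage
      hm.nullMeasurableSet, Measure.volume_eq_prod, Measure.prod_apply
      ((MeasurableEquiv.measurable _) hm)]
    rw [← simplex_integral n t ht.le, ← lintegral_indicator measurableSet_Ioc]
    refine lintegral_congr_ae ?_
    have : ∀ᵐ x : ℝ, x ≠ t := by
      simp [ae_iff]
    filter_upwards [this] with x hxt
    have key : Prod.mk x ⁻¹' ((MeasurableEquiv.piFinSuccAbove (fun _ : Fin (n+1) => ℝ) 0).symm ⁻¹' S)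
        = {y : Fin n → ℝ | 0 < x ∧ (∀ i, 0 < y i) ∧ ∑ i, y i < t - x} := by
      ext y
      simp [hS, MeasurableEquiv.piFinSuccAbove, Fin.insertNthEquiv, Fin.forall_fin_succ, Fin.sum_univ_succ, and_assoc,
        lt_sub_iff_add_lt']
    rw [key]
    by_cases hx : x ∈ Set.Ioc 0 t
    · rw [Set.indicator_of_mem hx, ← ih (t - x) (by have := lt_of_le_of_ne hx.2 hxt; linarith)]
      simp [hx.1]
    · rw [Set.indicator_of_notMem hx]
      convert measure_empty (μ := (volume : Measure (Fin n → ℝ)))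
      ext y
      simp only [Set.mem_ofPred_eq, Set.mem_empty_iff_false, iff_false]
      rintro ⟨h1, h2, h3⟩
      apply hx
      have := Finset.sum_nonneg (s := Finset.univ) (fun i _ => (h2 i).le)
      exact ⟨h1, by linarith⟩

lemma volume_closed_simplex (n : ℕ) : ∀ t : ℝ, 0 ≤ t →
    volume {x : Fin n → ℝ | (∀ i, 0 ≤ x i) ∧ ∑ i, x i ≤ t} =
      ENNReal.ofReal (t ^ n / n.factorial) := by
  induction n with
  | zero =>
    intro t ht
    have : {x : Fin 0 → ℝ | (∀ i, 0 ≤ x i) ∧ ∑ i, x i ≤ t} = Set.univ := by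
      ext x; simp [ht]
    rw [this, Measure.volume_pi_eq_dirac 0]; simp
  | succ n ih =>
    intro t ht
    set S := {x : Fin (n+1) → ℝ | (∀ i, 0 ≤ x i) ∧ ∑ i, x i ≤ t} with hS
    have hm : MeasurableSet S := by
      simp only [hS]
      measurability
    rw [← ((volume_preserving_piFinSuccAbove (fun _ : Fin (n+1) => ℝ) 0).symm).measure_preimage
      hm.nullMeasurableSet, Measure.volume_eq_prod, Measure.prod_apply
      ((MeasurableEquiv.measurable _) hm)]
    rw [← simplex_integral n t ht, ← lintegral_indicator measurableSet_Ioc]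
    refine lintegral_congr_ae ?_
    have : ∀ᵐ x : ℝ, x ≠ 0 := by
      simp [ae_iff]
    filter_upwards [this] with x hxt
    have key : Prod.mk x ⁻¹' ((MeasurableEquiv.piFinSuccAbove (fun _ : Fin (n+1) => ℝ) 0).symm ⁻¹' S)
        = {y : Fin n → ℝ | 0 ≤ x ∧ (∀ i, 0 ≤ y i) ∧ ∑ i, y i ≤ t - x} := by
      ext y
      simp [hS, MeasurableEquiv.piFinSuccAbove, Fin.insertNthEquiv, Fin.forall_fin_succ, Fin.sum_univ_succ, and_assoc,
        le_sub_iff_add_le']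
    rw [key]
    by_cases hx : x ∈ Set.Ioc 0 t
    · rw [Set.indicator_of_mem hx, ← ih (t - x) (by linarith [hx.2])]
      simp [hx.1.le]
    · rw [Set.indicator_of_notMem hx]
      convert measure_empty (μ := (volume : Measure (Fin n → ℝ)))
      ext y
      simp only [Set.mem_ofPred_eq, Set.mem_empty_iff_false, iff_false]
      rintro ⟨h1, h2, h3⟩
      apply hx
      have := Finset.sum_nonneg (s := Finset.univ) (fun i _ => (h2 i))
      exact ⟨lt_of_le_of_ne h1 (Ne.symm hxt), by linarith⟩

lemma combo_eq (W : Fin 4 → Fin 4 → ℝ) (c : Fin 4 → ℝ) :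
    Matrix.toLin' (Matrix.of W).transpose c = ∑ a, c a • W a := by
  ext b
  simp [Matrix.mulVec, dotProduct, mul_comm]

lemma polytope_volume {ι κ : Type} [Fintype ι] [Fintype κ] [Nonempty κ]
    (V : ι → Fin 4 → ℝ) (F : κ → Fin 4 → ι) (l : κ → (Fin 4 → ℝ) →ₗ[ℝ] ℝ) (N : κ → Fin 4 → κ)
    (heq : ∀ k a, l k (V (F k a)) = 1)
    (hlt : ∀ k i, (∀ a, F k a ≠ i) → l k (V i) < 1)
    (hF : ∀ k k', k ≠ k' → ∃ a, ∀ b, F k' b ≠ F k a)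
    (hN : ∀ k a b, b ≠ a → ∃ c, F (N k a) c = F k b)
    (hN' : ∀ k a c, F (N k a) c ≠ F k a)
    (hdet : ∀ k, (Matrix.of fun a => V (F k a)).det ≠ 0)
    (h0 : 0 ∈ convexHull ℝ (Set.range V)) :
    volume (convexHull ℝ (Set.range V)) =
      ∑ k, ENNReal.ofReal (|(Matrix.of fun a => V (F k a)).det| / 24) := by
  classical
  have hle : ∀ k i, l k (V i) ≤ 1 := by
    intro k i
    by_cases h : ∃ a, F k a = i
    · obtain ⟨a, rfl⟩ := h
      exact (heq k a).le
    · push Not at h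
      exact (hlt k i h).le
  have hhull : ∀ k, ∀ x ∈ convexHull ℝ (Set.range V), l k x ≤ 1 := by
    intro k
    have : convexHull ℝ (Set.range V) ⊆ {x | l k x ≤ 1} :=
      convexHull_min (by rintro _ ⟨i, rfl⟩; exact hle k i)
        (convex_halfSpace_le (l k).isLinear 1)
    exact this
  let f : κ → (Fin 4 → ℝ) →ₗ[ℝ] (Fin 4 → ℝ) := fun k =>
    Matrix.toLin' (Matrix.of fun a => V (F k a)).transpose
  have hf : ∀ k c, f k c = ∑ a, c a • V (F k a) := fun k c => combo_eq _ c
  have hfdet : ∀ k, LinearMap.det (f k) = (Matrix.of fun a => V (F k a)).det := by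
    intro k
    simp only [f, LinearMap.det_toLin', Matrix.det_transpose]
  have hlf : ∀ k c, l k (f k c) = ∑ a, c a := by
    intro k c
    simp [hf, heq]
  set T : Set (Fin 4 → ℝ) := {x | (∀ i, 0 ≤ x i) ∧ ∑ i, x i ≤ 1} with hT
  set O : Set (Fin 4 → ℝ) := {x | (∀ i, 0 < x i) ∧ ∑ i, x i < 1} with hO
  have vT : volume T = ENNReal.ofReal (1 / 24) := by
    rw [hT, volume_closed_simplex 4 1 zero_le_one]; norm_num [Nat.factorial]
  have vO : volume O = ENNReal.ofReal (1 / 24) := by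
    rw [hO, volume_open_simplex 4 1 zero_lt_one]; norm_num [Nat.factorial]
  have vfT : ∀ k, volume (f k '' T) = ENNReal.ofReal (|(Matrix.of fun a => V (F k a)).det| / 24) := by
    intro k
    rw [Measure.addHaar_image_linearMap, vT, hfdet, ← ENNReal.ofReal_mul (abs_nonneg _)]
    ring_nf
  have vfO : ∀ k, volume (f k '' O) = ENNReal.ofReal (|(Matrix.of fun a => V (F k a)).det| / 24) := by
    intro k
    rw [Measure.addHaar_image_linearMap, vO, hfdet, ← ENNReal.ofReal_mul (abs_nonneg _)]
    ring_nf
  apply le_antisymm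
  · have hcov : convexHull ℝ (Set.range V) ⊆ ⋃ k ∈ (Finset.univ : Finset κ), f k '' T := by
      intro x hx
      obtain ⟨k, -, hk⟩ := Finset.exists_max_image (Finset.univ : Finset κ) (fun k => l k x)
        Finset.univ_nonempty
      obtain ⟨c, rfl⟩ : ∃ c, f k c = x := by
        have : LinearMap.det (f k) ≠ 0 := by rw [hfdet]; exact hdet k
        exact ⟨((f k).equivOfDetNeZero this).symm x, ((f k).equivOfDetNeZero this).apply_symm_apply x⟩
      refine Set.mem_biUnion (Finset.mem_univ k) ⟨c, ⟨fun a => ?_, ?_⟩, rfl⟩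
      · have h1 := hk (N k a) (Finset.mem_univ _)
        have h2 : l (N k a) (f k c) = ∑ b, c b + c a * (l (N k a) (V (F k a)) - 1) := by
          have : ∀ b, c b * l (N k a) (V (F k b)) =
              c b + if b = a then c a * (l (N k a) (V (F k a)) - 1) else 0 := by
            intro b
            by_cases hb : b = a
            · subst hb; simp; ring
            · obtain ⟨d, hd⟩ := hN k a b hb
              rw [← hd, heq]; simp [hb]
          simp [hf, this, Finset.sum_add_distrib]
        simp only [hlf, h2] at h1
        have h3 := hlt (N k a) (F k a) (hN' k a)
        by_contra hc
        push Not at hc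
        nlinarith
      · rw [← hlf]; exact hhull k _ hx
    calc volume (convexHull ℝ (Set.range V)) ≤ _ := measure_mono hcov
      _ ≤ ∑ k, volume (f k '' T) := measure_biUnion_finset_le _ _
      _ = _ := Finset.sum_congr rfl fun k _ => vfT k
  · have hsub : (⋃ k ∈ (Finset.univ : Finset κ), f k '' O) ⊆ convexHull ℝ (Set.range V) := by
      refine Set.iUnion₂_subset fun k _ => ?_
      rintro _ ⟨c, ⟨hc0, hc1⟩, rfl⟩
      have hconv := convex_convexHull ℝ (Set.range V)
      have := hconv.sum_mem (t := (Finset.univ : Finset (Option (Fin 4))))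
        (w := fun o => o.elim (1 - ∑ i, c i) c) (z := fun o => o.elim 0 fun a => V (F k a))
        (by
          rintro (_ | a) -
          · simp; linarith
          · exact (hc0 a).le)
        (by simp [Fintype.sum_option])
        (by
          rintro (_ | a) -
          · exact h0
          · exact subset_convexHull ℝ _ ⟨_, rfl⟩)
      simpa [Fintype.sum_option, hf] using this
    have hmeas : ∀ k, MeasurableSet (f k '' O) := by
      intro k
      have : LinearMap.det (f k) ≠ 0 := by rw [hfdet]; exact hdet k
      have hop : IsOpen O := by
        have : O = (⋂ i, {x : Fin 4 → ℝ | 0 < x i}) ∩ {x | ∑ i, x i < 1} := by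
          ext x; simp [hO]
        rw [this]
        exact (isOpen_iInter_of_finite fun i => isOpen_lt (by fun_prop) (by fun_prop)).inter
          (isOpen_lt (by fun_prop) (by fun_prop))
      have := (((f k).equivOfDetNeZero this).toContinuousLinearEquiv.toHomeomorph.isOpenMap O hop)
      exact this.measurableSet
    have hdisj : (↑(Finset.univ : Finset κ) : Set κ).PairwiseDisjoint fun k => f k '' O := by
      have key : ∀ k k', k ≠ k' → ∀ x ∈ f k '' O, l k' x < l k x := by
        rintro k k' hkk _ ⟨c, ⟨hc0, hc1⟩, rfl⟩
        rw [hlf, hf, map_sum]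
        obtain ⟨a, ha⟩ := hF k k' hkk
        refine Finset.sum_lt_sum (fun b _ => ?_) ⟨a, Finset.mem_univ _, ?_⟩
        · simp only [map_smul, smul_eq_mul]
          have := hle k' (F k b)
          nlinarith [hc0 b]
        · simp only [map_smul, smul_eq_mul]
          have := hlt k' (F k a) ha
          nlinarith [hc0 a]
      intro k _ k' _ hkk
      refine Set.disjoint_left.2 fun x hx hx' => ?_
      exact lt_asymm (key k k' hkk x hx) (key k' k hkk.symm x hx')
    calc _ = ∑ k, volume (f k '' O) := Finset.sum_congr rfl fun k _ => (vfO k).symm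
      _ = volume (⋃ k ∈ (Finset.univ : Finset κ), f k '' O) :=
        (measure_biUnion_finset hdisj fun k _ => hmeas k).symm
      _ ≤ _ := measure_mono hsub

lemma euclid_volume (s : Set (Fin 4 → ℝ)) :
    volume (convexHull ℝ ((WithLp.toLp 2 : (Fin 4 → ℝ) → EuclideanSpace ℝ (Fin 4)) '' s)) =
      volume (convexHull ℝ s) := by
  have h1 := ((EuclideanSpace.equiv (Fin 4) ℝ).symm.toLinearMap).image_convexHull s
  have h2 : ⇑((EuclideanSpace.equiv (Fin 4) ℝ).symm.toLinearMap) =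
    (WithLp.toLp 2 : (Fin 4 → ℝ) → EuclideanSpace ℝ (Fin 4)) := rfl
  rw [h2] at h1
  rw [← h1, ← (PiLp.volume_preserving_toLp (Fin 4)).measure_preimage_emb
    (MeasurableEquiv.toLp 2 (Fin 4 → ℝ)).measurableEmbedding,
    Set.preimage_image_eq _ (WithLp.toLp_injective 2)]

noncomputable def PV : Fin 7 → Fin 4 → ℝ :=
  ![![1, 0, 0, 0], ![-(1 / 2), √3 / 2, 0, 0], ![-(1 / 2), -(√3 / 2), 0, 0],
    ![0, 0, 1, 0], ![0, 0, -1, 0], ![0, 0, 0, 1], ![0, 0, 0, -1]]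

def PF (k : Fin 3 × Fin 2 × Fin 2) : Fin 4 → Fin 7 :=
  ![![1, 2, 0] k.1, ![2, 0, 1] k.1, ![3, 4] k.2.1, ![5, 6] k.2.2]

def PN (k : Fin 3 × Fin 2 × Fin 2) : Fin 4 → Fin 3 × Fin 2 × Fin 2 :=
  ![(k.1 + 1, k.2), (k.1 + 2, k.2), (k.1, k.2.1 + 1, k.2.2), (k.1, k.2.1, k.2.2 + 1)]

/-- The linear functional with the given coefficients. -/
def lf (u : Fin 4 → ℝ) : (Fin 4 → ℝ) →ₗ[ℝ] ℝ where
  toFun x := u 0 * x 0 + u 1 * x 1 + u 2 * x 2 + u 3 * x 3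
  map_add' x y := by simp; ring
  map_smul' c x := by simp; ring

lemma lf_apply (u x : Fin 4 → ℝ) :
    lf u x = u 0 * x 0 + u 1 * x 1 + u 2 * x 2 + u 3 * x 3 := rfl

noncomputable def Pu (k : Fin 3 × Fin 2 × Fin 2) : Fin 4 → ℝ :=
  ![![-2, 1, 1] k.1, ![0, -√3, √3] k.1, ![1, -1] k.2.1, ![1, -1] k.2.2]

lemma P_det (k : Fin 3 × Fin 2 × Fin 2) :
    |(Matrix.of fun a => PV (PF k a)).det| = √3 / 2 := by
  have h3 : (0 : ℝ) < √3 / 2 := by positivity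
  have hor : (Matrix.of fun a => PV (PF k a)).det = √3 / 2 ∨
      (Matrix.of fun a => PV (PF k a)).det = -(√3 / 2) := by
    obtain ⟨j, s, t⟩ := k
    fin_cases j <;> fin_cases s <;> fin_cases t <;>
      simp [Matrix.det_succ_row_zero, Fin.sum_univ_succ, PV, PF, Fin.succAbove] <;> grind
  rcases hor with h | h
  · rw [h, abs_of_pos h3]
  · rw [h, abs_neg, abs_of_pos h3]

lemma P_volume : volume (convexHull ℝ (Set.range PV)) = ENNReal.ofReal (√3 / 4) := by
  have h3 : √3 * √3 = 3 := Real.mul_self_sqrt (by norm_num)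
  rw [polytope_volume PV PF (fun k => lf (Pu k)) PN]
  · simp only [P_det]
    rw [← ENNReal.ofReal_sum_of_nonneg (fun _ _ => by positivity)]
    congr 1
    simp
    ring
  · rintro ⟨j, s, t⟩ a
    fin_cases j <;> fin_cases s <;> fin_cases t <;> fin_cases a <;>
      simp [lf_apply, PV, PF, Pu] <;> linarith
  · rintro ⟨j, s, t⟩ i h
    fin_cases j <;> fin_cases s <;> fin_cases t <;> fin_cases i <;>
      first
      | (exfalso; revert h; decide)
      | (simp [lf_apply, PV, Pu] <;> linarith)
  · decide
  · decide
  · decide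
  · intro k h
    have := P_det k
    rw [h] at this
    have : (0 : ℝ) < √3 / 2 := by positivity
    simp_all
  · have := (convex_convexHull ℝ (Set.range PV)).sum_mem
      (t := (Finset.univ : Finset (Fin 2))) (w := ![1/2, 1/2]) (z := ![PV 3, PV 4])
      (by intro i _; fin_cases i <;> norm_num)
      (by norm_num [Fin.sum_univ_two])
      (by intro i _; fin_cases i; exacts [subset_convexHull ℝ _ ⟨3, rfl⟩, subset_convexHull ℝ _ ⟨4, rfl⟩])
    convert this using 1
    ext i
    fin_cases i <;> simp [PV, Fin.sum_univ_two]

/-- The trigonometric moment curve. -/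
noncomputable def tc (θ : ℝ) : Fin 4 → ℝ :=
  ![(√2)⁻¹ * cos θ, (√2)⁻¹ * sin θ, (√2)⁻¹ * cos (2 * θ), (√2)⁻¹ * sin (2 * θ)]

noncomputable def CV (i : Fin 7) : Fin 4 → ℝ := tc (2 * π * (i : ℕ) / 7)

def Coff : Fin 2 → Fin 4 → Fin 7 := ![![0, 1, 2, 3], ![0, 1, 3, 4]]

def CF (k : Fin 7 × Fin 2) (a : Fin 4) : Fin 7 := k.1 + Coff k.2 a

def CN (k : Fin 7 × Fin 2) : Fin 4 → Fin 7 × Fin 2 :=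
  ![![(k.1 + 1, 0), (k.1 + 6, 1), (k.1, 1), (k.1 + 6, 0)],
    ![(k.1 + 1, 0), (k.1 + 3, 1), (k.1 + 4, 1), (k.1, 0)]] k.2

lemma tc_add_two_pi (θ : ℝ) : tc (θ + 2 * π) = tc θ := by
  have h1 : 2 * (θ + 2 * π) = 2 * θ + 2 * π + 2 * π := by ring
  simp [tc, h1, cos_add_two_pi, sin_add_two_pi]

lemma CV_add (b j : Fin 7) : CV (b + j) = tc (2 * π * ((b : ℕ) + (j : ℕ)) / 7) := by
  unfold CV
  rw [Fin.val_add]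
  rcases lt_or_ge ((b : ℕ) + j) 7 with h | h
  · rw [Nat.mod_eq_of_lt h]; push_cast; rfl
  · have h2 : ((b : ℕ) + j) % 7 = b + j - 7 := by omega
    rw [h2, Nat.cast_sub h, ← tc_add_two_pi]
    push_cast
    congr 1
    ring

noncomputable def Cu (α β C c0 : ℝ) : Fin 4 → ℝ :=
  ![√2 / c0 * (C * (cos α + cos β)), √2 / c0 * (C * (sin α + sin β)),
    √2 / c0 * (-cos (α + β) / 2), √2 / c0 * (-sin (α + β) / 2)]

lemma Cu_apply (α β C c0 θ : ℝ) (h : c0 = C ^ 2 + cos (α - β) / 2) (h0 : c0 ≠ 0) :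
    lf (Cu α β C c0) (tc θ) = 1 - (C - cos (θ - α)) * (C - cos (θ - β)) / c0 := by
  have h2 : √2 ≠ 0 := by positivity
  have e1 : lf (Cu α β C c0) (tc θ) =
      (C * (cos (θ - α) + cos (θ - β)) - cos (2 * θ - (α + β)) / 2) / c0 := by
    rw [lf_apply, cos_sub θ, cos_sub θ, cos_sub (2 * θ)]
    simp [Cu, tc]
    field_simp
    ring
  have e2 : cos (2 * θ - (α + β)) + cos (α - β) = 2 * cos (θ - α) * cos (θ - β) := by
    have x1 : 2 * θ - (α + β) = (θ - α) + (θ - β) := by ring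
    have x2 : α - β = (θ - β) - (θ - α) := by ring
    rw [x1, x2, cos_add (θ - α), cos_sub (θ - β)]
    ring
  rw [e1, eq_sub_iff_add_eq, ← add_div, div_eq_one_iff_eq h0, h]
  linear_combination -e2 / 2

lemma cos_lt_aux (m : ℝ) (h1 : 1 < m) (h2 : m ≤ 7) : cos (m * π / 7) < cos (π / 7) := by
  apply cos_lt_cos_of_nonneg_of_le_pi
  · positivity
  · nlinarith [pi_pos]
  · nlinarith [pi_pos]

/-- The nonnegative factor vanishing at two adjacent vertices. -/
noncomputable def hh (m : ℤ) : ℝ := cos (π / 7) - cos ((2 * m - 1) * π / 7)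

lemma hh_symm (m : ℤ) : hh (1 - m) = hh m := by
  unfold hh
  rw [← cos_neg ((2 * (m : ℝ) - 1) * π / 7)]
  congr 2
  push_cast
  ring

lemma hh_per (m : ℤ) : hh (m + 7) = hh m := by
  unfold hh
  rw [← cos_add_two_pi ((2 * (m : ℝ) - 1) * π / 7)]
  congr 2
  push_cast
  ring

lemma hh1 : hh 1 = 0 := by unfold hh; norm_num
lemma hh0 : hh 0 = 0 := by rw [← hh_symm]; exact hh1
lemma hh2 : 0 < hh 2 := by
  unfold hh; have := cos_lt_aux 3 (by norm_num) (by norm_num); norm_num at this ⊢; exact this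
lemma hh3 : 0 < hh 3 := by
  unfold hh; have := cos_lt_aux 5 (by norm_num) (by norm_num); norm_num at this ⊢; exact this
lemma hh4 : 0 < hh 4 := by
  unfold hh; have := cos_lt_aux 7 (by norm_num) (by norm_num); norm_num at this ⊢; linarith
lemma hh5 : 0 < hh 5 := by
  have h := hh3; rw [← hh_symm, ← hh_per] at h; exact h
lemma hh6 : 0 < hh 6 := by
  have h := hh2; rw [← hh_symm, ← hh_per] at h; exact h
lemma hhn1 : 0 < hh (-1) := by
  have h := hh2; rw [← hh_symm] at h; exact h
lemma hhn2 : 0 < hh (-2) := by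
  have h := hh3; rw [← hh_symm] at h; exact h
lemma hhn3 : 0 < hh (-3) := by
  have h := hh4; rw [← hh_symm] at h; exact h

def Cd : Fin 2 → ℤ := ![2, 3]

noncomputable def Cc0 (s : Fin 2) : ℝ := cos (π / 7) ^ 2 + cos (2 * π * Cd s / 7) / 2

noncomputable def Cl (k : Fin 7 × Fin 2) : (Fin 4 → ℝ) →ₗ[ℝ] ℝ :=
  lf (Cu ((2 * (k.1 : ℕ) + 1) * π / 7) ((2 * (k.1 : ℕ) + 1) * π / 7 + 2 * π * Cd k.2 / 7)
    (cos (π / 7)) (Cc0 k.2))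

lemma c_gt : 1 / 2 < cos (π / 7) := by
  rw [← cos_pi_div_three]
  apply cos_lt_cos_of_nonneg_of_le_pi
  · positivity
  · linarith [pi_pos]
  · linarith [pi_pos]

lemma c_lt : cos (π / 7) < 1 := by
  rw [← cos_zero]
  apply cos_lt_cos_of_nonneg_of_le_pi
  · norm_num
  · linarith [pi_pos]
  · linarith [pi_pos]

lemma cos6 : cos (6 * π / 7) = - cos (π / 7) := by
  rw [← cos_pi_sub]; congr 1; ring

lemma Cc0_pos (s : Fin 2) : 0 < Cc0 s := by
  have h6 := cos6
  have hc := c_gt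
  have h4 : cos (6 * π / 7) < cos (4 * π / 7) := by
    apply cos_lt_cos_of_nonneg_of_le_pi
    · positivity
    · linarith [pi_pos]
    · linarith [pi_pos]
  fin_cases s
  · simp only [Cc0, Cd]
    have : 2 * π * ((![2, 3] : Fin 2 → ℤ) ⟨0, by norm_num⟩ : ℤ) / 7 = 4 * π / 7 := by
      simp; ring
    simp only [Fin.zero_eta] at this ⊢
    rw [this]; nlinarith
  · simp only [Cc0, Cd]
    have : 2 * π * ((![2, 3] : Fin 2 → ℤ) ⟨1, by norm_num⟩ : ℤ) / 7 = 6 * π / 7 := by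
      simp; ring
    simp only [Fin.mk_one] at this ⊢
    rw [this, h6]; nlinarith

lemma Cl_apply (k : Fin 7 × Fin 2) (j : Fin 7) :
    Cl k (CV (k.1 + j)) = 1 - hh (j : ℕ) * hh ((j : ℕ) - Cd k.2) / Cc0 k.2 := by
  rw [CV_add, Cl, Cu_apply]
  · unfold hh
    congr 5
    · push_cast; ring
    · push_cast; ring
  · unfold Cc0
    rw [sub_add_cancel_left, cos_neg]
  · exact ne_of_gt (Cc0_pos _)

/-- Rotation matrix commuting with the curve. -/
noncomputable def Rot (φ : ℝ) : Matrix (Fin 4) (Fin 4) ℝ :=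
  !![cos φ, sin φ, 0, 0; -sin φ, cos φ, 0, 0;
    0, 0, cos (2 * φ), sin (2 * φ); 0, 0, -sin (2 * φ), cos (2 * φ)]

lemma Rot_det (φ : ℝ) : (Rot φ).det = 1 := by
  have h1 := sin_sq_add_cos_sq φ
  have h2 := sin_sq_add_cos_sq (2 * φ)
  have : (Rot φ).det = (sin φ ^ 2 + cos φ ^ 2) * (sin (2 * φ) ^ 2 + cos (2 * φ) ^ 2) := by
    simp [Rot, Matrix.det_succ_row_zero, Fin.sum_univ_succ, Fin.succAbove,
      -sin_sq_add_cos_sq]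
    ring
  rw [this, h1, h2, one_mul]

lemma det_rot (φ : ℝ) (t : Fin 4 → ℝ) :
    (Matrix.of fun a => tc (φ + t a)).det = (Matrix.of fun a => tc (t a)).det := by
  have : (Matrix.of fun a => tc (φ + t a)) = (Matrix.of fun a => tc (t a)) * Rot φ := by
    ext a b
    fin_cases b <;>
      simp [tc, Rot, Matrix.mul_apply, Fin.sum_univ_succ, mul_add, cos_add, sin_add] <;> ring
  rw [this, Matrix.det_mul, Rot_det, mul_one]

lemma det_base (a b : ℝ) :
    (Matrix.of fun i => tc ((![-b, -a, a, b] : Fin 4 → ℝ) i)).det =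
      (cos a * cos (2 * b) - cos b * cos (2 * a)) * (sin a * sin (2 * b) - sin b * sin (2 * a)) := by
  have h2 : (√2)⁻¹ ^ 4 = 1 / 4 := by
    have : √2 ^ 4 = 4 := by
      have h := Real.sq_sqrt (show (0:ℝ) ≤ 2 by norm_num)
      calc √2 ^ 4 = (√2 ^ 2) ^ 2 := by ring
        _ = 4 := by rw [h]; norm_num
    rw [inv_pow, this]; norm_num
  have : (Matrix.of fun i => tc ((![-b, -a, a, b] : Fin 4 → ℝ) i)).det = (√2)⁻¹ ^ 4 * 4 *
      ((cos a * cos (2 * b) - cos b * cos (2 * a)) *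
        (sin a * sin (2 * b) - sin b * sin (2 * a))) := by
    simp [tc, Matrix.det_succ_row_zero, Fin.sum_univ_succ, Fin.succAbove]
    ring
  rw [this, h2]; ring

lemma min_poly : 8 * cos (π / 7) ^ 3 - 4 * cos (π / 7) ^ 2 - 4 * cos (π / 7) + 1 = 0 := by
  have h1 : cos (3 * (π / 7)) = - cos (2 * (2 * (π / 7))) := by
    rw [← cos_pi_sub]; congr 1; ring
  rw [cos_three_mul, cos_two_mul, cos_two_mul] at h1
  have hc := c_gt
  have : (cos (π / 7) + 1) *
      (8 * cos (π / 7) ^ 3 - 4 * cos (π / 7) ^ 2 - 4 * cos (π / 7) + 1) = 0 := by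
    linear_combination h1
  rcases mul_eq_zero.1 this with h | h
  · linarith
  · exact h

noncomputable def Cdet (s : Fin 2) : ℝ :=
  ![(-cos (π/7) ^ 2 - (4 * cos (π/7) ^ 3 - 3 * cos (π/7)) * (2 * cos (π/7) ^ 2 - 1)) *
      ((1 - cos (π/7) ^ 2) * (1 - 2 * cos (π/7) * (4 * cos (π/7) ^ 2 - 1))),
    (-cos (π/7) * (2 * cos (π/7) ^ 2 - 1) - (4 * cos (π/7) ^ 3 - 3 * cos (π/7)) ^ 2) *
      (-(2 * cos (π/7) * (1 - cos (π/7) ^ 2)) - (1 - (4 * cos (π/7) ^ 3 - 3 * cos (π/7)) ^ 2))] s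

lemma C_det (k : Fin 7 × Fin 2) : (Matrix.of fun a => CV (CF k a)).det = Cdet k.2 := by
  obtain ⟨b, s⟩ := k
  have hs : sin (π / 7) ^ 2 = 1 - cos (π / 7) ^ 2 := sin_sq _
  have c2 : cos (2 * π / 7) = 2 * cos (π / 7) ^ 2 - 1 := by
    rw [← cos_two_mul]; congr 1; ring
  have c3 : cos (3 * π / 7) = 4 * cos (π / 7) ^ 3 - 3 * cos (π / 7) := by
    rw [← cos_three_mul]; congr 1; ring
  have s2 : sin (2 * π / 7) = 2 * sin (π / 7) * cos (π / 7) := by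
    rw [← sin_two_mul]; congr 1; ring
  have s3 : sin (3 * π / 7) = sin (π / 7) * (4 * cos (π / 7) ^ 2 - 1) := by
    have : sin (3 * π / 7) = 3 * sin (π / 7) - 4 * sin (π / 7) ^ 3 := by
      rw [← sin_three_mul]; congr 1; ring
    rw [this]; linear_combination -4 * sin (π / 7) * hs
  have s3q : sin (3 * π / 7) ^ 2 = 1 - cos (3 * π / 7) ^ 2 := sin_sq _
  have s6 : sin (6 * π / 7) = sin (π / 7) := by rw [← sin_pi_sub]; congr 1; ring
  have c4 : cos (4 * π / 7) = - cos (3 * π / 7) := by rw [← cos_pi_sub]; congr 1; ring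
  have s4 : sin (4 * π / 7) = sin (3 * π / 7) := by rw [← sin_pi_sub]; congr 1; ring
  have c8 : cos (8 * π / 7) = - cos (π / 7) := by rw [← cos_add_pi]; congr 1; ring
  have s8 : sin (8 * π / 7) = - sin (π / 7) := by rw [← sin_add_pi]; congr 1; ring
  have c6 := cos6
  fin_cases s
  · have e : (fun a => CV (CF (b, 0) a)) = fun a => tc ((2 * (b : ℕ) + 3) * π / 7 +
        (![-(3 * π / 7), -(π / 7), π / 7, 3 * π / 7] : Fin 4 → ℝ) a) := by
      funext a
      rw [CF, CV_add]
      congr 1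
      fin_cases a <;> simp [Coff] <;> ring
    have x1 : 2 * (3 * π / 7) = 6 * π / 7 := by ring
    have x2 : 2 * (π / 7) = 2 * π / 7 := by ring
    simp only [Fin.zero_eta]
    rw [e, det_rot, det_base, x1, x2, c6, s6, c3, c2, s2, s3]
    simp only [Cdet, Matrix.cons_val_zero]
    rw [← hs]
    ring
  · have e : (fun a => CV (CF (b, 1) a)) = fun a => tc ((2 * (b : ℕ) + 4) * π / 7 +
        (![-(4 * π / 7), -(2 * π / 7), 2 * π / 7, 4 * π / 7] : Fin 4 → ℝ) a) := by
      funext a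
      rw [CF, CV_add]
      congr 1
      fin_cases a <;> simp [Coff] <;> ring
    have x1 : 2 * (4 * π / 7) = 8 * π / 7 := by ring
    have x2 : 2 * (2 * π / 7) = 4 * π / 7 := by ring
    simp only [Fin.mk_one]
    rw [e, det_rot, det_base, x1, x2, c8, s8, c4, s4, s2]
    simp only [Cdet, Matrix.cons_val_one, Matrix.cons_val_fin_one]
    rw [← c3, ← s3q, c2, ← hs]
    ring

lemma Cdet_pos (s : Fin 2) : 0 < Cdet s := by
  have hm := min_poly
  have hg := c_gt
  have hl := c_lt
  have c2 : 0 < cos (2 * (π / 7)) :=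
    cos_pos_of_mem_Ioo ⟨by linarith [pi_pos], by linarith [pi_pos]⟩
  have c3 : 0 < cos (3 * (π / 7)) :=
    cos_pos_of_mem_Ioo ⟨by linarith [pi_pos], by linarith [pi_pos]⟩
  have c31 : cos (3 * (π / 7)) ≤ 1 := cos_le_one _
  rw [cos_two_mul] at c2
  rw [cos_three_mul] at c3 c31
  unfold Cdet
  generalize cos (π / 7) = c at *
  have hc2 : 0 < 1 - c ^ 2 := by nlinarith
  have hc3 : (4 * c ^ 3 - 3 * c) ^ 2 ≤ 1 := by nlinarith
  fin_cases s
  · simp only [Fin.zero_eta, Matrix.cons_val_zero]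
    apply mul_pos_of_neg_of_neg
    · have := mul_pos c3 c2
      nlinarith
    · apply mul_neg_of_pos_of_neg hc2
      have : 1 - 2 * c * (4 * c ^ 2 - 1) = 2 - 2 * c - 4 * c ^ 2 := by linear_combination -hm
      rw [this]; nlinarith
  · simp only [Fin.mk_one, Matrix.cons_val_one, Matrix.cons_val_fin_one]
    apply mul_pos_of_neg_of_neg
    · have : 0 < c * (2 * c ^ 2 - 1) := by positivity
      nlinarith [sq_nonneg (4 * c ^ 3 - 3 * c)]
    · have : 0 < 2 * c * (1 - c ^ 2) := by positivity
      linarith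

lemma Cdet_sum : Cdet 0 + Cdet 1 = 7 / 8 * (cos (π / 7) + cos (2 * π / 7)) := by
  have hm := min_poly
  have c2 : cos (2 * π / 7) = 2 * cos (π / 7) ^ 2 - 1 := by
    rw [← cos_two_mul]; congr 1; ring
  rw [c2]
  simp only [Cdet, Matrix.cons_val_zero, Matrix.cons_val_one, Matrix.cons_val_fin_one]
  generalize cos (π / 7) = c at *
  linear_combination ((7/8)*c^0 + (-11/8)*c^1 + (-15/4)*c^2 + (25/2)*c^3 + (-2)*c^4 + (-44)*c^5 + (20)*c^6 + (64)*c^7 + (-16)*c^8 + (-32)*c^9) * hm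

lemma C_zero_mem : (0 : Fin 4 → ℝ) ∈ convexHull ℝ (Set.range CV) := by
  have hm := min_poly
  have := (convex_convexHull ℝ (Set.range CV)).sum_mem
    (t := (Finset.univ : Finset (Fin 7))) (w := fun _ => 1 / 7) (z := CV)
    (by intro i _; norm_num) (by norm_num)
    (fun i _ => subset_convexHull ℝ _ ⟨i, rfl⟩)
  convert this using 1
  have c2 : cos (2 * π / 7) = 2 * cos (π / 7) ^ 2 - 1 := by
    rw [← cos_two_mul]; congr 1; ring
  have c3 : cos (3 * π / 7) = 4 * cos (π / 7) ^ 3 - 3 * cos (π / 7) := by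
    rw [← cos_three_mul]; congr 1; ring
  have c4 : cos (4 * π / 7) = - cos (3 * π / 7) := by rw [← cos_pi_sub]; congr 1; ring
  have c6 := cos6
  have p1 : tc (2 * π * 4 / 7) = tc (-(6 * π / 7)) := by
    rw [← tc_add_two_pi (-(6 * π / 7))]; congr 1; ring
  have p2 : tc (2 * π * 5 / 7) = tc (-(4 * π / 7)) := by
    rw [← tc_add_two_pi (-(4 * π / 7))]; congr 1; ring
  have p3 : tc (2 * π * 6 / 7) = tc (-(2 * π / 7)) := by
    rw [← tc_add_two_pi (-(2 * π / 7))]; congr 1; ring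
  have p4 : tc (2 * π * 1 / 7) = tc (2 * π / 7) := by congr 1; ring
  have p5 : tc (2 * π * 2 / 7) = tc (4 * π / 7) := by congr 1; ring
  have p6 : tc (2 * π * 3 / 7) = tc (6 * π / 7) := by congr 1; ring
  have p0 : tc (2 * π * 0 / 7) = tc 0 := by congr 1; ring
  have d2 : cos (2 * (2 * π / 7)) = - cos (3 * π / 7) := by rw [← c4]; congr 1; ring
  have d4 : cos (2 * (4 * π / 7)) = - cos (π / 7) := by rw [← cos_add_pi]; congr 1; ring
  have d6 : cos (2 * (6 * π / 7)) = cos (2 * π / 7) := by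
    rw [← cos_two_pi_sub]; congr 1; ring
  have hsum : 1 + 2 * (cos (2 * π / 7) + cos (4 * π / 7) + cos (6 * π / 7)) = 0 := by
    rw [c2, c4, c3, c6]; linear_combination -hm
  have hsum2 : 1 + 2 * (cos (2 * (2 * π / 7)) + cos (2 * (4 * π / 7)) +
      cos (2 * (6 * π / 7))) = 0 := by
    rw [d2, d4, d6, c2, c3]; linear_combination -hm
  have e : ∑ i, (1 / 7 : ℝ) • CV i = (1 / 7 : ℝ) • (tc 0 + (tc (2 * π / 7) + tc (-(2 * π / 7))) +
      (tc (4 * π / 7) + tc (-(4 * π / 7))) + (tc (6 * π / 7) + tc (-(6 * π / 7)))) := by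
    rw [← Finset.smul_sum]
    congr 1
    rw [← p0, ← p1, ← p2, ← p3, ← p4, ← p5, ← p6]
    simp only [Fin.sum_univ_seven, CV]
    norm_num
    abel
  rw [e]
  ext i
  fin_cases i
  · simp only [tc, cos_neg, sin_neg]
    simp
    linear_combination ((√2)⁻¹) * hsum
  · simp [tc]
  · simp only [tc, mul_neg, cos_neg, sin_neg]
    simp
    linear_combination ((√2)⁻¹) * hsum2
  · simp [tc]

lemma C_volume : volume (convexHull ℝ (Set.range CV)) =
    ENNReal.ofReal ((49 / 192) * (cos (π / 7) + cos (2 * π / 7))) := by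
  rw [polytope_volume CV CF Cl CN]
  · simp only [C_det, abs_of_pos (Cdet_pos _)]
    rw [← ENNReal.ofReal_sum_of_nonneg (fun i _ => by have := Cdet_pos i.2; positivity)]
    congr 1
    rw [Fintype.sum_prod_type]
    simp only [Fin.sum_univ_two, ← add_div, Cdet_sum]
    simp
    ring
  · rintro ⟨b, s⟩ a
    rw [CF, Cl_apply]
    fin_cases s <;> fin_cases a <;> simp [Coff, Cd, hh0, hh1]
  · rintro ⟨b, s⟩ i h
    obtain ⟨j, rfl⟩ : ∃ j, i = b + j := ⟨i - b, by simp⟩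
    have h' : ∀ a, Coff s a ≠ j := fun a ha => h a (by rw [CF, ha])
    rw [Cl_apply (b, s) j]
    have hc := Cc0_pos s
    suffices hp : 0 < hh (j : ℕ) * hh ((j : ℕ) - Cd s) by
      have := div_pos hp hc
      simp only
      linarith
    have := hh2
    have := hh3
    have := hh4
    have := hh5
    have := hh6
    have := hhn1
    have := hhn2
    have := hhn3
    fin_cases s <;> fin_cases j <;>
      first
      | (exfalso; revert h'; decide)
      | (apply mul_pos <;> simpa [Cd])
  · decide
  · decide
  · decide
  · intro k
    rw [C_det]; exact (Cdet_pos _).ne'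
  · exact C_zero_mem

theorem vol_P4_gt_vol_C4 (v : ℝ → ℝ → ℝ → ℝ → EuclideanSpace ℝ (Fin 4))
    (hv : ∀ x y z w : ℝ, v x y z w = (WithLp.equiv 2 (Fin 4 → ℝ)).symm ![x, y, z, w])
    (P₄ C₄ : Set (EuclideanSpace ℝ (Fin 4)))
    (hP₄ : P₄ = convexHull ℝ
      ((Set.range fun j : Fin 3 =>
          v (Real.cos (2 * π * (j : ℕ) / 3)) (Real.sin (2 * π * (j : ℕ) / 3)) 0 0) ∪
        {v 0 0 1 0, v 0 0 (-1) 0, v 0 0 0 1, v 0 0 0 (-1)}))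
    (hC₄ : C₄ = convexHull ℝ
      (Set.range fun i : Fin 7 =>
        v ((Real.sqrt 2)⁻¹ * Real.cos (2 * π * (i : ℕ) / 7))
          ((Real.sqrt 2)⁻¹ * Real.sin (2 * π * (i : ℕ) / 7))
          ((Real.sqrt 2)⁻¹ * Real.cos (4 * π * (i : ℕ) / 7))
          ((Real.sqrt 2)⁻¹ * Real.sin (4 * π * (i : ℕ) / 7)))) :
    (volume P₄).toReal = Real.sqrt 3 / 4 ∧
    (volume C₄).toReal = (49 / 192) * (Real.cos (π / 7) + Real.cos (2 * π / 7)) ∧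
    volume C₄ < volume P₄ := by
  have hP : volume P₄ = ENNReal.ofReal (√3 / 4) := by
    rw [hP₄, ← P_volume, ← euclid_volume]
    congr 2
    have c1 : cos (2 * π / 3) = -(1 / 2) := by
      rw [← cos_pi_div_three, ← cos_pi_sub]; congr 1; ring
    have s1 : sin (2 * π / 3) = √3 / 2 := by
      rw [← sin_pi_div_three, ← sin_pi_sub]; congr 1; ring
    have c2 : cos (2 * π * 2 / 3) = -(1 / 2) := by
      rw [← cos_pi_div_three, ← cos_add_pi]; congr 1; ring
    have s2 : sin (2 * π * 2 / 3) = -(√3 / 2) := by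
      rw [← sin_pi_div_three, ← sin_add_pi]; congr 1; ring
    ext x
    simp only [hv, Set.mem_union, Set.mem_range, Set.mem_insert_iff, Set.mem_singleton_iff,
      Set.mem_image, Fin.exists_fin_succ, PV, WithLp.equiv_symm_apply]
    simp [c1, s1, c2, s2, eq_comm, or_assoc]
  have hC : volume C₄ = ENNReal.ofReal ((49 / 192) * (cos (π / 7) + cos (2 * π / 7))) := by
    rw [hC₄, ← C_volume, ← euclid_volume, ← Set.range_comp]
    congr 3
    funext i
    have h4 : 2 * (2 * π * (i : ℕ) / 7) = 4 * π * (i : ℕ) / 7 := by ring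
    simp [hv, CV, tc, h4]
  have hm := min_poly
  have hg := c_gt
  have hl := c_lt
  have c2 : cos (2 * π / 7) = 2 * cos (π / 7) ^ 2 - 1 := by
    rw [← cos_two_mul]; congr 1; ring
  have c2p : 0 < cos (2 * π / 7) :=
    cos_pos_of_mem_Ioo ⟨by linarith [pi_pos], by linarith [pi_pos]⟩
  refine ⟨?_, ?_, ?_⟩
  · rw [hP, ENNReal.toReal_ofReal (by positivity)]
  · rw [hC, ENNReal.toReal_ofReal (by nlinarith)]
  · rw [hP, hC]
    apply (ENNReal.ofReal_lt_ofReal_iff (by positivity)).2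
    have h3 : 1.7 < √3 := by
      apply Real.lt_sqrt_of_sq_lt; norm_num
    have hc : cos (π / 7) < 0.91 := by
      by_contra h
      push Not at h
      generalize cos (π / 7) = c at *
      nlinarith [mul_nonneg (sub_nonneg.2 h) (sub_nonneg.2 h),
        mul_nonneg (mul_nonneg (sub_nonneg.2 h) (sub_nonneg.2 h)) (sub_nonneg.2 h)]
    rw [c2]
    nlinarith
end
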